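/- arXiv:2507.17167 — 5 statements merged into one kernel-verified Lean document; each statement's English description precedes it below -/
import Mathlib

section
/- Let ℓ be a positive integer, B a real number with 1 < B < ∞, and 𝒩 ⊆ ℕ an infinite set. Then the Hausdorff dimension of E′_ℓ(φ_B; 𝒩) equals the Hausdorff dimension of E′_ℓ(φ_B). -/
open MeasureTheory Filter Set

/-- The Gauss map `T(x) = 1/x - ⌊1/x⌋` (with `T 0 = 0`). -/
noncomputable def gaussMap (x : ℝ) : ℝ := if x = 0 then 0 else Int.fract x⁻¹

/-- `cfA x n` is the `n`-th partial quotient `a_n(x) = ⌊1 / T^{n-1}(x)⌋` (for `n ≥ 1`). -/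
noncomputable def cfA (x : ℝ) (n : ℕ) : ℕ := ⌊(gaussMap^[n - 1] x)⁻¹⌋₊

/-- `cfA' x n` is `a_n(x)` if it is prime, and `0` otherwise. -/
noncomputable def cfA' (x : ℝ) (n : ℕ) : ℕ := if (cfA x n).Prime then cfA x n else 0

/-- `EprimeℓN ℓ B 𝒩` is the set `E′_ℓ(φ_B; 𝒩)` of irrational `x ∈ [0,1)` such that
`a′_n(x) ⋯ a′_{n+ℓ-1}(x) ≥ B^n` for infinitely many `n ∈ 𝒩`. -/
noncomputable def EprimeℓN (ℓ : ℕ) (B : ℝ) (𝒩 : Set ℕ) : Set ℝ :=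
  {x | x ∈ Set.Ico (0 : ℝ) 1 ∧ Irrational x ∧
    {n : ℕ | n ∈ 𝒩 ∧ 1 ≤ n ∧ B ^ n ≤ ∏ i ∈ Finset.range ℓ, (cfA' x (n + i) : ℝ)}.Infinite}

namespace CFrac

/-- The composition `y ↦ 1/(a₁ + 1/(a₂ + ⋯ + 1/(a_k + y)))` attached to a word. -/
noncomputable def mob : List ℕ → ℝ → ℝ
  | [], y => y
  | a :: v, y => 1 / (a + mob v y)

/-- The denominator of the Möbius map `mob w` at `y`. -/
noncomputable def den : List ℕ → ℝ → ℝ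
  | [], _ => 1
  | a :: v, y => (a + mob v y) * den v y

lemma mob_append (u v : List ℕ) (y : ℝ) : mob (u ++ v) y = mob u (mob v y) := by
  induction u with
  | nil => rfl
  | cons a u ih => simp [mob, ih]

lemma den_append (u v : List ℕ) (y : ℝ) : den (u ++ v) y = den u (mob v y) * den v y := by
  induction u with
  | nil => simp [den]
  | cons a u ih => simp [den, ih, mob_append, mul_assoc]

lemma mob_mem {w : List ℕ} (hw : ∀ a ∈ w, 1 ≤ a) {y : ℝ} (hy : y ∈ Icc (0 : ℝ) 1) :
    mob w y ∈ Icc (0 : ℝ) 1 := by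
  induction w with
  | nil => exact hy
  | cons a v ih =>
    have h := ih fun b hb => hw b (List.mem_cons_of_mem _ hb)
    have ha : (1 : ℝ) ≤ a := by exact_mod_cast hw a (by simp)
    simp only [mob]
    exact ⟨div_nonneg zero_le_one (by linarith [h.1]), by
      rw [div_le_one (by linarith [h.1])]; linarith [h.1]⟩

lemma one_le_den {w : List ℕ} (hw : ∀ a ∈ w, 1 ≤ a) {y : ℝ} (hy : y ∈ Icc (0 : ℝ) 1) :
    1 ≤ den w y := by
  induction w with
  | nil => exact le_rfl
  | cons a v ih =>
    have hv : ∀ b ∈ v, 1 ≤ b := fun b hb => hw b (List.mem_cons_of_mem _ hb)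
    have h := ih hv
    have h1 := (mob_mem hv hy).1
    have ha : (1 : ℝ) ≤ a := by exact_mod_cast hw a (by simp)
    simp only [den]
    nlinarith

lemma abs_mob_sub {w : List ℕ} (hw : ∀ a ∈ w, 1 ≤ a) {y z : ℝ} (hy : y ∈ Icc (0 : ℝ) 1)
    (hz : z ∈ Icc (0 : ℝ) 1) :
    |mob w y - mob w z| = |y - z| / (den w y * den w z) := by
  induction w with
  | nil => simp [mob, den]
  | cons a v ih =>
    have hv : ∀ b ∈ v, 1 ≤ b := fun b hb => hw b (List.mem_cons_of_mem _ hb)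
    have h := ih hv
    have h1 := (mob_mem hv hy).1
    have h2 := (mob_mem hv hz).1
    have ha : (1 : ℝ) ≤ a := by exact_mod_cast hw a (by simp)
    have p1 : 0 < a + mob v y := by linarith
    have p2 : 0 < a + mob v z := by linarith
    have e : 1 / (a + mob v y) - 1 / (a + mob v z)
        = -(mob v y - mob v z) / ((a + mob v y) * (a + mob v z)) := by
      field_simp; ring
    have d1 := one_le_den hv hy
    have d2 := one_le_den hv hz
    simp only [mob, den]
    rw [e, abs_div, abs_neg, h, abs_of_pos (mul_pos p1 p2)]
    field_simp

lemma exists_affine {w : List ℕ} (hw : ∀ a ∈ w, 1 ≤ a) :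
    ∃ p' p q' q : ℝ, 0 ≤ p' ∧ 0 ≤ p ∧ 0 ≤ q' ∧ 0 ≤ q ∧ q' ≤ q ∧ p' + q' ≤ p + q ∧
      ∀ y ∈ Icc (0 : ℝ) 1, mob w y * den w y = p' * y + p ∧ den w y = q' * y + q := by
  induction w with
  | nil => exact ⟨1, 0, 0, 1, by norm_num, by norm_num, by norm_num, by norm_num, by norm_num,
      by norm_num, fun y _ => by simp [mob, den]⟩
  | cons a v ih =>
    have hv : ∀ b ∈ v, 1 ≤ b := fun b hb => hw b (List.mem_cons_of_mem _ hb)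
    obtain ⟨p', p, q', q, hp', hp, hq', hq, h1, h2, h⟩ := ih hv
    have ha : (1 : ℝ) ≤ a := by exact_mod_cast hw a (by simp)
    refine ⟨q', q, a * q' + p', a * q + p, hq', hq, by positivity, by positivity, by nlinarith,
      by nlinarith, fun y hy => ?_⟩
    obtain ⟨e1, e2⟩ := h y hy
    have := (mob_mem hv hy).1
    have p1 : 0 < a + mob v y := by linarith
    simp only [mob, den]
    constructor
    · rw [← e2]; field_simp
    · rw [add_mul, e1, e2]; ring

lemma den_zero_le {w : List ℕ} (hw : ∀ a ∈ w, 1 ≤ a) {y : ℝ} (hy : y ∈ Icc (0 : ℝ) 1) :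
    den w 0 ≤ den w y := by
  obtain ⟨p', p, q', q, hp', hp, hq', hq, h1, h2, h⟩ := exists_affine hw
  rw [(h 0 (by simp)).2, (h y hy).2]
  nlinarith [hy.1]

lemma den_le_two_mul {w : List ℕ} (hw : ∀ a ∈ w, 1 ≤ a) {y : ℝ} (hy : y ∈ Icc (0 : ℝ) 1) :
    den w y ≤ 2 * den w 0 := by
  obtain ⟨p', p, q', q, hp', hp, hq', hq, h1, h2, h⟩ := exists_affine hw
  rw [(h 0 (by simp)).2, (h y hy).2]
  nlinarith [hy.1, hy.2]

lemma mul_den_le_den_append {u v : List ℕ} (hu : ∀ a ∈ u, 1 ≤ a) (hv : ∀ a ∈ v, 1 ≤ a) :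
    den u 0 * den v 0 ≤ den (u ++ v) 0 := by
  rw [den_append]
  have := one_le_den hv (y := 0) (by simp)
  exact mul_le_mul_of_nonneg_right (den_zero_le hu (mob_mem hv (by simp))) (by linarith)

lemma den_append_le {u v : List ℕ} (hu : ∀ a ∈ u, 1 ≤ a) (hv : ∀ a ∈ v, 1 ≤ a) :
    den (u ++ v) 0 ≤ 2 * den u 0 * den v 0 := by
  rw [den_append]
  have := one_le_den hv (y := 0) (by simp)
  exact mul_le_mul_of_nonneg_right (den_le_two_mul hu (mob_mem hv (by simp))) (by linarith)

lemma prod_le_den {w : List ℕ} (hw : ∀ a ∈ w, 1 ≤ a) : ((w.prod : ℕ) : ℝ) ≤ den w 0 := by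
  induction w with
  | nil => simp [den]
  | cons a v ih =>
    have hv : ∀ b ∈ v, 1 ≤ b := fun b hb => hw b (List.mem_cons_of_mem _ hb)
    have := (mob_mem hv (y := 0) (by simp)).1
    have h1 := one_le_den hv (y := 0) (by simp)
    simp only [den, List.prod_cons, Nat.cast_mul]
    exact mul_le_mul (by linarith) (ih hv) (by positivity) (by positivity)

/-- The prefix of length `n` of a digit sequence. -/
def pre (a : ℕ → ℕ) (n : ℕ) : List ℕ := List.ofFn fun i : Fin n => a i

/-- The shifted sequence. -/
def shift (n : ℕ) (a : ℕ → ℕ) : ℕ → ℕ := fun i => a (n + i)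

/-- The continuant of the prefix of length `n`. -/
noncomputable def cont (a : ℕ → ℕ) (n : ℕ) : ℝ := den (pre a n) 0

lemma pre_zero (a : ℕ → ℕ) : pre a 0 = [] := by simp [pre]

lemma pre_add (a : ℕ → ℕ) (n k : ℕ) : pre a (n + k) = pre a n ++ pre (shift n a) k := by
  simp [pre, shift, List.ofFn_add]

lemma pre_succ' (a : ℕ → ℕ) (n : ℕ) : pre a (n + 1) = a 0 :: pre (shift 1 a) n := by
  simp [pre, shift, List.ofFn_succ, add_comm]

lemma pre_succ (a : ℕ → ℕ) (n : ℕ) : pre a (n + 1) = pre a n ++ [a n] := by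
  rw [pre_add]; simp [pre, shift]

lemma pre_congr {a b : ℕ → ℕ} {n : ℕ} (h : ∀ i < n, a i = b i) : pre a n = pre b n := by
  simp only [pre]
  congr 1
  funext i
  exact h i i.2

lemma mem_pre {a : ℕ → ℕ} (ha : ∀ i, 1 ≤ a i) (n : ℕ) : ∀ b ∈ pre a n, 1 ≤ b := by
  intro b hb
  simp only [pre, List.mem_ofFn] at hb
  obtain ⟨i, rfl⟩ := hb
  exact ha i

lemma one_le_cont {a : ℕ → ℕ} (ha : ∀ i, 1 ≤ a i) (n : ℕ) : 1 ≤ cont a n :=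
  one_le_den (mem_pre ha n) (by simp)

lemma cont_add_le {a : ℕ → ℕ} (ha : ∀ i, 1 ≤ a i) (n k : ℕ) :
    cont a (n + k) ≤ 2 * cont a n * cont (shift n a) k := by
  rw [cont, pre_add]
  exact den_append_le (mem_pre ha n) (mem_pre (fun i => ha _) k)

lemma le_cont_add {a : ℕ → ℕ} (ha : ∀ i, 1 ≤ a i) (n k : ℕ) :
    cont a n * cont (shift n a) k ≤ cont a (n + k) := by
  rw [cont, cont, cont, pre_add]
  exact mul_den_le_den_append (mem_pre ha n) (mem_pre (fun i => ha _) k)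

lemma cont_succ_le {a : ℕ → ℕ} (ha : ∀ i, 1 ≤ a i) (n : ℕ) :
    cont a (n + 1) ≤ 2 * a n * cont a n := by
  have := cont_add_le ha n 1
  have e : cont (shift n a) 1 = a n := by simp [cont, pre, shift, den, mob]
  rw [e] at this
  linarith

lemma cont_le_succ {a : ℕ → ℕ} (ha : ∀ i, 1 ≤ a i) (n : ℕ) : cont a n ≤ cont a (n + 1) := by
  have := le_cont_add ha n 1
  have h1 := one_le_cont (a := shift n a) (fun i => ha _) 1
  have h2 := one_le_cont ha n
  nlinarith

lemma two_pow_le_cont {a : ℕ → ℕ} (ha : ∀ i, 1 ≤ a i) (n : ℕ) : (2 : ℝ) ^ (n / 2) ≤ cont a n := by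
  have key : ∀ k, (2 : ℝ) ^ k ≤ cont a (2 * k) := by
    intro k
    induction k with
    | zero => simpa using one_le_cont ha 0
    | succ k ih =>
      have h := le_cont_add ha (2 * k) 2
      have e : cont (shift (2 * k) a) 2 = a (2 * k) * a (2 * k + 1) + 1 := by
        have : (1 : ℝ) ≤ a (2 * k + 1) := by exact_mod_cast ha _
        simp [cont, pre, shift, den, mob]
        field_simp
      have h1 : (1 : ℝ) ≤ a (2 * k) := by exact_mod_cast ha _
      have h2 : (1 : ℝ) ≤ a (2 * k + 1) := by exact_mod_cast ha _
      have h3 : 2 ≤ cont (shift (2 * k) a) 2 := by rw [e]; nlinarith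
      calc (2 : ℝ) ^ (k + 1) = 2 ^ k * 2 := pow_succ _ _
        _ ≤ cont a (2 * k) * cont (shift (2 * k) a) 2 :=
          mul_le_mul ih h3 (by norm_num) (by linarith [one_le_cont ha (2 * k)])
        _ ≤ _ := h
  refine (key (n / 2)).trans ?_
  rcases Nat.even_or_odd' n with ⟨c, rfl | rfl⟩
  · simp
  · have : (2 * c + 1) / 2 = c := by omega
    rw [this]; exact cont_le_succ ha _

lemma abs_mob_sub_le {w : List ℕ} (hw : ∀ a ∈ w, 1 ≤ a) {y z : ℝ} (hy : y ∈ Icc (0 : ℝ) 1)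
    (hz : z ∈ Icc (0 : ℝ) 1) :
    |mob w y - mob w z| ≤ |y - z| / den w 0 ^ 2 := by
  have h0 := one_le_den hw (y := 0) (by simp)
  rw [abs_mob_sub hw hy hz]
  have h1 := den_zero_le hw hy
  have h2 := den_zero_le hw hz
  have : den w 0 ^ 2 ≤ den w y * den w z := by
    rw [sq]; exact mul_le_mul h1 h2 (by linarith) (by linarith)
  gcongr

/-- The value of the infinite continued fraction `[a 0, a 1, …]`. -/
noncomputable def val (a : ℕ → ℕ) : ℝ := limUnder atTop fun n => mob (pre a n) 0

lemma shift_shift (m n : ℕ) (a : ℕ → ℕ) : shift m (shift n a) = shift (n + m) a := by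
  funext i; simp [shift, add_assoc]

lemma shift_zero (a : ℕ → ℕ) : shift 0 a = a := by
  funext i; simp [shift]

lemma shift_apply_zero (n : ℕ) (a : ℕ → ℕ) : shift n a 0 = a n := rfl

lemma tendsto_val {a : ℕ → ℕ} (ha : ∀ i, 1 ≤ a i) :
    Tendsto (fun n => mob (pre a n) 0) atTop (nhds (val a)) := by
  have hc : CauchySeq fun n => mob (pre a n) 0 := by
    refine cauchySeq_of_le_tendsto_0 (fun n => 2 * ((2 : ℝ) ^ (n / 2))⁻¹) ?_ ?_
    · have key : ∀ n k, n ≤ k → |mob (pre a k) 0 - mob (pre a n) 0| ≤ ((2 : ℝ) ^ (n / 2))⁻¹ := by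
        intro n k hk
        obtain ⟨j, rfl⟩ := Nat.exists_eq_add_of_le hk
        have hm := mob_mem (mem_pre (a := shift n a) (fun i => ha _) j) (y := 0) (by simp)
        rw [pre_add, mob_append]
        refine (abs_mob_sub_le (mem_pre ha n) hm (by simp)).trans ?_
        have h1 := two_pow_le_cont ha n
        have h2 := one_le_cont ha n
        have h3 : |mob (pre (shift n a) j) 0 - 0| ≤ 1 := by
          rw [sub_zero, abs_le]; exact ⟨by linarith [hm.1], hm.2⟩
        have h4 : (2 : ℝ) ^ (n / 2) ≤ den (pre a n) 0 ^ 2 := by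
          change _ ≤ cont a n ^ 2
          nlinarith
        rw [← one_div]
        gcongr
      intro n m N hn hm
      rw [Real.dist_eq]
      have := abs_sub_le (mob (pre a n) 0) (mob (pre a N) 0) (mob (pre a m) 0)
      have h1 := key N n hn
      have h2 := key N m hm
      rw [abs_sub_comm] at h2
      linarith
    · have h1 : Tendsto (fun k : ℕ => ((2 : ℝ) ^ k)⁻¹) atTop (nhds 0) :=
        tendsto_inv_atTop_zero.comp (tendsto_pow_atTop_atTop_of_one_lt (by norm_num))
      have h2 : Tendsto (fun n : ℕ => n / 2) atTop atTop := by
        refine tendsto_atTop_atTop.2 fun b => ⟨2 * b, fun n hn => by omega⟩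
      simpa using (h1.comp h2).const_mul 2
  exact hc.tendsto_limUnder

lemma val_mem_Icc {a : ℕ → ℕ} (ha : ∀ i, 1 ≤ a i) : val a ∈ Icc (0 : ℝ) 1 :=
  isClosed_Icc.mem_of_tendsto (tendsto_val ha)
    (Eventually.of_forall fun n => mob_mem (mem_pre ha n) (by simp))

lemma val_eq_mob {a : ℕ → ℕ} (ha : ∀ i, 1 ≤ a i) (n : ℕ) :
    val a = mob (pre a n) (val (shift n a)) := by
  have hs : ∀ i, 1 ≤ shift n a i := fun i => ha _
  have h1 : Tendsto (fun k => mob (pre a (k + n)) 0) atTop (nhds (val a)) :=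
    (tendsto_add_atTop_iff_nat n).2 (tendsto_val ha)
  refine tendsto_nhds_unique h1 ?_
  rw [tendsto_iff_dist_tendsto_zero]
  have h2 := tendsto_iff_dist_tendsto_zero.1 (tendsto_val hs)
  refine squeeze_zero (fun _ => dist_nonneg) (fun k => ?_) h2
  rw [add_comm k n, pre_add, mob_append, Real.dist_eq, Real.dist_eq]
  refine (abs_mob_sub_le (mem_pre ha n) (mob_mem (mem_pre hs k) (by simp))
    (val_mem_Icc hs)).trans ?_
  refine div_le_self (abs_nonneg _) ?_
  have := one_le_cont ha n
  change 1 ≤ cont a n ^ 2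
  nlinarith

lemma val_eq {a : ℕ → ℕ} (ha : ∀ i, 1 ≤ a i) : val a = 1 / (a 0 + val (shift 1 a)) := by
  conv_lhs => rw [val_eq_mob ha 1]
  simp [pre, mob]

lemma val_pos {a : ℕ → ℕ} (ha : ∀ i, 1 ≤ a i) : 0 < val a := by
  rw [val_eq ha]
  have := (val_mem_Icc (a := shift 1 a) fun i => ha _).1
  have h1 : (1 : ℝ) ≤ a 0 := by exact_mod_cast ha 0
  positivity

lemma val_lt_one {a : ℕ → ℕ} (ha : ∀ i, 1 ≤ a i) : val a < 1 := by
  rw [val_eq ha]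
  have := val_pos (a := shift 1 a) fun i => ha _
  have h1 : (1 : ℝ) ≤ a 0 := by exact_mod_cast ha 0
  rw [div_lt_one (by linarith)]
  linarith

lemma inv_val {a : ℕ → ℕ} (ha : ∀ i, 1 ≤ a i) : (val a)⁻¹ = a 0 + val (shift 1 a) := by
  rw [val_eq ha, one_div, inv_inv]

lemma gaussMap_val {a : ℕ → ℕ} (ha : ∀ i, 1 ≤ a i) : gaussMap (val a) = val (shift 1 a) := by
  have hs : ∀ i, 1 ≤ shift 1 a i := fun i => ha _
  rw [gaussMap, if_neg (val_pos ha).ne', inv_val ha, Int.fract_natCast_add,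
    Int.fract_eq_self.2 ⟨(val_pos hs).le, val_lt_one hs⟩]

lemma iterate_gaussMap_val {a : ℕ → ℕ} (ha : ∀ i, 1 ≤ a i) (n : ℕ) :
    gaussMap^[n] (val a) = val (shift n a) := by
  induction n with
  | zero => rw [shift_zero]; rfl
  | succ n ih =>
    rw [Function.iterate_succ_apply', ih, gaussMap_val (a := shift n a) fun i => ha _,
      shift_shift]

lemma cfA_val {a : ℕ → ℕ} (ha : ∀ i, 1 ≤ a i) (n : ℕ) : cfA (val a) (n + 1) = a n := by
  have hs : ∀ i, 1 ≤ shift n a i := fun i => ha _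
  have hs' : ∀ i, 1 ≤ shift (n + 1) a i := fun i => ha _
  rw [cfA, Nat.add_sub_cancel, iterate_gaussMap_val ha, inv_val hs, shift_shift,
    add_comm, Nat.floor_add_natCast (val_pos hs').le, Nat.floor_eq_zero.2 (val_lt_one hs')]
  simp [shift]

lemma val_mul_ne {d : ℕ} (hd : 0 < d) :
    ∀ {a : ℕ → ℕ}, (∀ i, 1 ≤ a i) → ∀ p : ℕ, val a * d ≠ p := by
  induction d using Nat.strong_induction_on with
  | _ d ih =>
    intro a ha p h
    have hs : ∀ i, 1 ≤ shift 1 a i := fun i => ha _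
    have hd' : (0 : ℝ) < d := by exact_mod_cast hd
    have hv := val_pos ha
    have hv1 := val_lt_one ha
    have hp : 0 < p := by
      have : (0 : ℝ) < p := by rw [← h]; positivity
      exact_mod_cast this
    have hpd : p < d := by
      have : (p : ℝ) < d := by rw [← h]; nlinarith
      exact_mod_cast this
    have e := inv_val ha
    have h2 : val (shift 1 a) * p = d - a 0 * p := by
      have : (d : ℝ) = (val a)⁻¹ * p := by rw [← h]; field_simp
      rw [this, e]; ring
    have h3 : a 0 * p ≤ d := by
      have h4 : (0 : ℝ) ≤ val (shift 1 a) * p := by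
        have := val_pos hs; positivity
      rw [h2] at h4
      have : ((a 0 * p : ℕ) : ℝ) ≤ d := by push_cast; linarith
      exact_mod_cast this
    refine ih p hpd hp hs (d - a 0 * p) ?_
    rw [h2, Nat.cast_sub h3]; push_cast; ring

lemma irrational_val {a : ℕ → ℕ} (ha : ∀ i, 1 ≤ a i) : Irrational (val a) := by
  rintro ⟨r, hr⟩
  have hr0 : 0 ≤ r := by
    have : (0 : ℝ) ≤ r := by rw [hr]; exact (val_pos ha).le
    exact_mod_cast this
  refine val_mul_ne r.pos ha r.num.toNat ?_
  rw [← hr]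
  have h1 : ((r * r.den : ℚ) : ℝ) = ((r.num : ℚ) : ℝ) := by rw [Rat.mul_den_eq_num]
  have h2 : ((r.num.toNat : ℕ) : ℤ) = r.num := Int.toNat_of_nonneg (Rat.num_nonneg.2 hr0)
  have h3 : ((r.num.toNat : ℕ) : ℝ) = ((r.num : ℤ) : ℝ) := by exact_mod_cast h2
  rw [h3]
  push_cast at h1
  exact h1

lemma measurable_mob_pre (n : ℕ) : Measurable fun a : ℕ → ℕ => mob (pre a n) 0 := by
  induction n with
  | zero => simp [pre_zero, mob]
  | succ n ih =>
    simp only [pre_succ', mob]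
    have hs : Measurable (shift 1) := measurable_pi_lambda _ fun i => measurable_pi_apply _
    have h0 : Measurable fun a : ℕ → ℕ => (a 0 : ℝ) :=
      (measurable_from_top (f := fun k : ℕ => (k : ℝ))).comp (measurable_pi_apply 0)
    exact measurable_const.div (h0.add (ih.comp hs))

/-- Points whose first different digits are `a n ≠ b n` are far apart, provided that the following
tails stay away from `1`. -/
lemma le_abs_val_sub {a b : ℕ → ℕ} (ha : ∀ i, 1 ≤ a i) (hb : ∀ i, 1 ≤ b i) {n H : ℕ} {δ : ℝ}
    (hδ : 0 < δ) (h : ∀ i < n, a i = b i) (hne : a n ≠ b n) (hHa : a n ≤ H) (hHb : b n ≤ H)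
    (hda : val (shift (n + 1) a) ≤ 1 - δ) (hdb : val (shift (n + 1) b) ≤ 1 - δ) :
    δ * |(a n : ℝ) - b n| / (16 * H ^ 2 * cont a n ^ 2) ≤ |val a - val b| := by
  have hsa : ∀ i, 1 ≤ shift n a i := fun i => ha _
  have hsb : ∀ i, 1 ≤ shift n b i := fun i => hb _
  have ma := val_mem_Icc hsa
  have mb := val_mem_Icc hsb
  rw [val_eq_mob ha n, val_eq_mob hb n, ← pre_congr h, abs_mob_sub (mem_pre ha n) ma mb]
  have d1 := den_le_two_mul (mem_pre ha n) ma
  have d2 := den_le_two_mul (mem_pre ha n) mb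
  have e1 := one_le_den (mem_pre ha n) ma
  have e2 := one_le_den (mem_pre ha n) mb
  change _ ≤ 2 * cont a n at d1
  change _ ≤ 2 * cont a n at d2
  rw [val_eq hsa, val_eq hsb, shift_shift, shift_shift]
  rw [val_eq hsa, shift_shift] at d1 e1
  rw [val_eq hsb, shift_shift] at d2 e2
  rw [shift_apply_zero] at d1 d2 e1 e2
  rw [shift_apply_zero, shift_apply_zero]
  have u0 : 0 < val (shift (n + 1) a) := val_pos fun i => ha _
  have v0 : 0 < val (shift (n + 1) b) := val_pos fun i => hb _
  set u := val (shift (n + 1) a)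
  set v := val (shift (n + 1) b)
  have a1 : (1 : ℝ) ≤ a n := by exact_mod_cast ha n
  have b1 : (1 : ℝ) ≤ b n := by exact_mod_cast hb n
  have aH : (a n : ℝ) ≤ H := by exact_mod_cast hHa
  have bH : (b n : ℝ) ≤ H := by exact_mod_cast hHb
  have hab : (1 : ℝ) ≤ |(a n : ℝ) - b n| := by
    have : (1 : ℤ) ≤ |(a n : ℤ) - b n| := Int.one_le_abs (by omega)
    exact_mod_cast this
  have e : (1 : ℝ) / (a n + u) - 1 / (b n + v) = -(a n - b n + (u - v)) / ((a n + u) * (b n + v)) := by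
    field_simp; ring
  have huv : |u - v| ≤ 1 - δ := by rw [abs_le]; constructor <;> linarith
  have hnum : δ * |(a n : ℝ) - b n| ≤ |(a n : ℝ) - b n + (u - v)| := by
    have h1 := abs_sub_abs_le_abs_add ((a n : ℝ) - b n) (u - v)
    have h2 : 0 ≤ 1 - δ := (abs_nonneg _).trans huv
    nlinarith
  rw [e, abs_div, abs_neg, abs_of_pos (a := ((a n : ℝ) + u) * (b n + v)) (by positivity), div_div]
  have c1 := one_le_cont ha n
  apply div_le_div₀ (abs_nonneg _) hnum
  · have : 0 < den (pre a n) (1 / (a n + u)) * den (pre a n) (1 / (b n + v)) := by nlinarith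
    positivity
  · have h1 : ((a n : ℝ) + u) * (b n + v) ≤ (2 * H) * (2 * H) :=
      mul_le_mul (by linarith) (by linarith) (by linarith) (by linarith)
    have h2 : den (pre a n) (1 / (a n + u)) * den (pre a n) (1 / (b n + v))
        ≤ (2 * cont a n) * (2 * cont a n) :=
      mul_le_mul d1 d2 (by linarith) (by linarith)
    calc _ ≤ (2 * (H : ℝ)) * (2 * H) * ((2 * cont a n) * (2 * cont a n)) :=
          mul_le_mul h1 h2 (by nlinarith) (by nlinarith)
      _ = _ := by ring

lemma exists_spread {A : Finset ℕ} (hA : A.Nonempty) :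
    ∃ i ∈ A, ∃ j ∈ A, i ≤ j ∧ A.card ≤ j - i + 1 := by
  refine ⟨A.min' hA, A.min'_mem hA, A.max' hA, A.max'_mem hA, A.min'_le _ (A.max'_mem hA), ?_⟩
  have : A ⊆ Finset.Icc (A.min' hA) (A.max' hA) := fun x hx =>
    Finset.mem_Icc.2 ⟨A.min'_le _ hx, A.le_max' _ hx⟩
  have h := Finset.card_le_card this
  rw [Nat.card_Icc] at h
  have := A.min'_le _ (A.max'_mem hA)
  omega

lemma tendsto_two_pow_half_inv :
    Tendsto (fun n : ℕ => ((2 : ℝ) ^ (n / 2))⁻¹) atTop (nhds 0) := by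
  have h1 : Tendsto (fun k : ℕ => ((2 : ℝ) ^ k)⁻¹) atTop (nhds 0) :=
    tendsto_inv_atTop_zero.comp (tendsto_pow_atTop_atTop_of_one_lt (by norm_num))
  have h2 : Tendsto (fun n : ℕ => n / 2) atTop atTop :=
    tendsto_atTop_atTop.2 fun b => ⟨2 * b, fun n hn => by omega⟩
  exact h1.comp h2

lemma aemeasurable_val {P : Measure (ℕ → ℕ)} (h : ∀ᵐ a ∂P, ∀ i, 1 ≤ a i) : AEMeasurable val P :=
  aemeasurable_of_tendsto_metrizable_ae atTop (fun n => (measurable_mob_pre n).aemeasurable)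
    (h.mono fun _ ha => tendsto_val ha)

section MassDistribution

variable {P : Measure (ℕ → ℕ)} {Ω : Set (ℕ → ℕ)} {H : ℕ → ℕ} {δ s C : ℝ}

/-- The measure of the set of digit sequences coding points of `U` is controlled by the
diameter of `U`. -/
lemma measure_coding_le (hpos : ∀ a ∈ Ω, ∀ n, 1 ≤ a n) (hH : ∀ a ∈ Ω, ∀ n, a n ≤ H n)
    (hδ : 0 < δ) (hsep : ∀ a ∈ Ω, ∀ n, val (shift n a) ≤ 1 - δ) (hs : 0 < s) (hC : 0 < C)
    (hP : ∀ a ∈ Ω, ∀ n, ∀ A : Finset ℕ, A.Nonempty →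
      P {b | (∀ i < n, b i = a i) ∧ b n ∈ A} ≤
        ENNReal.ofReal (C * ((A.card : ℝ) / (H n ^ 2 * cont a n ^ 2)) ^ s)) (U : Set ℝ) :
    P {a | a ∈ Ω ∧ val a ∈ U} ≤ ENNReal.ofReal (C * (32 / δ) ^ s) * Metric.ediam U ^ s := by
  rcases eq_empty_or_nonempty {a | a ∈ Ω ∧ val a ∈ U} with hV | ⟨a, haΩ, haU⟩
  · rw [hV]; simp
  by_cases hall : ∀ b ∈ {a | a ∈ Ω ∧ val a ∈ U}, ∀ n, b n = a n
  · have hzero : P {a | a ∈ Ω ∧ val a ∈ U} ≤ 0 := by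
      have hb : ∀ n : ℕ, P {a | a ∈ Ω ∧ val a ∈ U} ≤
          ENNReal.ofReal (C * (((2 : ℝ) ^ (n / 2))⁻¹) ^ s) := by
        intro n
        refine (measure_mono ?_).trans ((hP a haΩ n {a n} (by simp)).trans ?_)
        · intro b hb
          exact ⟨fun i _ => hall b hb i, by simp [hall b hb n]⟩
        · apply ENNReal.ofReal_le_ofReal
          have h1 := two_pow_le_cont (hpos a haΩ) n
          have h2 := one_le_cont (hpos a haΩ) n
          have h3 : (1 : ℝ) ≤ H n := by exact_mod_cast (hpos a haΩ n).trans (hH a haΩ n)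
          have h4 : (2 : ℝ) ^ (n / 2) ≤ H n ^ 2 * cont a n ^ 2 := by
            have : (1 : ℝ) ≤ H n ^ 2 := by nlinarith
            nlinarith
          have : ((({a n} : Finset ℕ).card : ℝ) / (H n ^ 2 * cont a n ^ 2)) ≤
              ((2 : ℝ) ^ (n / 2))⁻¹ := by
            rw [Finset.card_singleton, Nat.cast_one, one_div]
            gcongr
          gcongr
      refine ge_of_tendsto' (x := atTop) ?_ hb
      have h1 := tendsto_two_pow_half_inv.rpow_const (p := s) (Or.inr hs.le)
      rw [Real.zero_rpow hs.ne'] at h1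
      have h2 := ENNReal.tendsto_ofReal (h1.const_mul C)
      simpa using h2
    exact hzero.trans zero_le
  · push Not at hall
    have hex : ∃ n, ∃ b ∈ {a | a ∈ Ω ∧ val a ∈ U}, b n ≠ a n := by
      obtain ⟨b, hb, n, hn⟩ := hall; exact ⟨n, b, hb, hn⟩
    classical
    let n := Nat.find hex
    have hmin : ∀ b ∈ {a | a ∈ Ω ∧ val a ∈ U}, ∀ i < n, b i = a i := by
      intro b hb i hi
      by_contra hne
      exact Nat.find_min hex hi ⟨b, hb, hne⟩
    obtain ⟨c, hc, hcn⟩ : ∃ b ∈ {a | a ∈ Ω ∧ val a ∈ U}, b n ≠ a n := Nat.find_spec hex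
    let A : Finset ℕ := (Finset.range (H n + 1)).filter
      fun k => ∃ b ∈ {a | a ∈ Ω ∧ val a ∈ U}, b n = k
    have hmemA : ∀ b ∈ {a | a ∈ Ω ∧ val a ∈ U}, b n ∈ A := fun b hb =>
      Finset.mem_filter.2 ⟨Finset.mem_range.2 (Nat.lt_succ_of_le (hH b hb.1 n)), b, hb, rfl⟩
    have hA : A.Nonempty := ⟨a n, hmemA a ⟨haΩ, haU⟩⟩
    have hcard : 2 ≤ A.card := by
      have : 1 < A.card :=
        Finset.one_lt_card.2 ⟨c n, hmemA c hc, a n, hmemA a ⟨haΩ, haU⟩, hcn⟩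
      omega
    obtain ⟨i, hi, j, hj, hij, hle⟩ := exists_spread hA
    obtain ⟨b, hb, rfl⟩ := (Finset.mem_filter.1 hi).2
    obtain ⟨b', hb', rfl⟩ := (Finset.mem_filter.1 hj).2
    have hne : b n ≠ b' n := by omega
    have hdist := le_abs_val_sub (hpos b hb.1) (hpos b' hb'.1) hδ
      (fun i hi => (hmin b hb i hi).trans (hmin b' hb' i hi).symm) hne (hH b hb.1 n)
      (hH b' hb'.1 n) (hsep b hb.1 _) (hsep b' hb'.1 _)
    have hcont : cont b n = cont a n := by
      rw [cont, cont, pre_congr (hmin b hb)]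
    rw [hcont] at hdist
    have h2 := one_le_cont (hpos a haΩ) n
    have h3 : (1 : ℝ) ≤ H n := by exact_mod_cast (hpos a haΩ n).trans (hH a haΩ n)
    set d := |val b - val b'| with hd
    have hdiff : (A.card : ℝ) / 2 ≤ |(b n : ℝ) - b' n| := by
      have h5 : (A.card : ℝ) + b n ≤ b' n + 1 := by
        have : A.card + b n ≤ b' n + 1 := by omega
        exact_mod_cast this
      have h6 : (2 : ℝ) ≤ A.card := by exact_mod_cast hcard
      rw [abs_sub_comm]
      refine le_trans ?_ (le_abs_self _)
      linarith
    have hmain : (A.card : ℝ) / (H n ^ 2 * cont a n ^ 2) ≤ 32 / δ * d := by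
      have h7 : δ * ((A.card : ℝ) / 2) / (16 * H n ^ 2 * cont a n ^ 2) ≤ d :=
        le_trans (by gcongr) hdist
      calc (A.card : ℝ) / (H n ^ 2 * cont a n ^ 2)
          = 32 / δ * (δ * ((A.card : ℝ) / 2) / (16 * H n ^ 2 * cont a n ^ 2)) := by
            field_simp; ring
        _ ≤ 32 / δ * d := by gcongr
    have hd0 : 0 ≤ d := abs_nonneg _
    calc P {a | a ∈ Ω ∧ val a ∈ U} ≤ P {b | (∀ i < n, b i = a i) ∧ b n ∈ A} :=
          measure_mono fun b hb => ⟨hmin b hb, hmemA b hb⟩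
      _ ≤ ENNReal.ofReal (C * ((A.card : ℝ) / (H n ^ 2 * cont a n ^ 2)) ^ s) := hP a haΩ n A hA
      _ ≤ ENNReal.ofReal (C * (32 / δ) ^ s * d ^ s) := by
          apply ENNReal.ofReal_le_ofReal
          rw [mul_assoc, ← Real.mul_rpow (by positivity) hd0]
          gcongr
      _ = ENNReal.ofReal (C * (32 / δ) ^ s) * ENNReal.ofReal d ^ s := by
          rw [ENNReal.ofReal_mul (by positivity), ENNReal.ofReal_rpow_of_nonneg hd0 hs.le]
      _ ≤ _ := by
          gcongr
          rw [hd, ← Real.dist_eq, ← edist_dist]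
          exact Metric.edist_le_ediam_of_mem hb.2 hb'.2

/-- A mass distribution principle for sets of continued fractions. -/
theorem le_dimH_of_measure [IsProbabilityMeasure P] (hΩ : ∀ᵐ a ∂P, a ∈ Ω)
    (hpos : ∀ a ∈ Ω, ∀ n, 1 ≤ a n) (hH : ∀ a ∈ Ω, ∀ n, a n ≤ H n)
    (hδ : 0 < δ) (hsep : ∀ a ∈ Ω, ∀ n, val (shift n a) ≤ 1 - δ) (hs : 0 < s) (hC : 0 < C)
    (hP : ∀ a ∈ Ω, ∀ n, ∀ A : Finset ℕ, A.Nonempty →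
      P {b | (∀ i < n, b i = a i) ∧ b n ∈ A} ≤
        ENNReal.ofReal (C * ((A.card : ℝ) / (H n ^ 2 * cont a n ^ 2)) ^ s))
    {E : Set ℝ} (hE : ∀ a ∈ Ω, val a ∈ E) : ENNReal.ofReal s ≤ dimH E := by
  have hm : AEMeasurable val P := aemeasurable_val (hΩ.mono hpos)
  set K : ENNReal := ENNReal.ofReal (C * (32 / δ) ^ s) with hK
  have hK0 : K ≠ 0 := by
    rw [hK, Ne, ENNReal.ofReal_eq_zero, not_le]; positivity
  have hKt : K ≠ ⊤ := ENNReal.ofReal_ne_top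
  have hle : K⁻¹ • P.map val ≤ μH[s] := by
    refine Measure.le_hausdorffMeasure s _ 1 one_pos fun U _ => ?_
    rw [Measure.smul_apply, smul_eq_mul]
    have h1 : P.map val U ≤ K * Metric.ediam U ^ s := by
      refine (measure_mono subset_closure).trans ?_
      rw [Measure.map_apply_of_aemeasurable hm isClosed_closure.measurableSet,
        ← Metric.ediam_closure U]
      refine le_trans (measure_mono_ae ?_)
        (measure_coding_le hpos hH hδ hsep hs hC hP (closure U))
      filter_upwards [hΩ] with a ha hU
      exact ⟨ha, hU⟩
    calc K⁻¹ * P.map val U ≤ K⁻¹ * (K * Metric.ediam U ^ s) := by gcongr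
      _ = Metric.ediam U ^ s := by rw [← mul_assoc, ENNReal.inv_mul_cancel hK0 hKt, one_mul]
  have hone : 1 ≤ P.map val E := by
    refine le_trans ?_ (Measure.le_map_apply hm E)
    rw [← measure_univ (μ := P)]
    refine measure_mono_ae ?_
    filter_upwards [hΩ] with a ha _
    exact hE a ha
  have hne : μH[s] E ≠ 0 := by
    intro h0
    have := hle E
    rw [h0, Measure.smul_apply, smul_eq_mul] at this
    have h2 : K⁻¹ * P.map val E ≠ 0 :=
      mul_ne_zero (ENNReal.inv_ne_zero.2 hKt) (by positivity)
    exact h2 (le_antisymm this zero_le)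
  have hs' : ((s.toNNReal : NNReal) : ℝ) = s := Real.coe_toNNReal _ hs.le
  rw [← hs'] at hne
  exact le_dimH_of_hausdorffMeasure_ne_zero hne

end MassDistribution

/-- The digit sequence of a real number. -/
noncomputable def digits (x : ℝ) : ℕ → ℕ := fun i => cfA x (i + 1)

lemma gaussMap_mem {x : ℝ} (hx : x ∈ Ioo (0 : ℝ) 1) (hi : Irrational x) :
    gaussMap x ∈ Ioo (0 : ℝ) 1 ∧ Irrational (gaussMap x) := by
  have e : gaussMap x = Int.fract x⁻¹ := if_neg hx.1.ne'
  have hirr : Irrational (gaussMap x) := by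
    rw [e, Int.fract]
    exact hi.inv.sub_intCast _
  refine ⟨⟨?_, ?_⟩, hirr⟩
  · refine lt_of_le_of_ne ?_ (fun h => hirr ⟨0, by simp [← h]⟩)
    rw [e]; exact Int.fract_nonneg _
  · rw [e]; exact Int.fract_lt_one _

lemma iterate_gaussMap_mem {x : ℝ} (hx : x ∈ Ioo (0 : ℝ) 1) (hi : Irrational x) (n : ℕ) :
    gaussMap^[n] x ∈ Ioo (0 : ℝ) 1 ∧ Irrational (gaussMap^[n] x) := by
  induction n with
  | zero => exact ⟨hx, hi⟩
  | succ n ih => rw [Function.iterate_succ_apply']; exact gaussMap_mem ih.1 ih.2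

lemma one_le_digits {x : ℝ} (hx : x ∈ Ioo (0 : ℝ) 1) (hi : Irrational x) (n : ℕ) :
    1 ≤ digits x n := by
  have h := (iterate_gaussMap_mem hx hi n).1
  rw [digits, cfA, Nat.add_sub_cancel, Nat.le_floor_iff (inv_nonneg.2 h.1.le), Nat.cast_one]
  exact (one_le_inv₀ h.1).2 h.2.le

lemma iterate_gaussMap_eq {x : ℝ} (hx : x ∈ Ioo (0 : ℝ) 1) (hi : Irrational x) (n : ℕ) :
    gaussMap^[n] x = 1 / (digits x n + gaussMap^[n + 1] x) := by
  have h := (iterate_gaussMap_mem hx hi n).1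
  have e : gaussMap^[n + 1] x = Int.fract (gaussMap^[n] x)⁻¹ := by
    rw [Function.iterate_succ_apply', gaussMap, if_neg h.1.ne']
  rw [e, digits, cfA, Nat.add_sub_cancel, natCast_floor_eq_intCast_floor (inv_nonneg.2 h.1.le),
    Int.floor_add_fract, one_div, inv_inv]

lemma eq_mob_digits {x : ℝ} (hx : x ∈ Ioo (0 : ℝ) 1) (hi : Irrational x) (n : ℕ) :
    x = mob (pre (digits x) n) (gaussMap^[n] x) := by
  induction n with
  | zero => simp [pre_zero, mob]
  | succ n ih =>
    rw [pre_succ, mob_append]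
    conv_lhs => rw [ih, iterate_gaussMap_eq hx hi n]
    simp [mob]

/-- The word with digits `u i + 1`. -/
def wd {n : ℕ} (u : Fin n → ℕ) : List ℕ := List.ofFn fun i => u i + 1

lemma one_le_of_mem_wd {n : ℕ} (u : Fin n → ℕ) : ∀ a ∈ wd u, 1 ≤ a := by
  intro a ha
  simp only [wd, List.mem_ofFn] at ha
  obtain ⟨i, rfl⟩ := ha
  omega

lemma one_le_den_wd {n : ℕ} (u : Fin n → ℕ) : 1 ≤ den (wd u) 0 :=
  one_le_den (one_le_of_mem_wd u) (by simp)

lemma prod_le_den_wd {n : ℕ} (u : Fin n → ℕ) : ∏ i, ((u i : ℝ) + 1) ≤ den (wd u) 0 := by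
  have h := prod_le_den (one_le_of_mem_wd u)
  rw [wd, List.prod_ofFn] at h
  push_cast at h
  exact h

lemma pre_eq_wd {a : ℕ → ℕ} (ha : ∀ i, 1 ≤ a i) (n : ℕ) :
    pre a n = wd fun i : Fin n => a i - 1 := by
  simp only [pre, wd]
  congr 1
  funext i
  have := ha i
  omega

lemma two_pow_le_den_wd {n : ℕ} (u : Fin n → ℕ) : (2 : ℝ) ^ n / 2 ≤ den (wd u) 0 ^ 2 := by
  let a : ℕ → ℕ := fun i => if h : i < n then u ⟨i, h⟩ + 1 else 1
  have ha : ∀ i, 1 ≤ a i := by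
    intro i; simp only [a]; split_ifs <;> omega
  have e : pre a n = wd u := by
    simp only [pre, wd, a]; congr 1; funext i; simp
  have h := two_pow_le_cont ha n
  rw [cont, e] at h
  calc (2 : ℝ) ^ n / 2 ≤ (2 ^ (n / 2)) ^ 2 := by
        rw [div_le_iff₀ (by norm_num), ← pow_mul, ← pow_succ]
        exact pow_le_pow_right₀ (by norm_num) (by omega)
    _ ≤ _ := by gcongr

/-- The sum of `q(u)^{-2s}` over all words of length `n`. -/
noncomputable def partitionSum (n : ℕ) (s : ℝ) : ENNReal :=
  ∑' u : Fin n → ℕ, ENNReal.ofReal ((den (wd u) 0 ^ 2) ^ (-s))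

lemma partitionSum_le {s s' : ℝ} (h : s' ≤ s) (n : ℕ) :
    partitionSum n s ≤ ENNReal.ofReal (((2 : ℝ) ^ n / 2) ^ (-(s - s'))) * partitionSum n s' := by
  rw [partitionSum, partitionSum, ← ENNReal.tsum_mul_left]
  refine ENNReal.tsum_le_tsum fun u => ?_
  have h1 := two_pow_le_den_wd u
  have h2 : (0 : ℝ) < 2 ^ n / 2 := by positivity
  rw [← ENNReal.ofReal_mul (by positivity)]
  apply ENNReal.ofReal_le_ofReal
  have e : -s = -(s - s') + -s' := by ring
  rw [e, Real.rpow_add (by linarith)]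
  have := Real.rpow_le_rpow_of_nonpos h2 h1 (z := -(s - s')) (by linarith)
  gcongr

lemma sum_inv_le {N : ℝ} (hN : 1 ≤ N) :
    ∑ k ∈ Finset.range ⌊N⌋₊, ((k : ℝ) + 1)⁻¹ ≤ 1 + Real.log N := by
  have h := harmonic_le_one_add_log ⌊N⌋₊
  rw [harmonic] at h
  push_cast at h
  refine h.trans ?_
  have : (0 : ℝ) < ⌊N⌋₊ := by exact_mod_cast Nat.floor_pos.2 hN
  gcongr
  exact Nat.floor_le (by linarith)

lemma tsum_words_le {i : ℕ} {N Y s : ℝ} (hN : 1 ≤ N) (hY : 1 ≤ Y) (hYN : Y ≤ N) (hs1 : s ≤ 1) :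
    ∑' v : Fin i → ℕ, (if ∏ j, ((v j : ℝ) + 1) ≤ Y then
      ENNReal.ofReal ((∏ j, ((v j : ℝ) + 1)) ^ (-s)) else 0) ≤
      ENNReal.ofReal (Y ^ (1 - s) * (1 + Real.log N) ^ i) := by
  have hlog := Real.log_nonneg hN
  rw [tsum_eq_sum (s := Fintype.piFinset fun _ : Fin i => Finset.range ⌊N⌋₊)]
  · calc
      _ ≤ ∑ v ∈ Fintype.piFinset (fun _ : Fin i => Finset.range ⌊N⌋₊),
          ENNReal.ofReal (Y ^ (1 - s) * ∏ j, ((v j : ℝ) + 1)⁻¹) := by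
        refine Finset.sum_le_sum fun v _ => ?_
        split_ifs with h
        · apply ENNReal.ofReal_le_ofReal
          have hp : 0 < ∏ j, ((v j : ℝ) + 1) := Finset.prod_pos fun j _ => by positivity
          have e : -s = (1 - s) + (-1) := by ring
          rw [e, Real.rpow_add hp, Real.rpow_neg_one, Finset.prod_inv_distrib]
          have := Real.rpow_le_rpow hp.le h (z := 1 - s) (by linarith)
          gcongr
        · exact zero_le
      _ = ENNReal.ofReal (Y ^ (1 - s) * (∑ k ∈ Finset.range ⌊N⌋₊, ((k : ℝ) + 1)⁻¹) ^ i) := by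
        rw [← ENNReal.ofReal_sum_of_nonneg, ← Finset.mul_sum,
          ← Finset.prod_univ_sum (fun _ : Fin i => Finset.range ⌊N⌋₊)
            (fun _ k => ((k : ℝ) + 1)⁻¹), Finset.prod_const, Finset.card_univ, Fintype.card_fin]
        intro v _
        have : 0 ≤ ∏ j, ((v j : ℝ) + 1)⁻¹ := Finset.prod_nonneg fun j _ => by positivity
        positivity
      _ ≤ _ := by
        apply ENNReal.ofReal_le_ofReal
        have h1 : (0 : ℝ) ≤ ∑ k ∈ Finset.range ⌊N⌋₊, ((k : ℝ) + 1)⁻¹ :=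
          Finset.sum_nonneg fun k _ => by positivity
        have := sum_inv_le hN
        gcongr
  · intro v hv
    rw [if_neg]
    intro h
    apply hv
    rw [Fintype.mem_piFinset]
    intro j
    rw [Finset.mem_range, ← Nat.succ_le_iff, Nat.le_floor_iff (by linarith)]
    push_cast
    refine le_trans ?_ (h.trans hYN)
    calc (v j : ℝ) + 1 = ∏ j', if j' = j then (v j' : ℝ) + 1 else 1 := by simp
      _ ≤ _ := by
        refine Finset.prod_le_prod (fun k _ => ?_) (fun k _ => ?_) <;> split_ifs <;>
          linarith [(v k).cast_nonneg (α := ℝ)]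

lemma dimH_le_of_covers {ι : ℕ → Type} [∀ p, Countable (ι p)] (t : ∀ p, ι p → Set ℝ)
    {E : Set ℝ} {s : ℝ} (hs : 0 ≤ s)
    (ht : ∀ p c, Metric.ediam (t p c) ≤ ENNReal.ofReal (2 * (1 / 2) ^ p))
    (hE : ∀ x ∈ E, ∀ N, ∃ p, N ≤ p ∧ ∃ c, x ∈ t p c)
    {C : ℕ → ℝ} (hC : Summable C) (hsum : ∀ p, ∑' c, Metric.ediam (t p c) ^ s ≤ ENNReal.ofReal (C p)) :
    dimH E ≤ ENNReal.ofReal s := by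
  have key : Measure.hausdorffMeasure s E ≤
      liminf (fun N => ∑' c : Σ p, ι (p + N), Metric.ediam (t (c.1 + N) c.2) ^ s) atTop := by
    refine Measure.hausdorffMeasure_le_liminf_tsum (ι := fun N => Σ p, ι (p + N)) (l := atTop) s E
      (fun N : ℕ => ENNReal.ofReal (2 * (1 / 2) ^ N)) ?_ (fun N c => t (c.1 + N) c.2) ?_ ?_
    · have h : Tendsto (fun N : ℕ => (2 : ℝ) * (1 / 2) ^ N) atTop (nhds (2 * 0)) :=
        (tendsto_pow_atTop_nhds_zero_of_lt_one (by norm_num) (by norm_num)).const_mul 2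
      have := ENNReal.tendsto_ofReal h
      simpa using this
    · refine Eventually.of_forall fun N c => (ht _ _).trans (ENNReal.ofReal_le_ofReal ?_)
      have : ((1 : ℝ) / 2) ^ (c.1 + N) ≤ (1 / 2) ^ N :=
        pow_le_pow_of_le_one (by norm_num) (by norm_num) (by omega)
      linarith
    · refine Eventually.of_forall fun N x hx => ?_
      obtain ⟨p, hp, c, hc⟩ := hE x hx N
      obtain ⟨k, rfl⟩ := Nat.exists_eq_add_of_le' hp
      exact mem_iUnion.2 ⟨⟨k, c⟩, hc⟩
  have hfin : ∑' p, ENNReal.ofReal (C p) ≠ ⊤ := hC.tsum_ofReal_ne_top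
  have hlim := ENNReal.tendsto_sum_nat_add _ hfin
  have hle : liminf (fun N => ∑' c : Σ p, ι (p + N), Metric.ediam (t (c.1 + N) c.2) ^ s) atTop
      ≤ 0 := by
    rw [← hlim.liminf_eq]
    refine liminf_le_liminf (Eventually.of_forall fun N => ?_)
    rw [ENNReal.tsum_sigma']
    exact ENNReal.tsum_le_tsum fun p => hsum _
  have h0 : Measure.hausdorffMeasure ((s.toNNReal : NNReal) : ℝ) E ≠ ⊤ := by
    rw [Real.coe_toNNReal _ hs]
    exact ne_top_of_le_ne_top ENNReal.zero_ne_top (key.trans hle)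
  exact dimH_le_of_hausdorffMeasure_ne_top h0

/-- The image under the branch of a word `u ++ v` of an initial interval of length at most
`∏ v / Y`. -/
noncomputable def cell {p i : ℕ} (Y : ℝ) (u : Fin p → ℕ) (v : Fin i → ℕ) : Set ℝ :=
  mob (wd u ++ wd v) '' Icc 0 (min 1 ((∏ j, ((v j : ℝ) + 1)) / Y))

lemma ediam_cell_le {p i : ℕ} {Y : ℝ} (hY : 1 ≤ Y) (u : Fin p → ℕ) (v : Fin i → ℕ) :
    Metric.ediam (cell Y u v) ≤
      ENNReal.ofReal (min (2 * (1 / 2) ^ p) (1 / (Y * (∏ j, ((v j : ℝ) + 1)) * den (wd u) 0 ^ 2))) := by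
  set P := ∏ j, ((v j : ℝ) + 1) with hP
  have hP1 : 1 ≤ P := by
    have h : ∏ j : Fin i, (1 : ℝ) ≤ P :=
      Finset.prod_le_prod (by simp) fun j _ => by linarith [(v j).cast_nonneg (α := ℝ)]
    simpa using h
  have hw : ∀ a ∈ wd u ++ wd v, 1 ≤ a := by
    intro a ha
    rcases List.mem_append.1 ha with h | h
    exacts [one_le_of_mem_wd u a h, one_le_of_mem_wd v a h]
  have hu := one_le_den_wd u
  have hd : den (wd u) 0 * P ≤ den (wd u ++ wd v) 0 :=
    (mul_le_mul_of_nonneg_left (prod_le_den_wd v) (by linarith)).trans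
      (mul_den_le_den_append (one_le_of_mem_wd u) (one_le_of_mem_wd v))
  have hd2 : (den (wd u) 0 * P) ^ 2 ≤ den (wd u ++ wd v) 0 ^ 2 := by gcongr
  have h2 := two_pow_le_den_wd u
  refine Metric.ediam_le ?_
  rintro _ ⟨y, hy, rfl⟩ _ ⟨z, hz, rfl⟩
  rw [edist_dist, Real.dist_eq]
  apply ENNReal.ofReal_le_ofReal
  have hy1 : y ∈ Icc (0 : ℝ) 1 := ⟨hy.1, hy.2.trans (min_le_left _ _)⟩
  have hz1 : z ∈ Icc (0 : ℝ) 1 := ⟨hz.1, hz.2.trans (min_le_left _ _)⟩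
  have hyz : |y - z| ≤ min 1 (P / Y) := by
    rw [abs_le]; constructor <;> linarith [hy.1, hy.2, hz.1, hz.2]
  have hpos : 0 < (den (wd u) 0 * P) ^ 2 := by positivity
  refine (abs_mob_sub_le hw hy1 hz1).trans (le_min ?_ ?_)
  · calc _ ≤ 1 / (den (wd u) 0 * P) ^ 2 :=
          div_le_div₀ (by norm_num) (hyz.trans (min_le_left _ _)) hpos hd2
      _ ≤ 1 / ((2 : ℝ) ^ p / 2) := by
          apply one_div_le_one_div_of_le (by positivity)
          refine h2.trans ?_
          have : den (wd u) 0 * 1 ≤ den (wd u) 0 * P := by gcongr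
          rw [mul_one] at this
          gcongr
      _ = 2 * (1 / 2) ^ p := by rw [one_div_pow]; field_simp
  · calc _ ≤ (P / Y) / (den (wd u) 0 * P) ^ 2 :=
          div_le_div₀ (by positivity) (hyz.trans (min_le_right _ _)) hpos hd2
      _ = _ := by field_simp

/-- The covering sets at a given level: `cell`s whose second word is not too large. -/
noncomputable def cover (ℓ : ℕ) (Y : ℕ → ℝ) (p : ℕ)
    (c : (Fin p → ℕ) × (Σ i : Fin ℓ, Fin i → ℕ)) : Set ℝ :=
  if ∏ j, ((c.2.2 j : ℝ) + 1) ≤ Y c.2.1 then cell (Y (c.2.1 + 1)) c.1 c.2.2 else ∅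

lemma mem_cover {ℓ : ℕ} {Y : ℕ → ℝ} (hY : ∀ i, 1 ≤ Y i) (hY0 : Y 0 = 1) (hℓ : 1 ≤ ℓ) {p : ℕ} {x : ℝ}
    (hx : x ∈ Ioo (0 : ℝ) 1) (hi : Irrational x)
    (h : Y ℓ ≤ ∏ i ∈ Finset.range ℓ, (cfA' x (p + 1 + i) : ℝ)) : ∃ c, x ∈ cover ℓ Y p c := by
  classical
  set a := digits x with ha
  have ha1 : ∀ i, 1 ≤ a i := one_le_digits hx hi
  let Q : ℕ → ℝ := fun k => ∏ j ∈ Finset.range k, (a (p + j) : ℝ)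
  have hQ : Y ℓ ≤ Q ℓ := by
    refine h.trans (Finset.prod_le_prod (fun _ _ => by positivity) fun j _ => ?_)
    rw [ha, digits, Nat.cast_le, show p + j + 1 = p + 1 + j by omega, cfA']
    split_ifs
    exacts [le_rfl, Nat.zero_le _]
  have hex : ∃ i, Y (i + 1) ≤ Q (i + 1) := ⟨ℓ - 1, by rwa [Nat.sub_add_cancel hℓ]⟩
  set i := Nat.find hex with hidef
  have hiY : Y (i + 1) ≤ Q (i + 1) := Nat.find_spec hex
  have hiℓ : i < ℓ := lt_of_le_of_lt (Nat.find_min' hex (m := ℓ - 1) (by rwa [Nat.sub_add_cancel hℓ]))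
    (by omega)
  have hQi : Q i ≤ Y i := by
    rcases Nat.eq_zero_or_pos i with h0 | h0
    · rw [h0, hY0]; simp [Q]
    · have := Nat.find_min hex (m := i - 1) (by omega)
      rw [Nat.sub_add_cancel h0] at this
      exact (not_le.1 this).le
  have hPQ : ∏ j : Fin i, (((a (p + j) - 1 : ℕ) : ℝ) + 1) = Q i := by
    simp only [Q]
    rw [Finset.prod_range (fun j => (a (p + j) : ℝ))]
    refine Finset.prod_congr rfl fun j _ => ?_
    rw [Nat.cast_sub (ha1 _)]; simp
  refine ⟨(fun k => a k - 1, ⟨⟨i, hiℓ⟩, fun j => a (p + j) - 1⟩), ?_⟩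
  simp only [cover, hPQ]
  rw [if_pos hQi, cell, hPQ]
  refine ⟨gaussMap^[p + i] x, ⟨(iterate_gaussMap_mem hx hi _).1.1.le, le_min
    (iterate_gaussMap_mem hx hi _).1.2.le ?_⟩, ?_⟩
  · rw [le_div_iff₀ (by linarith [hY (i + 1)])]
    have hpos : (0 : ℝ) < a (p + i) := by exact_mod_cast ha1 _
    have ht := (iterate_gaussMap_mem hx hi (p + i + 1)).1.1
    have hQ0 : 0 ≤ Q i := Finset.prod_nonneg fun _ _ => by positivity
    have hT : gaussMap^[p + i] x ≤ 1 / a (p + i) := by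
      rw [iterate_gaussMap_eq hx hi (p + i)]
      exact one_div_le_one_div_of_le hpos (by linarith)
    calc gaussMap^[p + i] x * Y (i + 1) ≤ 1 / a (p + i) * Q (i + 1) := by
          have := hY (i + 1)
          gcongr
      _ = Q i := by
          simp only [Q, Finset.prod_range_succ]
          field_simp
  · have e := eq_mob_digits hx hi (p + i)
    rw [pre_add, pre_eq_wd ha1, pre_eq_wd (a := shift p (digits x)) fun _ => ha1 _] at e
    exact e.symm

lemma tsum_cover_le {ℓ : ℕ} {Y : ℕ → ℝ} {N s : ℝ} (hY : ∀ i, 1 ≤ Y i) (hYN : ∀ i < ℓ, Y i ≤ N)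
    (hs : 0 < s) (hs1 : s ≤ 1) {R : ℝ} (hR : ∀ i < ℓ, Y (i + 1) ^ (-s) * Y i ^ (1 - s) ≤ R)
    (hN : 1 ≤ N) (p : ℕ) :
    ∑' c, Metric.ediam (cover ℓ Y p c) ^ s ≤
      partitionSum p s * ENNReal.ofReal (ℓ * (R * (1 + Real.log N) ^ ℓ)) := by
  have hlog := Real.log_nonneg hN
  rw [ENNReal.tsum_prod', partitionSum, ← ENNReal.tsum_mul_right]
  refine ENNReal.tsum_le_tsum fun u => ?_
  rw [ENNReal.tsum_sigma', tsum_fintype]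
  have hd : 0 < den (wd u) 0 ^ 2 := by have := one_le_den_wd u; positivity
  have hterm : ∀ (i : Fin ℓ), ∑' v : Fin i → ℕ, Metric.ediam (cover ℓ Y p (u, ⟨i, v⟩)) ^ s ≤
      ENNReal.ofReal ((den (wd u) 0 ^ 2) ^ (-s)) * ENNReal.ofReal (R * (1 + Real.log N) ^ ℓ) := by
    intro i
    have hYi := hY i
    have hYi1 := hY (i + 1)
    calc ∑' v : Fin i → ℕ, Metric.ediam (cover ℓ Y p (u, ⟨i, v⟩)) ^ s
        ≤ ∑' v : Fin i → ℕ, ENNReal.ofReal ((den (wd u) 0 ^ 2) ^ (-s) * Y (i + 1) ^ (-s)) *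
          (if ∏ j, ((v j : ℝ) + 1) ≤ Y i then
            ENNReal.ofReal ((∏ j, ((v j : ℝ) + 1)) ^ (-s)) else 0) := by
          refine ENNReal.tsum_le_tsum fun v => ?_
          simp only [cover]
          split_ifs with h
          · have hP : 0 < ∏ j, ((v j : ℝ) + 1) := Finset.prod_pos fun j _ => by positivity
            rw [← ENNReal.ofReal_mul (by positivity)]
            refine (ENNReal.rpow_le_rpow ((ediam_cell_le hYi1 u v).trans
              (ENNReal.ofReal_le_ofReal (min_le_right _ _))) hs.le).trans ?_
            rw [ENNReal.ofReal_rpow_of_nonneg (by positivity) hs.le]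
            apply ENNReal.ofReal_le_ofReal
            rw [one_div, ← Real.rpow_neg_eq_inv_rpow, Real.mul_rpow (by positivity) (by positivity),
              Real.mul_rpow (by positivity) (by positivity)]
            apply le_of_eq; ring
          · simp [hs]
      _ ≤ ENNReal.ofReal ((den (wd u) 0 ^ 2) ^ (-s) * Y (i + 1) ^ (-s)) *
          ENNReal.ofReal (Y i ^ (1 - s) * (1 + Real.log N) ^ (i : ℕ)) := by
          rw [ENNReal.tsum_mul_left]
          gcongr
          exact tsum_words_le hN hYi (hYN i i.2) hs1
      _ ≤ _ := by
          rw [← ENNReal.ofReal_mul (by positivity), ← ENNReal.ofReal_mul (by positivity)]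
          apply ENNReal.ofReal_le_ofReal
          have h1 : (1 + Real.log N) ^ (i : ℕ) ≤ (1 + Real.log N) ^ ℓ :=
            pow_le_pow_right₀ (by linarith) i.2.le
          calc _ = (den (wd u) 0 ^ 2) ^ (-s) * ((Y (i + 1) ^ (-s) * Y i ^ (1 - s)) *
                (1 + Real.log N) ^ (i : ℕ)) := by ring
            _ ≤ _ := by
              have := hR i i.2
              have : 0 ≤ R := le_trans (by positivity) this
              gcongr
  refine (Finset.sum_le_sum fun i _ => hterm i).trans ?_
  rw [Finset.sum_const, Finset.card_univ, Fintype.card_fin, nsmul_eq_mul,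
    ENNReal.ofReal_mul (p := (ℓ : ℝ)) (by positivity), ENNReal.ofReal_natCast]
  apply le_of_eq; ring

lemma summable_polyexp {L r : ℝ} (hr : 0 ≤ r) (hr1 : r < 1) (ℓ : ℕ) :
    Summable fun p : ℕ => (1 + ((p : ℝ) + 1) * L) ^ ℓ * r ^ p := by
  have h : ∀ k : ℕ, Summable fun p : ℕ => (p : ℝ) ^ k * r ^ p := fun k =>
    summable_pow_mul_geometric_of_norm_lt_one k (by rwa [Real.norm_eq_abs, abs_of_nonneg hr])
  have e : ∀ p : ℕ, (1 + ((p : ℝ) + 1) * L) ^ ℓ * r ^ p =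
      ∑ k ∈ Finset.range (ℓ + 1), (L ^ k * (1 + L) ^ (ℓ - k) * (ℓ.choose k)) * ((p : ℝ) ^ k * r ^ p) := by
    intro p
    rw [show 1 + ((p : ℝ) + 1) * L = p * L + (1 + L) by ring, add_pow, Finset.sum_mul]
    exact Finset.sum_congr rfl fun k _ => by rw [mul_pow]; ring
  simp_rw [e]
  exact summable_sum fun k _ => (h k).mul_left _

theorem dimH_le_of_partitionSum {ℓ : ℕ} {B s s' f K : ℝ} {β : ℕ → ℝ} (hℓ : 1 ≤ ℓ) (hB : 1 < B)
    (hs' : 0 < s) (hss : s' < s) (hs1 : s ≤ 1) (hβ : ∀ i, 0 ≤ β i)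
    (hsum : ∑ i ∈ Finset.range ℓ, β i = 1)
    (hf : ∀ i < ℓ, (2 * s - 1) * ∑ j ∈ Finset.range i, β j + s * β i = f) (hK : 0 ≤ K)
    (hpart : ∀ p : ℕ, partitionSum p s' ≤ ENNReal.ofReal (K * B ^ (p * f))) :
    dimH (EprimeℓN ℓ B univ) ≤ ENNReal.ofReal s := by
  have hB0 : 0 < B := by linarith
  let σ : ℕ → ℝ := fun i => ∑ j ∈ Finset.range i, β j
  have hσ0 : ∀ i, 0 ≤ σ i := fun i => Finset.sum_nonneg fun j _ => hβ j
  have hσmono : Monotone σ := by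
    refine monotone_nat_of_le_succ fun i => ?_
    simp only [σ, Finset.sum_range_succ]; linarith [hβ i]
  let Y : ℕ → ℕ → ℝ := fun p i => B ^ (((p : ℝ) + 1) * σ i)
  have hY1 : ∀ p i, 1 ≤ Y p i := fun p i =>
    Real.one_le_rpow hB.le (mul_nonneg (by positivity) (hσ0 i))
  have hYℓ : ∀ p, Y p ℓ = B ^ (p + 1) := by
    intro p
    simp only [Y, σ, hsum, mul_one]
    rw [← Nat.cast_succ, Real.rpow_natCast]
  have hlog : 0 < Real.log B := Real.log_pos hB
  set r : ℝ := 2 ^ (-(s - s')) with hr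
  have hr1 : r < 1 := Real.rpow_lt_one_of_one_lt_of_neg (by norm_num) (by linarith)
  refine dimH_le_of_covers (ι := fun p => (Fin p → ℕ) × (Σ i : Fin ℓ, Fin i → ℕ))
    (fun p => cover ℓ (Y p) p) hs'.le ?_ ?_
    (C := fun p => (2 ^ (s - s') * K * ℓ * B ^ (-f)) *
      ((1 + ((p : ℝ) + 1) * Real.log B) ^ ℓ * r ^ p))
    ((summable_polyexp (by positivity) hr1 ℓ).mul_left _) ?_
  · rintro p c
    rw [cover]
    split_ifs
    · exact (ediam_cell_le (hY1 _ _) _ _).trans (ENNReal.ofReal_le_ofReal (min_le_left _ _))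
    · simp
  · rintro x ⟨hx, hi, hinf⟩ N
    obtain ⟨n, ⟨-, h1, hn⟩, hNn⟩ := hinf.exists_gt N
    obtain ⟨p, rfl⟩ := Nat.exists_eq_add_of_le' h1
    refine ⟨p, by omega, mem_cover (hY1 p) (by simp [Y, σ]) hℓ ⟨?_, hx.2⟩ hi ((hYℓ p).trans_le hn)⟩
    exact lt_of_le_of_ne hx.1 fun h => hi ⟨0, by simp [h]⟩
  · intro p
    have hN : (1 : ℝ) ≤ B ^ (p + 1) := one_le_pow₀ hB.le
    refine (tsum_cover_le (N := B ^ (p + 1)) (R := B ^ (-((p : ℝ) + 1) * f)) (hY1 p) ?_ hs' hs1 ?_ hN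
      p).trans ?_
    · intro i hi
      rw [← hYℓ]
      exact Real.rpow_le_rpow_of_exponent_le hB.le
        (mul_le_mul_of_nonneg_left (hσmono hi.le) (by positivity))
    · intro i hi
      simp only [Y]
      rw [← Real.rpow_mul hB0.le, ← Real.rpow_mul hB0.le, ← Real.rpow_add hB0, ← hf i hi]
      apply le_of_eq; congr 1
      simp only [σ, Finset.sum_range_succ]
      ring
    · rw [Real.log_pow]
      have hp1 : (0 : ℝ) ≤ 2 ^ p / 2 := by positivity
      calc _ ≤ (ENNReal.ofReal (((2 : ℝ) ^ p / 2) ^ (-(s - s'))) * ENNReal.ofReal (K * B ^ (p * f))) *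
            ENNReal.ofReal (ℓ * (B ^ (-((p : ℝ) + 1) * f) * (1 + ((p + 1 : ℕ) : ℝ) * Real.log B) ^ ℓ)) := by
            gcongr
            exact (partitionSum_le hss.le p).trans (by gcongr; exact hpart p)
        _ = _ := by
            rw [← ENNReal.ofReal_mul (by positivity), ← ENNReal.ofReal_mul (by positivity)]
            congr 1
            have e1 : ((2 : ℝ) ^ p / 2) ^ (-(s - s')) = r ^ p * 2 ^ (s - s') := by
              rw [Real.div_rpow (by positivity) (by norm_num), hr, ← Real.rpow_natCast,
                ← Real.rpow_natCast, ← Real.rpow_mul (by norm_num), ← Real.rpow_mul (by norm_num),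
                mul_comm (p : ℝ), div_eq_mul_inv, ← Real.rpow_neg (by norm_num), neg_neg]
            have e2 : B ^ ((p : ℝ) * f) * B ^ (-((p : ℝ) + 1) * f) = B ^ (-f) := by
              rw [← Real.rpow_add hB0]; congr 1; ring
            rw [e1, ← e2]
            push_cast
            ring

/-- The primes in `(X, 8 X]`. -/
noncomputable def primesIn (X : ℝ) : Finset ℕ := (Finset.Ioc ⌊X⌋₊ ⌊8 * X⌋₊).filter Nat.Prime

lemma of_mem_primesIn {X : ℝ} (hX : 0 ≤ X) {p : ℕ} (hp : p ∈ primesIn X) :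
    p.Prime ∧ X ≤ p ∧ (p : ℝ) ≤ 8 * X := by
  rw [primesIn, Finset.mem_filter, Finset.mem_Ioc] at hp
  exact ⟨hp.2, (Nat.lt_of_floor_lt hp.1.1).le,
    (Nat.le_floor_iff (by linarith)).1 hp.1.2⟩

lemma theta_sub_le {X : ℝ} (hX : 1 ≤ X) :
    Chebyshev.theta (8 * X) - Chebyshev.theta X ≤ (primesIn X).card * Real.log (8 * X) := by
  have hle : ⌊X⌋₊ ≤ ⌊8 * X⌋₊ := Nat.floor_mono (by linarith)
  have h : Chebyshev.theta (8 * X) = Chebyshev.theta X + ∑ p ∈ primesIn X, Real.log p := by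
    rw [Chebyshev.theta, Chebyshev.theta, primesIn, Finset.sum_filter, Finset.sum_filter,
      Finset.sum_filter, ← Finset.sum_union]
    · rw [Finset.Ioc_union_Ioc_eq_Ioc (Nat.zero_le _) hle]
    · exact Finset.Ioc_disjoint_Ioc_of_le le_rfl
  rw [h, add_sub_cancel_left, ← nsmul_eq_mul]
  refine Finset.sum_le_card_nsmul _ _ _ fun p hp => ?_
  have := of_mem_primesIn (by linarith) hp
  have hp0 : (0 : ℝ) < p := by exact_mod_cast this.1.pos
  exact Real.log_le_log hp0 this.2.2

lemma eventually_le_card_primesIn :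
    ∀ᶠ X : ℝ in atTop, X ≤ (primesIn X).card * Real.log (8 * X) := by
  have h8 : Tendsto (fun X : ℝ => 8 * X) atTop atTop := tendsto_id.const_mul_atTop (by norm_num)
  have h2 : Tendsto (fun X : ℝ => X + 2) atTop atTop := tendsto_atTop_add_const_right _ _ tendsto_id
  have hlog : ∀ᶠ X : ℝ in atTop, Real.log X ≤ 1 / 200 * X ^ (1 / 2 : ℝ) := by
    have := (isLittleO_log_rpow_atTop (r := 1 / 2) (by norm_num)).def (c := 1 / 200) (by norm_num)
    filter_upwards [this, eventually_ge_atTop 1] with X h h1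
    rw [Real.norm_eq_abs, Real.norm_eq_abs, abs_of_nonneg (Real.log_nonneg h1),
      abs_of_nonneg (by positivity)] at h
    exact h
  have hlog' : ∀ᶠ X : ℝ in atTop, Real.log X ≤ 1 / 200 * √X := by
    simpa only [Real.sqrt_eq_rpow] using hlog
  filter_upwards [h8.eventually hlog', h8.eventually (h2.eventually hlog'), eventually_ge_atTop 100]
    with X ha hb hX
  refine le_trans ?_ (theta_sub_le (by linarith))
  have h1 := Chebyshev.theta_ge' (x := 8 * X) (by linarith)
  have h3 := Chebyshev.theta_le_log4_mul_x (x := X) (by linarith)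
  have e4 : Real.log 4 = 2 * Real.log 2 := by
    rw [show (4 : ℝ) = 2 ^ 2 by norm_num, Real.log_pow]; norm_num
  have hl2 := Real.log_two_gt_d9
  have hl2' := Real.log_two_lt_d9
  have hsq : √(8 * X) * √(8 * X) = 8 * X := Real.mul_self_sqrt (by linarith)
  have hc : 2 * √(8 * X) * Real.log (8 * X) ≤ 2 * √(8 * X) * (1 / 200 * √(8 * X)) := by gcongr
  have hd : √(8 * X + 2) ≤ 8 * X + 2 := by
    rw [Real.sqrt_le_left (by linarith)]; nlinarith
  rw [e4] at h3
  nlinarith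

lemma exists_exponents {s : ℝ} (hs : 1 / 2 ≤ s) (hs1 : s < 1) {ℓ : ℕ} (hℓ : 1 ≤ ℓ) :
    ∃ (β : ℕ → ℝ) (f : ℝ), (∀ i, 0 < β i) ∧ ∑ i ∈ Finset.range ℓ, β i = 1 ∧ 0 < f ∧
      ∀ i, (2 * s - 1) * ∑ j ∈ Finset.range i, β j + s * β i = f := by
  have hs0 : 0 < s := by linarith
  set r := (1 - s) / s with hr
  have hr0 : 0 < r := div_pos (by linarith) hs0
  set S := ∑ i ∈ Finset.range ℓ, r ^ i with hS
  have hS0 : 0 < S := Finset.sum_pos (fun i _ => by positivity) ⟨0, Finset.mem_range.2 hℓ⟩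
  refine ⟨fun i => r ^ i / S, s / S, fun i => by positivity, ?_, by positivity, fun i => ?_⟩
  · rw [← Finset.sum_div, ← hS, div_self hS0.ne']
  · induction i with
    | zero => simp [div_eq_mul_inv]
    | succ i ih =>
      rw [Finset.sum_range_succ, ← ih]
      simp only [pow_succ]
      have : s * r = 1 - s := by rw [hr]; field_simp
      linear_combination (r ^ i / S) * this

/-- The `j`-th block of length `m` of a sequence. -/
def block (m : ℕ) (a : ℕ → ℕ) (j : ℕ) : Fin m → ℕ := fun t => a (j * m + t)

/-- The sequence obtained by concatenating blocks of length `m`. -/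
def unblock {m : ℕ} (hm : 0 < m) (ω : ℕ → Fin m → ℕ) : ℕ → ℕ :=
  fun n => ω (n / m) ⟨n % m, Nat.mod_lt n hm⟩

lemma block_unblock {m : ℕ} (hm : 0 < m) (ω : ℕ → Fin m → ℕ) (j : ℕ) :
    block m (unblock hm ω) j = ω j := by
  funext t
  have h1 : (j * m + t) / m = j := by
    rw [mul_comm, Nat.mul_add_div hm, Nat.div_eq_of_lt t.2, add_zero]
  have h2 : (j * m + t) % m = t := by
    rw [mul_comm, Nat.mul_add_mod, Nat.mod_eq_of_lt t.2]
  simp only [block, unblock, h1, h2]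

lemma measurable_unblock {m : ℕ} (hm : 0 < m) : Measurable (unblock hm) := by
  refine measurable_pi_lambda _ fun n => ?_
  exact (measurable_pi_apply _).comp (measurable_pi_apply _)

lemma measurable_block (m j : ℕ) : Measurable fun a => block m a j :=
  measurable_pi_lambda _ fun _ => measurable_pi_apply _

lemma exists_block_measure {m : ℕ} (hm : 0 < m) (supp : ℕ → Finset (Fin m → ℕ))
    (q : ℕ → (Fin m → ℕ) → ℝ) (hq0 : ∀ j u, 0 ≤ q j u) (hq1 : ∀ j, ∑ u ∈ supp j, q j u = 1) :
    ∃ P : Measure (ℕ → ℕ), IsProbabilityMeasure P ∧ (∀ᵐ a ∂P, ∀ j, block m a j ∈ supp j) ∧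
      ∀ a j (F : Finset (Fin m → ℕ)),
        P {b | (∀ k < j, block m b k = block m a k) ∧ (block m b j ∈ supp j → block m b j ∈ F)} ≤
        ENNReal.ofReal ((∏ k ∈ Finset.range j, q k (block m a k)) * ∑ u ∈ F, q j u) := by
  classical
  let μ : ℕ → Measure (Fin m → ℕ) := fun j =>
    ∑ u ∈ supp j, ENNReal.ofReal (q j u) • Measure.dirac u
  have hμ : ∀ j (F : Set (Fin m → ℕ)), μ j F = ∑ u ∈ supp j with u ∈ F, ENNReal.ofReal (q j u) := by
    intro j F
    simp only [μ, Measure.finsetSum_apply, Measure.smul_apply, smul_eq_mul, Measure.dirac_apply,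
      Finset.sum_filter, indicator, Pi.one_apply, mul_ite, mul_one, mul_zero]
  have hprob : ∀ j, IsProbabilityMeasure (μ j) := fun j => ⟨by
    rw [hμ]
    simp only [mem_univ, Finset.filter_true]
    rw [← ENNReal.ofReal_sum_of_nonneg fun u _ => hq0 j u, hq1, ENNReal.ofReal_one]⟩
  have hsupp : ∀ j, ∀ᵐ u ∂μ j, u ∈ supp j := by
    intro j
    rw [ae_iff]
    simp only [μ, Measure.finsetSum_apply, Measure.smul_apply, smul_eq_mul, Measure.dirac_apply]
    refine Finset.sum_eq_zero fun u hu => ?_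
    have hu' : u ∉ {a | a ∉ supp j} := fun h : u ∉ supp j => h hu
    rw [indicator_of_notMem hu', mul_zero]
  refine ⟨(Measure.infinitePi μ).map (unblock hm),
    Measure.isProbabilityMeasure_map (measurable_unblock hm).aemeasurable, ?_, ?_⟩
  · rw [ae_all_iff]
    intro j
    have hms : MeasurableSet {a : ℕ → ℕ | block m a j ∈ supp j} :=
      measurable_block m j (Set.to_countable {u | u ∈ supp j}).measurableSet
    rw [ae_map_iff (measurable_unblock hm).aemeasurable hms]
    simp only [block_unblock]
    exact (measurePreserving_eval_infinitePi μ j).quasiMeasurePreserving.ae (hsupp j)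
  · intro a j F
    have hms : MeasurableSet {b : ℕ → ℕ | (∀ k < j, block m b k = block m a k) ∧
        (block m b j ∈ supp j → block m b j ∈ F)} := by
      have h1 : ∀ k, MeasurableSet {b : ℕ → ℕ | block m b k = block m a k} := fun k =>
        measurable_block m k (measurableSet_singleton (block m a k))
      have h2 : MeasurableSet {b : ℕ → ℕ | block m b j ∈ supp j → block m b j ∈ F} :=
        measurable_block m j (Set.to_countable {u | u ∈ supp j → u ∈ F}).measurableSet
      simp only [ofPred_and, ofPred_forall]
      exact (MeasurableSet.iInter fun k => MeasurableSet.iInter fun _ => h1 k).inter h2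
    rw [Measure.map_apply (measurable_unblock hm) hms]
    simp only [preimage_ofPred_eq, block_unblock]
    let t : ℕ → Set (Fin m → ℕ) := fun k => if k < j then {block m a k} else
      {u | u ∈ supp j → u ∈ F}
    have hsub : {ω : ℕ → Fin m → ℕ | (∀ k < j, ω k = block m a k) ∧ (ω j ∈ supp j → ω j ∈ F)} ⊆
        ((Finset.range (j + 1) : Finset ℕ) : Set ℕ).pi t := by
      rintro ω ⟨h1, h2⟩ k hk
      rw [Finset.mem_coe, Finset.mem_range] at hk
      simp only [t]
      split_ifs with h
      · exact h1 k h
      · obtain rfl : k = j := by omega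
        exact h2
    refine (measure_mono hsub).trans ?_
    rw [Measure.infinitePi_pi μ fun k _ => (Set.to_countable (t k)).measurableSet,
      Finset.prod_range_succ, ENNReal.ofReal_mul (Finset.prod_nonneg fun k _ => hq0 _ _),
      ENNReal.ofReal_prod_of_nonneg fun k _ => hq0 _ _]
    refine mul_le_mul' (Finset.prod_le_prod' fun k hk => ?_) ?_
    · simp only [t, if_pos (Finset.mem_range.1 hk), hμ, mem_singleton_iff]
      rw [Finset.sum_filter, Finset.sum_ite_eq']
      split_ifs
      exacts [le_rfl, zero_le]
    · simp only [t, lt_irrefl, if_false, hμ, mem_ofPred_eq]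
      rw [ENNReal.ofReal_sum_of_nonneg fun u _ => hq0 j u]
      refine Finset.sum_le_sum_of_subset fun u hu => ?_
      rw [Finset.mem_filter] at hu
      exact hu.2 hu.1

section Scheme

variable {m M : ℕ} {s γ C : ℝ} {W : Finset (Fin m → ℕ)} {con : ℕ → Prop} {D : ℕ → Finset ℕ}
  {H : ℕ → ℕ}

open Classical in
/-- The admissible `j`-th blocks: prescribed digit sets on constrained blocks, and the fixed
family `W` of words on free blocks. -/
noncomputable def supp (W : Finset (Fin m → ℕ)) (con : ℕ → Prop) (D : ℕ → Finset ℕ) (j : ℕ) :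
    Finset (Fin m → ℕ) :=
  if con j then Fintype.piFinset (fun t : Fin m => D (j * m + t)) else W

open Classical in
/-- The weights of the admissible blocks. -/
noncomputable def weight (W : Finset (Fin m → ℕ)) (con : ℕ → Prop) (D : ℕ → Finset ℕ) (s : ℝ)
    (j : ℕ) (u : Fin m → ℕ) : ℝ :=
  if con j then ∏ t : Fin m, ((D (j * m + t)).card : ℝ)⁻¹
  else (den (List.ofFn u) 0 ^ 2) ^ (-s) / ∑ v ∈ W, (den (List.ofFn v) 0 ^ 2) ^ (-s)

open Classical in
/-- The factor by which the normalised measure of a cylinder may grow when a digit is added. -/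
noncomputable def gain (m : ℕ) (con : ℕ → Prop) (D : ℕ → Finset ℕ) (H : ℕ → ℕ) (s γ : ℝ)
    (n : ℕ) : ℝ :=
  if con (n / m) then ((2 * H n : ℝ) ^ 2) ^ s / (D n).card else γ

lemma gain_nonneg (hγ : 0 ≤ γ) (n : ℕ) : 0 ≤ gain m con D H s γ n := by
  rw [gain]; split_ifs <;> positivity

lemma block_div {j t : ℕ} (ht : t < m) : (j * m + t) / m = j := by
  rw [mul_comm, Nat.mul_add_div (by omega), Nat.div_eq_of_lt ht, add_zero]

lemma weight_nonneg (j : ℕ) (u : Fin m → ℕ) : 0 ≤ weight W con D s j u := by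
  have hsq : ∀ v : Fin m → ℕ, 0 ≤ (den (List.ofFn v) 0 ^ 2) ^ (-s) := fun v => by positivity
  rw [weight]
  split_ifs
  · exact Finset.prod_nonneg fun _ _ => by positivity
  · exact div_nonneg (hsq u) (Finset.sum_nonneg fun v _ => hsq v)

lemma sum_weight (hD : ∀ n, con (n / m) → (D n).Nonempty)
    (hZ : 0 < ∑ v ∈ W, (den (List.ofFn v) 0 ^ 2) ^ (-s)) (j : ℕ) :
    ∑ u ∈ supp W con D j, weight W con D s j u = 1 := by
  by_cases h : con j
  · simp only [supp, weight, if_pos h]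
    rw [Finset.sum_const, Fintype.card_piFinset, nsmul_eq_mul, Nat.cast_prod,
      ← Finset.prod_mul_distrib]
    refine Finset.prod_eq_one fun t _ => mul_inv_cancel₀ ?_
    have := (hD (j * m + t) (by rwa [block_div t.2])).card_pos
    positivity
  · simp only [supp, weight, if_neg h]
    rw [← Finset.sum_div, div_self hZ.ne']

lemma cont_con_le {a : ℕ → ℕ} (ha : ∀ n, 1 ≤ a n) (haH : ∀ n, a n ≤ H n) (hs : 0 ≤ s) {j : ℕ}
    (hj : con j) {X Y : ℝ} (hX : 0 ≤ X) (h : (cont a (j * m) ^ 2) ^ s * X ≤ Y) (t : ℕ)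
    (ht : t ≤ m) :
    (cont a (j * m + t) ^ 2) ^ s * (X * ∏ i ∈ Finset.range t, ((D (j * m + i)).card : ℝ)⁻¹) ≤
      Y * ∏ i ∈ Finset.range t, gain m con D H s γ (j * m + i) := by
  induction t with
  | zero => simpa using h
  | succ t ih =>
    have ih := ih (by omega)
    set n := j * m + t with hn
    have hg : gain m con D H s γ n = ((2 * H n : ℝ) ^ 2) ^ s / (D n).card := by
      rw [gain, if_pos (by rwa [hn, block_div (by omega)])]
    have h0 := one_le_cont ha n
    have h0' := one_le_cont ha (n + 1)
    have h1 : cont a (n + 1) ≤ 2 * H n * cont a n := by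
      refine (cont_succ_le ha n).trans ?_
      have : (a n : ℝ) ≤ H n := by exact_mod_cast haH n
      gcongr
    have h2 : (cont a (n + 1) ^ 2) ^ s ≤ ((2 * H n : ℝ) ^ 2) ^ s * (cont a n ^ 2) ^ s := by
      rw [← Real.mul_rpow (by positivity) (by positivity), ← mul_pow]
      gcongr
    rw [Finset.prod_range_succ, Finset.prod_range_succ, ← hn, hg, ← add_assoc, ← hn]
    have hP : 0 ≤ ∏ i ∈ Finset.range t, ((D (j * m + i)).card : ℝ)⁻¹ :=
      Finset.prod_nonneg fun _ _ => by positivity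
    generalize ∏ i ∈ Finset.range t, ((D (j * m + i)).card : ℝ)⁻¹ = p at hP ih ⊢
    generalize ∏ i ∈ Finset.range t, gain m con D H s γ (j * m + i) = p' at ih ⊢
    calc (cont a (n + 1) ^ 2) ^ s * (X * (p * ((D n).card : ℝ)⁻¹))
        ≤ (((2 * H n : ℝ) ^ 2) ^ s * (cont a n ^ 2) ^ s) * (X * (p * ((D n).card : ℝ)⁻¹)) := by
          gcongr
      _ = ((cont a n ^ 2) ^ s * (X * p)) * (((2 * H n : ℝ) ^ 2) ^ s / (D n).card) := by ring
      _ ≤ Y * p' * (((2 * H n : ℝ) ^ 2) ^ s / (D n).card) := by gcongr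
      _ = _ := by ring

lemma cont_block_le {a : ℕ → ℕ} (ha : ∀ n, 1 ≤ a n) (haH : ∀ n, a n ≤ H n) (hs : 0 ≤ s)
    (hZ : 0 < ∑ v ∈ W, (den (List.ofFn v) 0 ^ 2) ^ (-s))
    (hγZ : 4 ^ s ≤ γ ^ m * ∑ v ∈ W, (den (List.ofFn v) 0 ^ 2) ^ (-s)) (hγ : 0 ≤ γ) (j : ℕ) :
    (cont a (j * m) ^ 2) ^ s * ∏ k ∈ Finset.range j, weight W con D s k (block m a k) ≤
      ∏ i ∈ Finset.range (j * m), gain m con D H s γ i := by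
  induction j with
  | zero => simp [cont, pre_zero, den]
  | succ j ih =>
    have hX : 0 ≤ ∏ k ∈ Finset.range j, weight W con D s k (block m a k) :=
      Finset.prod_nonneg fun _ _ => weight_nonneg _ _
    rw [Finset.prod_range_succ, add_mul, one_mul, Finset.prod_range_add]
    by_cases hj : con j
    · have h := cont_con_le (D := D) (γ := γ) ha haH hs hj hX ih m le_rfl
      rw [weight, if_pos hj, ← Finset.prod_range (fun t => ((D (j * m + t)).card : ℝ)⁻¹)]
      exact h
    · set d := den (List.ofFn (block m a j)) 0 with hd
      have hdc : d = cont (shift (j * m) a) m := rfl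
      have hd1 : 1 ≤ d := hdc ▸ one_le_cont (fun i => ha _) m
      have hc := one_le_cont ha (j * m)
      have hc' := one_le_cont ha (j * m + m)
      have h1 : (cont a (j * m + m) ^ 2) ^ s ≤ 4 ^ s * (cont a (j * m) ^ 2) ^ s * (d ^ 2) ^ s := by
        rw [← Real.mul_rpow (by positivity) (by positivity),
          ← Real.mul_rpow (by positivity) (by positivity)]
        have := cont_add_le ha (j * m) m
        rw [← hdc] at this
        have e : 4 * cont a (j * m) ^ 2 * d ^ 2 = (2 * cont a (j * m) * d) ^ 2 := by ring
        rw [e]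
        gcongr
      have hg : ∀ t ∈ Finset.range m, gain m con D H s γ (j * m + t) = γ := by
        intro t ht
        rw [gain, if_neg (by rwa [block_div (Finset.mem_range.1 ht)])]
      rw [Finset.prod_congr rfl hg, Finset.prod_const, Finset.card_range, weight, if_neg hj, ← hd]
      set Z := ∑ v ∈ W, (den (List.ofFn v) 0 ^ 2) ^ (-s)
      have hinv : (d ^ 2) ^ s * (d ^ 2) ^ (-s) = 1 := by
        rw [← Real.rpow_add (by positivity), add_neg_cancel, Real.rpow_zero]
      calc _ ≤ (4 ^ s * (cont a (j * m) ^ 2) ^ s * (d ^ 2) ^ s) *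
            ((∏ k ∈ Finset.range j, weight W con D s k (block m a k)) * ((d ^ 2) ^ (-s) / Z)) := by
            gcongr
        _ = (4 ^ s / Z) * ((d ^ 2) ^ s * (d ^ 2) ^ (-s)) * ((cont a (j * m) ^ 2) ^ s *
            ∏ k ∈ Finset.range j, weight W con D s k (block m a k)) := by ring
        _ ≤ γ ^ m * 1 * ∏ i ∈ Finset.range (j * m), gain m con D H s γ i := by
            rw [hinv]
            have : 4 ^ s / Z ≤ γ ^ m := (div_le_iff₀ hZ).2 hγZ
            gcongr
        _ = _ := by ring

end Scheme

lemma min_card_le {x A d h c s C Pi R : ℝ} (hs : 0 < s) (hs1 : s ≤ 1) (hA : 0 ≤ A) (hd : 0 < d)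
    (hh : 0 < h) (hc : 0 < c) (hx : 0 ≤ x) (hxd : x ≤ d) (hxA : x ≤ A)
    (h1 : c ^ s * R ≤ Pi) (hPi : 0 ≤ Pi) (h2 : Pi * (h / d) ^ s ≤ C) :
    R * (x / d) ≤ C * (A / (h * c)) ^ s := by
  have hx1 : x / d ≤ (A / d) ^ s := by
    have h3 : x / d ≤ (x / d) ^ s :=
      Real.self_le_rpow_of_le_one (by positivity) ((div_le_one hd).2 hxd) hs1
    exact h3.trans (by gcongr)
  have hcs : 0 < c ^ s := by positivity
  have hR : R ≤ Pi / c ^ s := by rw [le_div_iff₀ hcs]; linarith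
  calc R * (x / d) ≤ Pi / c ^ s * (A / d) ^ s := by gcongr
    _ = (Pi * (h / d) ^ s) * (A / (h * c)) ^ s := by
      rw [Real.div_rpow hA hd.le, Real.div_rpow hh.le hd.le, Real.div_rpow hA (by positivity),
        Real.mul_rpow hh.le hc.le]
      field_simp
    _ ≤ _ := by gcongr

lemma val_shift_le {a : ℕ → ℕ} (ha : ∀ n, 1 ≤ a n) {n M : ℕ} (h : 2 ≤ a n ∨ a (n + 1) ≤ M) :
    val (shift n a) ≤ 1 - 1 / ((M : ℝ) + 2) := by
  have hs : ∀ k i, 1 ≤ shift k a i := fun k i => ha _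
  have hM : (0 : ℝ) < (M : ℝ) + 2 := by positivity
  have e : (1 : ℝ) - 1 / (M + 2) = ((M : ℝ) + 1) / (M + 2) := by field_simp; ring
  rw [e, val_eq (hs n), shift_shift, shift_apply_zero]
  have hv := val_pos (hs (n + 1))
  have han : (1 : ℝ) ≤ a n := by exact_mod_cast ha n
  rw [div_le_div_iff₀ (by positivity) hM, one_mul]
  rcases h with h | h
  · have : (2 : ℝ) ≤ a n := by exact_mod_cast h
    nlinarith [(M.cast_nonneg : (0 : ℝ) ≤ M)]
  · have h1 : (a (n + 1) : ℝ) ≤ M := by exact_mod_cast h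
    have h2 : 1 / ((M : ℝ) + 1) ≤ val (shift (n + 1) a) := by
      rw [val_eq (hs (n + 1)), shift_shift, shift_apply_zero]
      have h3 := val_lt_one (hs (n + 1 + 1))
      have h4 := val_pos (hs (n + 1 + 1))
      exact one_div_le_one_div_of_le (by positivity) (by linarith)
    calc (M : ℝ) + 2 = (1 + 1 / ((M : ℝ) + 1)) * (M + 1) := by field_simp; ring
      _ ≤ (a n + val (shift (n + 1) a)) * (M + 1) := by gcongr
      _ = _ := by ring

theorem le_dimH_of_scheme {m M : ℕ} {s γ C : ℝ} {W : Finset (Fin m → ℕ)} {con : ℕ → Prop}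
    {D : ℕ → Finset ℕ} {H : ℕ → ℕ} {E : Set ℝ} (hm : 0 < m) (hM : 1 ≤ M) (hs : 0 < s) (hs1 : s ≤ 1)
    (hγ : 0 ≤ γ) (hC : 0 < C) (hW : ∀ u ∈ W, ∀ t, 1 ≤ u t ∧ u t ≤ M)
    (hZ : 0 < ∑ v ∈ W, (den (List.ofFn v) 0 ^ 2) ^ (-s))
    (hγZ : 4 ^ s ≤ γ ^ m * ∑ v ∈ W, (den (List.ofFn v) 0 ^ 2) ^ (-s))
    (hD : ∀ n, con (n / m) → (D n).Nonempty ∧ ∀ d ∈ D n, 1 ≤ d ∧ d ≤ H n)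
    (hH : ∀ n, ¬ con (n / m) → H n = M)
    (hsep : ∀ n, (con (n / m) ∧ ∀ d ∈ D n, 2 ≤ d) ∨ H (n + 1) ≤ M)
    (hgain : ∀ n, ∏ i ∈ Finset.range n, gain m con D H s γ i ≤ C)
    (hgain' : ∀ n, con (n / m) →
      (∏ i ∈ Finset.range n, gain m con D H s γ i) * ((H n : ℝ) ^ 2 / (D n).card) ^ s ≤ C)
    (hE : ∀ a : ℕ → ℕ, (∀ n, 1 ≤ a n) → (∀ n, con (n / m) → a n ∈ D n) → val a ∈ E) :
    ENNReal.ofReal s ≤ dimH E := by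
  classical
  obtain ⟨P, hP, hae, hcyl⟩ := exists_block_measure hm (supp W con D) (weight W con D s)
    weight_nonneg (sum_weight (fun n h => (hD n h).1) hZ)
  set Ω : Set (ℕ → ℕ) := {a | ∀ j, block m a j ∈ supp W con D j} with hΩ
  have hdm : ∀ n, n / m * m + n % m = n := fun n => Nat.div_add_mod' n m
  have hΩD : ∀ a ∈ Ω, ∀ n, con (n / m) → a n ∈ D n := by
    intro a ha n hn
    have h := ha (n / m)
    rw [supp, if_pos hn, Fintype.mem_piFinset] at h
    simpa only [block, hdm] using h ⟨n % m, Nat.mod_lt n hm⟩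
  have hΩW : ∀ a ∈ Ω, ∀ n, ¬ con (n / m) → 1 ≤ a n ∧ a n ≤ M := by
    intro a ha n hn
    have h := ha (n / m)
    rw [supp, if_neg hn] at h
    simpa only [block, hdm] using hW _ h ⟨n % m, Nat.mod_lt n hm⟩
  have hpos : ∀ a ∈ Ω, ∀ n, 1 ≤ a n := by
    intro a ha n
    by_cases h : con (n / m)
    exacts [((hD n h).2 _ (hΩD a ha n h)).1, (hΩW a ha n h).1]
  have haH : ∀ a ∈ Ω, ∀ n, a n ≤ H n := by
    intro a ha n
    by_cases h : con (n / m)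
    exacts [((hD n h).2 _ (hΩD a ha n h)).2, (hΩW a ha n h).2.trans (hH n h).ge]
  have hM' : (1 : ℝ) ≤ M := by exact_mod_cast hM
  set K : ℝ := (M : ℝ) ^ 2 * ((2 * M : ℝ) ^ m) ^ 2 with hK
  have hK1 : 1 ≤ K := by
    have h1 : (1 : ℝ) ≤ (2 * M : ℝ) ^ m := one_le_pow₀ (by linarith)
    exact one_le_mul_of_one_le_of_one_le (one_le_pow₀ hM') (one_le_pow₀ h1)
  have hKs : 1 ≤ K ^ s := Real.one_le_rpow hK1 hs.le
  refine le_dimH_of_measure (P := P) (Ω := Ω) (H := H) (δ := 1 / ((M : ℝ) + 2)) (C := C * K ^ s)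
    hae hpos haH (by positivity) ?_ hs (by positivity) ?_ fun a ha => hE a (hpos a ha) (hΩD a ha)
  · intro a ha n
    refine val_shift_le (hpos a ha) ?_
    rcases hsep n with ⟨h1, h2⟩ | h
    exacts [Or.inl (h2 _ (hΩD a ha n h1)), Or.inr ((haH a ha _).trans h)]
  intro a ha n A hA
  have hA1 : (1 : ℝ) ≤ A.card := by exact_mod_cast hA.card_pos
  set j := n / m with hj
  set t := n % m with ht
  have htm : t < m := Nat.mod_lt n hm
  have hn : j * m + t = n := hdm n
  have hblk : ∀ b : ℕ → ℕ, (∀ i < n, b i = a i) → ∀ k < j, block m b k = block m a k := by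
    intro b hb k hk
    funext i
    refine hb _ ?_
    have : (k + 1) * m ≤ j * m := Nat.mul_le_mul_right m hk
    have hi := i.2
    rw [add_mul] at this
    omega
  have hQ0 : 0 ≤ ∏ k ∈ Finset.range j, weight W con D s k (block m a k) :=
    Finset.prod_nonneg fun _ _ => weight_nonneg _ _
  have hcb := cont_block_le (con := con) (D := D) (hpos a ha) (haH a ha) hs.le hZ hγZ hγ j
  have hcn := one_le_cont (hpos a ha) n
  have hcj := one_le_cont (hpos a ha) (j * m)
  by_cases hcon : con j
  · let F : Finset (Fin m → ℕ) := Fintype.piFinset fun i : Fin m =>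
      if (i : ℕ) < t then {a (j * m + i)} else if (i : ℕ) = t then A ∩ D n else D (j * m + i)
    refine (measure_mono ?_).trans ((hcyl a j F).trans (ENNReal.ofReal_le_ofReal ?_))
    · rintro b ⟨hb, hbn⟩
      refine ⟨hblk b hb, fun hbs => Fintype.mem_piFinset.2 fun i => ?_⟩
      rw [supp, if_pos hcon, Fintype.mem_piFinset] at hbs
      have hbi := hbs i
      split_ifs with h1 h2
      · rw [Finset.mem_singleton]
        exact hb _ (by omega)
      · rw [block, h2, hn, Finset.mem_inter]
        rw [block, h2, hn] at hbi
        exact ⟨hbn, hbi⟩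
      · exact hbi
    have hDpos : ∀ i < m, (0 : ℝ) < (D (j * m + i)).card := fun i hi => by
      exact_mod_cast (hD (j * m + i) (by rwa [block_div hi])).1.card_pos
    have hDn : (0 : ℝ) < (D n).card := hn ▸ hDpos t htm
    have hsum : ∑ u ∈ F, weight W con D s j u ≤
        (∏ i ∈ Finset.range t, ((D (j * m + i)).card : ℝ)⁻¹) * (((A ∩ D n).card : ℝ) / (D n).card) := by
      simp only [weight, if_pos hcon]
      rw [Finset.sum_const, Fintype.card_piFinset, nsmul_eq_mul, Nat.cast_prod,
        ← Finset.prod_mul_distrib, ← Finset.prod_range (fun i => (((if i < t then {a (j * m + i)} else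
          if i = t then A ∩ D n else D (j * m + i)) : Finset ℕ).card : ℝ) *
          ((D (j * m + i)).card : ℝ)⁻¹)]
      obtain ⟨r, hr⟩ := Nat.exists_eq_add_of_lt htm
      have hr' : m = (t + 1) + r := by omega
      rw [hr', Finset.prod_range_add, Finset.prod_range_succ, ← hr', if_neg (lt_irrefl t), if_pos rfl,
        hn, ← div_eq_mul_inv]
      have h1 : ∀ i ∈ Finset.range t, (((if i < t then {a (j * m + i)} else
          if i = t then A ∩ D n else D (j * m + i)) : Finset ℕ).card : ℝ) *
          ((D (j * m + i)).card : ℝ)⁻¹ = ((D (j * m + i)).card : ℝ)⁻¹ := by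
        intro i hi
        rw [if_pos (Finset.mem_range.1 hi), Finset.card_singleton, Nat.cast_one, one_mul]
      rw [Finset.prod_congr rfl h1]
      refine mul_le_of_le_one_right (mul_nonneg
        (Finset.prod_nonneg fun _ _ => inv_nonneg.2 (Nat.cast_nonneg _))
        (div_nonneg (Nat.cast_nonneg _) hDn.le))
        (Finset.prod_le_one (fun _ _ => mul_nonneg (Nat.cast_nonneg _)
          (inv_nonneg.2 (Nat.cast_nonneg _))) fun i hi => ?_)
      rw [if_neg (by omega), if_neg (by omega),
        mul_inv_cancel₀ (hDpos _ (by have := Finset.mem_range.1 hi; omega)).ne']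
    have hcc := cont_con_le (D := D) (γ := γ) (hpos a ha) (haH a ha) hs.le hcon hQ0 hcb t htm.le
    rw [← Finset.prod_range_add, hn] at hcc
    have hHn : (0 : ℝ) < H n := by exact_mod_cast (hpos a ha n).trans (haH a ha n)
    have hPi : 0 ≤ ∏ i ∈ Finset.range n, gain m con D H s γ i :=
      Finset.prod_nonneg fun _ _ => gain_nonneg hγ _
    refine (mul_le_mul_of_nonneg_left hsum hQ0).trans ?_
    rw [← mul_assoc]
    refine (min_card_le (A := A.card) (h := (H n : ℝ) ^ 2) (c := cont a n ^ 2) hs hs1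
      (Nat.cast_nonneg _) hDn (pow_pos hHn 2) (pow_pos (by linarith) 2) (Nat.cast_nonneg _) ?_ ?_ hcc hPi (hgain' n hcon)).trans ?_
    · exact_mod_cast Finset.card_le_card Finset.inter_subset_right
    · exact_mod_cast Finset.card_le_card Finset.inter_subset_left
    · have : C * 1 ≤ C * K ^ s := by gcongr
      rw [mul_one] at this
      gcongr
  · refine (measure_mono ?_).trans ((hcyl a j (supp W con D j)).trans (ENNReal.ofReal_le_ofReal ?_))
    · rintro b ⟨hb, -⟩
      exact ⟨hblk b hb, id⟩
    rw [sum_weight (fun n h => (hD n h).1) hZ, mul_one, hH n hcon]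
    have hct : ∀ i ≤ t, cont a (j * m + i) ≤ cont a (j * m) * (2 * M) ^ i := by
      intro i hi
      induction i with
      | zero => simp
      | succ i ih =>
        have ih := ih (by omega)
        have h1 : (a (j * m + i) : ℝ) ≤ M := by
          exact_mod_cast (hΩW a ha (j * m + i) (by rwa [block_div (by omega)])).2
        have h0 := one_le_cont (hpos a ha) (j * m + i)
        calc cont a (j * m + i + 1) ≤ 2 * a (j * m + i) * cont a (j * m + i) :=
              cont_succ_le (hpos a ha) _
          _ ≤ 2 * M * (cont a (j * m) * (2 * M) ^ i) := by gcongr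
          _ = _ := by ring
    have h1 : cont a n ≤ cont a (j * m) * (2 * M) ^ m := by
      rw [← hn]
      refine (hct t le_rfl).trans ?_
      have : (2 * (M : ℝ)) ^ t ≤ (2 * M) ^ m := pow_le_pow_right₀ (by linarith) htm.le
      gcongr
    have h2 : (cont a (j * m) ^ 2)⁻¹ ≤ K * (A.card / ((M : ℝ) ^ 2 * cont a n ^ 2)) := by
      rw [inv_eq_one_div, mul_div_assoc', div_le_div_iff₀ (by positivity) (by positivity), one_mul]
      calc (M : ℝ) ^ 2 * cont a n ^ 2 ≤ (M : ℝ) ^ 2 * (cont a (j * m) * (2 * M) ^ m) ^ 2 := by gcongr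
        _ = K * 1 * cont a (j * m) ^ 2 := by rw [hK]; ring
        _ ≤ _ := by gcongr
    have h3 : ((cont a (j * m) ^ 2)⁻¹) ^ s ≤
        K ^ s * (A.card / ((M : ℝ) ^ 2 * cont a n ^ 2)) ^ s := by
      rw [← Real.mul_rpow (by positivity) (by positivity)]
      gcongr
    have hps : 0 < (cont a (j * m) ^ 2) ^ s := by positivity
    calc _ ≤ C * ((cont a (j * m) ^ 2)⁻¹) ^ s := by
          rw [Real.inv_rpow (by positivity), ← div_eq_mul_inv, le_div_iff₀ hps, mul_comm]
          exact hcb.trans (hgain _)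
      _ ≤ C * (K ^ s * (A.card / ((M : ℝ) ^ 2 * cont a n ^ 2)) ^ s) := by gcongr
      _ = _ := by ring

lemma prime_window_bounds {B b s : ℝ} (hB : 1 < B) (hs : 0 < s) (hs1 : s ≤ 1) (hb : 0 ≤ b)
    (hb1 : b ≤ 1) (p : ℕ)
    (hX : B ^ (((p : ℝ) + 1) * b) ≤
      (primesIn (B ^ (((p : ℝ) + 1) * b))).card * Real.log (8 * B ^ (((p : ℝ) + 1) * b))) :
    (primesIn (B ^ (((p : ℝ) + 1) * b))).Nonempty ∧
    ((2 * ⌊8 * B ^ (((p : ℝ) + 1) * b)⌋₊ : ℝ) ^ 2) ^ s / (primesIn (B ^ (((p : ℝ) + 1) * b))).card ≤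
      256 * (Real.log 8 + Real.log B) * ((p : ℝ) + 1) * B ^ (((p : ℝ) + 1) * ((2 * s - 1) * b)) ∧
    ((⌊8 * B ^ (((p : ℝ) + 1) * b)⌋₊ : ℝ) ^ 2 / (primesIn (B ^ (((p : ℝ) + 1) * b))).card) ^ s ≤
      256 * (Real.log 8 + Real.log B) * ((p : ℝ) + 1) * B ^ (((p : ℝ) + 1) * (s * b)) := by
  have hB0 : 0 < B := by linarith
  have hp : (1 : ℝ) ≤ (p : ℝ) + 1 := by linarith [(p.cast_nonneg : (0 : ℝ) ≤ p)]
  have e1 : B ^ (((p : ℝ) + 1) * ((2 * s - 1) * b)) = (B ^ (((p : ℝ) + 1) * b)) ^ (2 * s - 1) := by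
    rw [← Real.rpow_mul hB0.le]; congr 1; ring
  have e2 : B ^ (((p : ℝ) + 1) * (s * b)) = (B ^ (((p : ℝ) + 1) * b)) ^ s := by
    rw [← Real.rpow_mul hB0.le]; congr 1; ring
  have hlogX : Real.log (B ^ (((p : ℝ) + 1) * b)) = ((p : ℝ) + 1) * b * Real.log B :=
    Real.log_rpow hB0 _
  have hX1 : 1 ≤ B ^ (((p : ℝ) + 1) * b) := Real.one_le_rpow hB.le (by positivity)
  rw [e1, e2]
  clear e1 e2
  generalize B ^ (((p : ℝ) + 1) * b) = X at *
  have hX0 : 0 < X := by linarith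
  have hlB : 0 < Real.log B := Real.log_pos hB
  have hl8 : 1 ≤ Real.log 8 := by
    rw [show (8 : ℝ) = 2 ^ 3 by norm_num, Real.log_pow]
    have := Real.log_two_gt_d9
    push_cast
    linarith
  set L := Real.log 8 + Real.log B with hL
  have hL1 : 1 ≤ L := by linarith
  have hlog : Real.log (8 * X) ≤ L * ((p : ℝ) + 1) := by
    rw [Real.log_mul (by norm_num) hX0.ne', hlogX, hL, add_mul]
    have h1 : ((p : ℝ) + 1) * b * Real.log B ≤ ((p : ℝ) + 1) * 1 * Real.log B := by gcongr
    nlinarith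
  have hT1 : 1 ≤ L * ((p : ℝ) + 1) := one_le_mul_of_one_le_of_one_le hL1 hp
  set T := L * ((p : ℝ) + 1) with hT
  have hcard : X ≤ (primesIn X).card * T := hX.trans (by gcongr)
  have hc0 : (0 : ℝ) < (primesIn X).card := by
    by_contra h
    have h0 : ((primesIn X).card : ℝ) = 0 := le_antisymm (not_lt.1 h) (Nat.cast_nonneg _)
    rw [h0, zero_mul] at hcard
    linarith
  have hfl : (⌊8 * X⌋₊ : ℝ) ≤ 8 * X := Nat.floor_le (by positivity)
  have hinv : ((primesIn X).card : ℝ)⁻¹ ≤ T / X := by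
    rw [inv_eq_one_div, div_le_div_iff₀ hc0 hX0]; linarith
  refine ⟨Finset.card_pos.1 (by exact_mod_cast hc0), ?_, ?_⟩
  · rw [div_eq_mul_inv]
    calc _ ≤ ((2 * (8 * X)) ^ 2) ^ s * (T / X) := by gcongr
      _ = 256 ^ s * (T * X ^ (2 * s - 1)) := by
        rw [show (2 * (8 * X)) ^ 2 = 256 * X ^ 2 by ring, Real.mul_rpow (by norm_num) (by positivity),
          ← Real.rpow_natCast X 2, ← Real.rpow_mul hX0.le, Real.rpow_sub_one hX0.ne']
        push_cast
        ring
      _ ≤ 256 * (T * X ^ (2 * s - 1)) := by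
        have : (256 : ℝ) ^ s ≤ 256 := Real.rpow_le_self_of_one_le (by norm_num) hs1
        gcongr
      _ = _ := by ring
  · rw [div_eq_mul_inv]
    calc _ ≤ ((8 * X) ^ 2 * (T / X)) ^ s := by gcongr
      _ = (64 * T) ^ s * X ^ s := by
        rw [← Real.mul_rpow (by positivity) (by positivity)]
        congr 1
        field_simp
        norm_num
      _ ≤ (64 * T) * X ^ s := by
        gcongr
        exact Real.rpow_le_self_of_one_le (by linarith) hs1
      _ ≤ 256 * T * X ^ s := by gcongr; norm_num
      _ = _ := by ring

/-- If a product of factors is at most one at `a`, all factors on `[a, q)` are at most `c`, and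
all of them except `2 m` equal `γ ≤ 1`, the product is controlled on `[a, q]`. -/
lemma prod_gap_le {g : ℕ → ℝ} {c γ : ℝ} {m a q : ℕ} (hg : ∀ n, 0 ≤ g n) (hc : 1 ≤ c) (hγ : 0 ≤ γ)
    (hγ1 : γ ≤ 1) (haq : a + 2 * m ≤ q) (ha : ∏ i ∈ Finset.range a, g i ≤ 1)
    (hgc : ∀ n, a ≤ n → n < q → g n ≤ c) (hgγ : ∀ n, a + m ≤ n → n + m < q → g n = γ) :
    (∀ n, a ≤ n → n ≤ q → ∏ i ∈ Finset.range n, g i ≤ c ^ (2 * m)) ∧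
      ∏ i ∈ Finset.range q, g i ≤ c ^ (2 * m) * γ ^ (q - a - 2 * m) := by
  have hstart : ∀ k, k ≤ m → ∏ i ∈ Finset.range (a + k), g i ≤ c ^ k := by
    intro k hk
    induction k with
    | zero => simpa using ha
    | succ k ih =>
      rw [← add_assoc, Finset.prod_range_succ, pow_succ]
      exact mul_le_mul (ih (by omega)) (hgc _ (by omega) (by omega)) (hg _) (by positivity)
  have hmid : ∀ k, a + 2 * m + k ≤ q → ∏ i ∈ Finset.range (a + m + k), g i ≤ c ^ m * γ ^ k := by
    intro k hk
    induction k with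
    | zero => simpa using hstart m le_rfl
    | succ k ih =>
      rw [← add_assoc, Finset.prod_range_succ, pow_succ, hgγ (a + m + k) (by omega) (by omega),
        ← mul_assoc]
      gcongr
      exact ih (by omega)
  obtain ⟨r, rfl⟩ := Nat.exists_eq_add_of_le haq
  have hend : ∀ k, k ≤ m → ∏ i ∈ Finset.range (a + m + r + k), g i ≤ c ^ (m + k) * γ ^ r := by
    intro k hk
    induction k with
    | zero => simpa using hmid r le_rfl
    | succ k ih =>
      rw [← add_assoc, Finset.prod_range_succ]
      calc _ ≤ (c ^ (m + k) * γ ^ r) * c :=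
            mul_le_mul (ih (by omega)) (hgc _ (by omega) (by omega)) (hg _) (by positivity)
        _ = _ := by rw [← add_assoc, pow_succ]; ring
  have hγr : ∀ r, γ ^ r ≤ 1 := fun r => pow_le_one₀ hγ hγ1
  refine ⟨fun n han hnq => ?_, ?_⟩
  · rcases le_total n (a + m) with h | h
    · obtain ⟨k, rfl⟩ := Nat.exists_eq_add_of_le han
      exact (hstart k (by omega)).trans (pow_le_pow_right₀ hc (by omega))
    rcases le_total n (a + m + r) with h' | h'
    · obtain ⟨k, rfl⟩ := Nat.exists_eq_add_of_le h
      refine (hmid k (by omega)).trans ((mul_le_of_le_one_right (by positivity) (hγr k)).trans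
        (pow_le_pow_right₀ hc (by omega)))
    · obtain ⟨k, rfl⟩ := Nat.exists_eq_add_of_le h'
      refine (hend k (by omega)).trans ((mul_le_of_le_one_right (by positivity) (hγr r)).trans
        (pow_le_pow_right₀ hc (by omega)))
  · have := hend m le_rfl
    rw [show a + 2 * m + r - a - 2 * m = r by omega, show a + 2 * m + r = a + m + r + m by ring,
      two_mul]
    exact this

section Windows

variable {ℓ : ℕ} {a φ : ℕ → ℕ}

lemma window_lt (haφ : ∀ k, a k ≤ φ k) (ha : ∀ k, a (k + 1) = φ k + ℓ) {j k : ℕ} (h : j < k) :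
    φ j + ℓ ≤ a k := by
  rw [← ha]
  exact monotone_nat_of_le_succ (fun i => by rw [ha]; have := haφ i; omega) h

lemma mem_gap_or_window (ha0 : a 0 = 0) (haφ : ∀ k, a k < φ k) (ha : ∀ k, a (k + 1) = φ k + ℓ)
    (n : ℕ) : ∃ k, (a k ≤ n ∧ n < φ k) ∨ ∃ i < ℓ, n = φ k + i := by
  have h : ∀ k, k ≤ a k := fun k => by
    induction k with
    | zero => omega
    | succ k ih => rw [ha]; have := haφ k; omega
  have hex : ∃ k, n < a k := ⟨n + 1, h (n + 1)⟩
  classical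
  obtain ⟨k, hk⟩ : ∃ k, Nat.find hex = k + 1 := by
    refine Nat.exists_eq_succ_of_ne_zero fun h0 => ?_
    have := Nat.find_spec hex
    rw [h0, ha0] at this
    omega
  have h1 := Nat.find_spec hex
  have h2 := Nat.find_min hex (m := k) (by omega)
  rw [hk, ha] at h1
  refine ⟨k, ?_⟩
  by_cases hn : n < φ k
  · exact Or.inl ⟨by omega, hn⟩
  · exact Or.inr ⟨n - φ k, by omega, by omega⟩

lemma exists_window_extension (haφ : ∀ k, a k ≤ φ k) (ha : ∀ k, a (k + 1) = φ k + ℓ)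
    (X : ℕ → ℕ → ℝ) : ∃ F : ℕ → ℝ, (∀ k, ∀ i < ℓ, F (φ k + i) = X k i) ∧
      ∀ k n, a k ≤ n → n < φ k → F n = 0 := by
  classical
  refine ⟨fun n => if h : ∃ p : ℕ × ℕ, p.2 < ℓ ∧ n = φ p.1 + p.2 then X h.choose.1 h.choose.2
    else 0, fun k i hi => ?_, fun k n h1 h2 => ?_⟩
  · have h : ∃ p : ℕ × ℕ, p.2 < ℓ ∧ φ k + i = φ p.1 + p.2 := ⟨(k, i), hi, rfl⟩
    simp only [dif_pos h]
    obtain ⟨h1, h2⟩ := h.choose_spec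
    have hk : h.choose.1 = k := by
      rcases lt_trichotomy h.choose.1 k with h3 | h3 | h3
      · have := window_lt haφ ha h3
        have := haφ k
        omega
      · exact h3
      · have := window_lt haφ ha h3
        have := haφ h.choose.1
        omega
    have hi' : h.choose.2 = i := by rw [hk] at h2; omega
    rw [hk, hi']
  · refine dif_neg ?_
    rintro ⟨⟨j, i⟩, hi, rfl⟩
    simp only at hi h1 h2
    rcases lt_or_ge j k with h3 | h3
    · have := window_lt haφ ha h3
      omega
    · rcases h3.eq_or_lt with h3 | h3
      · subst h3; omega
      · have := window_lt haφ ha h3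
        have := haφ j
        omega

/-- Control of a product of nonnegative factors along alternating gaps `[a k, φ k)`, where most
factors equal a small `γ`, and windows `[φ k, φ k + ℓ)`, where the partial products are bounded. -/
lemma prod_windows_le {g Y : ℕ → ℝ} {c γ : ℝ} {m : ℕ} (ha0 : a 0 = 0)
    (haφ : ∀ k, a k + 2 * m ≤ φ k) (ha : ∀ k, a (k + 1) = φ k + ℓ) (hg : ∀ n, 0 ≤ g n) (hc : 1 ≤ c)
    (hγ : 0 ≤ γ) (hγ1 : γ ≤ 1) (hY : ∀ k, 0 ≤ Y k)
    (hgc : ∀ k n, a k ≤ n → n < φ k → g n ≤ c)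
    (hgγ : ∀ k n, a k + m ≤ n → n + m < φ k → g n = γ)
    (hwin : ∀ k, ∏ i ∈ Finset.range ℓ, g (φ k + i) ≤ Y k)
    (hdecay : ∀ k, c ^ (2 * m) * γ ^ (φ k - a k - 2 * m) * Y k ≤ 1) (k : ℕ) :
    (∀ n, a k ≤ n → n ≤ φ k → ∏ i ∈ Finset.range n, g i ≤ c ^ (2 * m)) ∧
      (∏ i ∈ Finset.range (φ k), g i) * Y k ≤ 1 := by
  have key : ∀ k, ∏ i ∈ Finset.range (a k), g i ≤ 1 := by
    intro k
    induction k with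
    | zero => simp [ha0]
    | succ k ih =>
      have h := (prod_gap_le hg hc hγ hγ1 (haφ k) ih (hgc k) (hgγ k)).2
      rw [ha, Finset.prod_range_add]
      exact (mul_le_mul h (hwin k) (Finset.prod_nonneg fun i _ => hg _) (by positivity)).trans
        (hdecay k)
  have h := prod_gap_le hg hc hγ hγ1 (haφ k) (key k) (hgc k) (hgγ k)
  exact ⟨h.1, (mul_le_mul_of_nonneg_right h.2 (hY k)).trans (hdecay k)⟩

end Windows

/-- A continued fraction whose digits in infinitely many windows are large primes lies in the
limsup set. -/
lemma val_mem_EprimeℓN {ℓ : ℕ} {B : ℝ} {𝒩 : Set ℕ} {φ b : ℕ → ℕ} {β : ℕ → ℝ} (hB : 0 < B)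
    (hφ : StrictMono φ) (hφN : ∀ k, φ k + 1 ∈ 𝒩) (hsum : ∑ i ∈ Finset.range ℓ, β i = 1)
    (hb : ∀ n, 1 ≤ b n)
    (hbp : ∀ k, ∀ i < ℓ, b (φ k + i) ∈ primesIn (B ^ (((φ k : ℝ) + 1) * β i))) :
    val b ∈ EprimeℓN ℓ B 𝒩 := by
  refine ⟨⟨(val_pos hb).le, val_lt_one hb⟩, irrational_val hb, ?_⟩
  have hinj : Function.Injective fun k => φ k + 1 := fun j k h => hφ.injective (by simpa using h)
  refine (infinite_range_of_injective hinj).mono ?_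
  rintro _ ⟨k, rfl⟩
  refine ⟨hφN k, by simp, ?_⟩
  calc B ^ (φ k + 1) = ∏ i ∈ Finset.range ℓ, B ^ (((φ k : ℝ) + 1) * β i) := by
        rw [← Real.rpow_sum_of_pos hB, ← Finset.mul_sum, hsum, mul_one, ← Real.rpow_natCast]
        push_cast
        rfl
    _ ≤ _ := by
        refine Finset.prod_le_prod (fun i _ => by positivity) fun i hi => ?_
        have h := of_mem_primesIn (by positivity) (hbp k i (Finset.mem_range.1 hi))
        rw [show φ k + 1 + i = φ k + i + 1 by ring, cfA', cfA_val hb, if_pos h.1]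
        exact h.2.1

lemma exponent_le {ℓ : ℕ} {s f : ℝ} {β : ℕ → ℝ} (hs1 : s ≤ 1) (hf0 : 0 ≤ f)
    (hβ : ∀ i, 0 ≤ β i)
    (hf : ∀ i < ℓ, (2 * s - 1) * ∑ j ∈ Finset.range i, β j + s * β i ≤ f) :
    ∀ i ≤ ℓ, (2 * s - 1) * ∑ j ∈ Finset.range i, β j ≤ f := by
  rintro (_ | i) hi
  · simpa using hf0
  · rw [Finset.sum_range_succ]
    have := hf i (by omega)
    have := mul_nonneg (sub_nonneg.2 hs1) (hβ i)
    nlinarith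

theorem le_dimH_of_windows {ℓ m M : ℕ} {B s f γ : ℝ} {𝒩 : Set ℕ} {a φ : ℕ → ℕ} {β : ℕ → ℝ}
    {W : Finset (Fin m → ℕ)} (hB : 1 < B) (hs : 0 < s) (hs1 : s ≤ 1) (hf0 : 0 ≤ f)
    (hβ : ∀ i, 0 ≤ β i) (hβ1 : ∀ i < ℓ, β i ≤ 1) (hsum : ∑ i ∈ Finset.range ℓ, β i = 1)
    (hf : ∀ i < ℓ, (2 * s - 1) * ∑ j ∈ Finset.range i, β j + s * β i ≤ f)
    (hm : 0 < m) (hM : 2 ≤ M) (hγ : 0 ≤ γ) (hγ1 : γ ≤ 1) (hW : ∀ u ∈ W, ∀ t, 1 ≤ u t ∧ u t ≤ M)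
    (hZ : 0 < ∑ v ∈ W, (den (List.ofFn v) 0 ^ 2) ^ (-s))
    (hγZ : 4 ^ s ≤ γ ^ m * ∑ v ∈ W, (den (List.ofFn v) 0 ^ 2) ^ (-s))
    (ha0 : a 0 = 0) (haφ : ∀ k, a k + 2 * m ≤ φ k) (ha : ∀ k, a (k + 1) = φ k + ℓ)
    (hφN : ∀ k, φ k + 1 ∈ 𝒩)
    (hX : ∀ k, ∀ i < ℓ, B ^ (((φ k : ℝ) + 1) * β i) ≤ (primesIn (B ^ (((φ k : ℝ) + 1) * β i))).card *
      Real.log (8 * B ^ (((φ k : ℝ) + 1) * β i)))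
    (hdecay : ∀ k, (((2 * M : ℝ) ^ 2) ^ s) ^ (2 * m) * γ ^ (φ k - a k - 2 * m) *
      ((256 * (Real.log 8 + Real.log B) * ((φ k : ℝ) + 1)) ^ (ℓ + 1) *
        B ^ (((φ k : ℝ) + 1) * f)) ≤ 1) :
    ENNReal.ofReal s ≤ dimH (EprimeℓN ℓ B 𝒩) := by
  classical
  have hB0 : 0 < B := by linarith
  have hle : ∀ k, a k ≤ φ k := fun k => by have := haφ k; omega
  have hlt : ∀ k, a k < φ k := fun k => by have := haφ k; omega
  have hφm : StrictMono φ := strictMono_nat_of_lt_succ fun k => by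
    have := haφ (k + 1); have := ha k; omega
  obtain ⟨F, hFX, hF0⟩ := exists_window_extension hle ha fun k i => B ^ (((φ k : ℝ) + 1) * β i)
  let D : ℕ → Finset ℕ := fun n => if 0 < F n then primesIn (F n) else {2}
  let H : ℕ → ℕ := fun n => if 0 < F n then ⌊8 * F n⌋₊ else M
  have hDw : ∀ k, ∀ i < ℓ, D (φ k + i) = primesIn (B ^ (((φ k : ℝ) + 1) * β i)) := by
    intro k i hi
    simp only [D, hFX k i hi]
    rw [if_pos (by positivity)]
  have hHw : ∀ k, ∀ i < ℓ, H (φ k + i) = ⌊8 * B ^ (((φ k : ℝ) + 1) * β i)⌋₊ := by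
    intro k i hi
    simp only [H, hFX k i hi]
    rw [if_pos (by positivity)]
  have hDg : ∀ k n, a k ≤ n → n < φ k → D n = {2} := by
    intro k n h1 h2
    simp only [D, hF0 k n h1 h2, lt_irrefl, if_false]
  have hHg : ∀ k n, a k ≤ n → n < φ k → H n = M := by
    intro k n h1 h2
    simp only [H, hF0 k n h1 h2, lt_irrefl, if_false]
  let con : ℕ → Prop := fun j => ∃ k, j * m < φ k + ℓ ∧ φ k ≤ (j + 1) * m
  have hdiv : ∀ n, n / m * m ≤ n := fun n => Nat.div_mul_le_self n m
  have hdiv' : ∀ n, n < (n / m + 1) * m := fun n =>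
    (Nat.div_lt_iff_lt_mul hm).1 (Nat.lt_succ_self _)
  have hconw : ∀ k, ∀ i < ℓ, con ((φ k + i) / m) := fun k i hi =>
    ⟨k, by have := hdiv (φ k + i); omega, by have := hdiv' (φ k + i); omega⟩
  have hcong : ∀ k n, a k + m ≤ n → n + m < φ k → ¬ con (n / m) := by
    rintro k n h1 h2 ⟨k', h3, h4⟩
    have h5 := hdiv n
    have h6 := hdiv' n
    rw [add_mul, one_mul] at h4 h6
    rcases lt_or_ge k' k with h | h
    · have := window_lt hle ha h
      omega
    · have := hφm.monotone h
      omega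
  have hD2 : ∀ n, ∀ d ∈ D n, 2 ≤ d := by
    intro n d hd
    obtain ⟨k, ⟨h1, h2⟩ | ⟨i, hi, rfl⟩⟩ := mem_gap_or_window ha0 hlt ha n
    · rw [hDg k n h1 h2, Finset.mem_singleton] at hd
      omega
    · rw [hDw k i hi] at hd
      exact (of_mem_primesIn (by positivity) hd).1.two_le
  set g := gain m con D H s γ with hg
  have hg0 : ∀ n, 0 ≤ g n := gain_nonneg hγ
  set c : ℝ := ((2 * M : ℝ) ^ 2) ^ s with hc
  have hM' : (2 : ℝ) ≤ M := by exact_mod_cast hM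
  have hc1 : 1 ≤ c := Real.one_le_rpow (by nlinarith) hs.le
  have hgc : ∀ k n, a k ≤ n → n < φ k → g n ≤ c := by
    intro k n h1 h2
    simp only [hg, gain, hDg k n h1 h2, hHg k n h1 h2]
    split_ifs
    · simp [hc]
    · exact hγ1.trans hc1
  have hgγ : ∀ k n, a k + m ≤ n → n + m < φ k → g n = γ := fun k n h1 h2 => by
    simp only [hg, gain, if_neg (hcong k n h1 h2)]
  have hbd := fun k i (hi : i < ℓ) =>
    prime_window_bounds hB hs hs1 (hβ i) (hβ1 i hi) (φ k) (hX k i hi)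
  have hgw : ∀ k, ∀ i < ℓ, g (φ k + i) ≤ 256 * (Real.log 8 + Real.log B) * ((φ k : ℝ) + 1) *
      B ^ (((φ k : ℝ) + 1) * ((2 * s - 1) * β i)) := by
    intro k i hi
    have := (hbd k i hi).2.1
    simp only [hg, gain, if_pos (hconw k i hi), hDw k i hi, hHw k i hi]
    exact this
  have hT1 : ∀ k, 1 ≤ 256 * (Real.log 8 + Real.log B) * ((φ k : ℝ) + 1) := by
    intro k
    have h1 : 0 < Real.log B := Real.log_pos hB
    have h2 : 1 ≤ Real.log 8 := by
      rw [show (8 : ℝ) = 2 ^ 3 by norm_num, Real.log_pow]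
      have := Real.log_two_gt_d9
      push_cast
      linarith
    have h3 : (0 : ℝ) ≤ φ k := Nat.cast_nonneg _
    exact one_le_mul_of_one_le_of_one_le (by linarith) (by linarith)
  have hprodw : ∀ k, ∀ i ≤ ℓ, ∏ j ∈ Finset.range i, g (φ k + j) ≤
      (256 * (Real.log 8 + Real.log B) * ((φ k : ℝ) + 1)) ^ i *
        B ^ (((φ k : ℝ) + 1) * ((2 * s - 1) * ∑ j ∈ Finset.range i, β j)) := by
    intro k i hi
    calc _ ≤ ∏ j ∈ Finset.range i, (256 * (Real.log 8 + Real.log B) * ((φ k : ℝ) + 1) *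
          B ^ (((φ k : ℝ) + 1) * ((2 * s - 1) * β j))) :=
          Finset.prod_le_prod (fun j _ => hg0 _) fun j hj => hgw k j (by
            have := Finset.mem_range.1 hj; omega)
      _ = _ := by
          rw [Finset.prod_mul_distrib, Finset.prod_const, Finset.card_range,
            ← Real.rpow_sum_of_pos hB0, Finset.mul_sum, Finset.mul_sum]
  set Y : ℕ → ℝ := fun k => (256 * (Real.log 8 + Real.log B) * ((φ k : ℝ) + 1)) ^ (ℓ + 1) *
        B ^ (((φ k : ℝ) + 1) * f) with hYdef
  have hYle : ∀ k, ∀ i ≤ ℓ + 1, ∀ e ≤ f,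
      (256 * (Real.log 8 + Real.log B) * ((φ k : ℝ) + 1)) ^ i * B ^ (((φ k : ℝ) + 1) * e) ≤ Y k := by
    intro k i hi e he
    have h1 := hT1 k
    have h2 := pow_le_pow_right₀ h1 hi
    have h3 : B ^ (((φ k : ℝ) + 1) * e) ≤ B ^ (((φ k : ℝ) + 1) * f) :=
      Real.rpow_le_rpow_of_exponent_le hB.le (by gcongr)
    exact mul_le_mul h2 h3 (by positivity) (pow_nonneg (by linarith) _)
  have hY0 : ∀ k, 0 ≤ Y k := fun k =>
    mul_nonneg (pow_nonneg (by linarith [hT1 k]) _) (by positivity)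
  have hfle := exponent_le hs1 hf0 hβ hf
  have hmain := prod_windows_le ha0 haφ ha hg0 hc1 hγ hγ1 hY0 hgc hgγ
    (fun k => (hprodw k ℓ le_rfl).trans (hYle k ℓ (by omega) _ (hfle ℓ le_rfl))) hdecay
  have hwle : ∀ k (x : ℝ), x ≤ Y k → (∏ i ∈ Finset.range (φ k), g i) * x ≤ 1 :=
    fun k x hx => (mul_le_mul_of_nonneg_left hx (Finset.prod_nonneg fun i _ => hg0 i)).trans
      (hmain k).2
  have hc2 : 1 ≤ c ^ (2 * m) := one_le_pow₀ hc1
  have hM2 : 1 ≤ ((M : ℝ) ^ 2) ^ s := Real.one_le_rpow (by nlinarith) hs.le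
  have hC1 : 1 ≤ c ^ (2 * m) * ((M : ℝ) ^ 2) ^ s := one_le_mul_of_one_le_of_one_le hc2 hM2
  refine le_dimH_of_scheme (M := M) (C := c ^ (2 * m) * ((M : ℝ) ^ 2) ^ s) (W := W) (con := con)
    (D := D) (H := H) hm (by omega) hs hs1 hγ (by linarith) hW hZ hγZ ?_ ?_ ?_ ?_ ?_ ?_
  · intro n _
    obtain ⟨k, ⟨h1, h2⟩ | ⟨i, hi, rfl⟩⟩ := mem_gap_or_window ha0 hlt ha n
    · rw [hDg k n h1 h2, hHg k n h1 h2]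
      simp [hM]
    · rw [hDw k i hi, hHw k i hi]
      refine ⟨(hbd k i hi).1, fun d hd => ?_⟩
      have h := of_mem_primesIn (by positivity) hd
      exact ⟨h.1.one_le, Nat.le_floor h.2.2⟩
  · intro n hn
    obtain ⟨k, ⟨h1, h2⟩ | ⟨i, hi, rfl⟩⟩ := mem_gap_or_window ha0 hlt ha n
    · exact hHg k n h1 h2
    · exact absurd (hconw k i hi) hn
  · intro n
    obtain ⟨k, ⟨h1, h2⟩ | ⟨i, hi, h⟩⟩ := mem_gap_or_window ha0 hlt ha (n + 1)
    · exact Or.inr (hHg k _ h1 h2).le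
    · refine Or.inl ⟨⟨k, ?_, ?_⟩, hD2 n⟩
      · have := hdiv n
        omega
      · have := hdiv' n
        omega
  · intro n
    obtain ⟨k, ⟨h1, h2⟩ | ⟨i, hi, rfl⟩⟩ := mem_gap_or_window ha0 hlt ha n
    · exact ((hmain k).1 n h1 h2.le).trans (le_mul_of_one_le_right (by linarith) hM2)
    · rw [Finset.prod_range_add]
      exact (hwle k _ ((hprodw k i hi.le).trans (hYle k i (by omega) _ (hfle i hi.le)))).trans hC1
  · intro n _
    obtain ⟨k, ⟨h1, h2⟩ | ⟨i, hi, rfl⟩⟩ := mem_gap_or_window ha0 hlt ha n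
    · rw [hDg k n h1 h2, hHg k n h1 h2]
      simp only [Finset.card_singleton, Nat.cast_one, div_one]
      exact mul_le_mul_of_nonneg_right ((hmain k).1 n h1 h2.le) (by positivity)
    · rw [Finset.prod_range_add, mul_assoc, hDw k i hi, hHw k i hi]
      refine (hwle k _ ((mul_le_mul (hprodw k i hi.le) (hbd k i hi).2.2 (by positivity)
          (mul_nonneg (pow_nonneg (by linarith [hT1 k]) _) (by positivity))).trans ?_)).trans hC1
      refine le_trans (le_of_eq ?_) (hYle k (i + 1) (by omega) _ (hf i hi))
      rw [mul_mul_mul_comm, ← pow_succ, ← Real.rpow_add hB0,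
        mul_add ((φ k : ℝ) + 1)]
  · intro b hb hbD
    refine val_mem_EprimeℓN hB0 hφm hφN hsum hb fun k i hi => ?_
    rw [← hDw k i hi]
    exact hbD _ (hconw k i hi)

lemma tendsto_window_decay {B f γ : ℝ} (hB : 1 < B) (hγ : 0 < γ) (hγB : γ * B ^ f < 1)
    (c L : ℝ) (k r : ℕ) :
    Tendsto (fun q : ℕ => c * γ ^ (q - r) * ((L * ((q : ℝ) + 1)) ^ k * B ^ (((q : ℝ) + 1) * f)))
      atTop (nhds 0) := by
  have hB0 : 0 < B := by linarith
  have h := ((tendsto_pow_const_mul_const_pow_of_lt_one k (by positivity) hγB).comp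
    (tendsto_add_atTop_nat 1)).const_mul (c * L ^ k / γ ^ (r + 1))
  rw [mul_zero] at h
  refine h.congr' ?_
  filter_upwards [eventually_ge_atTop r] with q hq
  have e : B ^ (((q : ℝ) + 1) * f) = (B ^ f) ^ (q + 1) := by
    rw [mul_comm, Real.rpow_mul hB0.le, ← Real.rpow_natCast]
    push_cast
    rfl
  obtain ⟨t, rfl⟩ := Nat.exists_eq_add_of_le hq
  rw [e, Nat.add_sub_cancel_left]
  simp only [Function.comp_apply]
  push_cast
  rw [mul_pow γ, mul_pow L, show r + t + 1 = t + (r + 1) by ring, pow_add γ]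
  field_simp
  ring

theorem le_dimH_of_words {ℓ m M : ℕ} {B s f γ : ℝ} {𝒩 : Set ℕ} {β : ℕ → ℝ}
    {W : Finset (Fin m → ℕ)} (hB : 1 < B) (hs : 0 < s) (hs1 : s ≤ 1) (hf0 : 0 ≤ f)
    (h𝒩 : 𝒩.Infinite) (hβ : ∀ i, 0 < β i) (hsum : ∑ i ∈ Finset.range ℓ, β i = 1)
    (hf : ∀ i < ℓ, (2 * s - 1) * ∑ j ∈ Finset.range i, β j + s * β i ≤ f)
    (hm : 0 < m) (hM : 2 ≤ M) (hγ : 0 < γ) (hγB : γ * B ^ f < 1)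
    (hW : ∀ u ∈ W, ∀ t, 1 ≤ u t ∧ u t ≤ M)
    (hγZ : 4 ^ s ≤ γ ^ m * ∑ v ∈ W, (den (List.ofFn v) 0 ^ 2) ^ (-s)) :
    ENNReal.ofReal s ≤ dimH (EprimeℓN ℓ B 𝒩) := by
  have hBf : 1 ≤ B ^ f := Real.one_le_rpow hB.le hf0
  have hγ1 : γ ≤ 1 := by nlinarith
  have hZ : 0 < ∑ v ∈ W, (den (List.ofFn v) 0 ^ 2) ^ (-s) :=
    pos_of_mul_pos_right (lt_of_lt_of_le (by positivity) hγZ) (by positivity)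
  have hβ1 : ∀ i < ℓ, β i ≤ 1 := fun i hi => by
    rw [← hsum]
    exact Finset.single_le_sum (fun j _ => (hβ j).le) (Finset.mem_range.2 hi)
  have hnext : ∀ a : ℕ, ∃ q : ℕ, a + 2 * m ≤ q ∧ q + 1 ∈ 𝒩 ∧
      (∀ i < ℓ, B ^ (((q : ℝ) + 1) * β i) ≤ (primesIn (B ^ (((q : ℝ) + 1) * β i))).card *
        Real.log (8 * B ^ (((q : ℝ) + 1) * β i))) ∧
      (((2 * M : ℝ) ^ 2) ^ s) ^ (2 * m) * γ ^ (q - (a + 2 * m)) *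
        ((256 * (Real.log 8 + Real.log B) * ((q : ℝ) + 1)) ^ (ℓ + 1) *
          B ^ (((q : ℝ) + 1) * f)) ≤ 1 := by
    intro a
    have h1 := (tendsto_window_decay hB hγ hγB ((((2 * M : ℝ) ^ 2) ^ s) ^ (2 * m))
      (256 * (Real.log 8 + Real.log B)) (ℓ + 1) (a + 2 * m)).eventually_le_const zero_lt_one
    have h2 : ∀ᶠ q : ℕ in atTop, ∀ i < ℓ, B ^ (((q : ℝ) + 1) * β i) ≤
        (primesIn (B ^ (((q : ℝ) + 1) * β i))).card * Real.log (8 * B ^ (((q : ℝ) + 1) * β i)) := by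
      have : ∀ i, ∀ᶠ q : ℕ in atTop, B ^ (((q : ℝ) + 1) * β i) ≤
          (primesIn (B ^ (((q : ℝ) + 1) * β i))).card *
            Real.log (8 * B ^ (((q : ℝ) + 1) * β i)) := fun i =>
        ((tendsto_rpow_atTop_of_base_gt_one B hB).comp
          ((tendsto_atTop_add_const_right _ 1 tendsto_natCast_atTop_atTop).atTop_mul_const
            (hβ i))).eventually eventually_le_card_primesIn
      exact (finite_lt_nat ℓ).eventually_all.2 fun i _ => this i
    obtain ⟨N, hN⟩ := eventually_atTop.1 ((h1.and h2).and (eventually_ge_atTop (a + 2 * m)))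
    obtain ⟨n, hn, hnN⟩ := h𝒩.exists_gt N
    obtain ⟨⟨h3, h4⟩, h5⟩ := hN (n - 1) (by omega)
    exact ⟨n - 1, h5, by rwa [Nat.sub_add_cancel (by omega)], h4, h3⟩
  choose nxt hn1 hn2 hn3 hn4 using hnext
  let a : ℕ → ℕ := fun k => (fun x => nxt x + ℓ)^[k] 0
  refine le_dimH_of_windows (a := a) (φ := fun k => nxt (a k)) hB hs hs1 hf0 (fun i => (hβ i).le)
    hβ1 hsum hf hm hM hγ.le hγ1 hW hZ hγZ rfl (fun k => hn1 _)
    (fun k => Function.iterate_succ_apply' _ _ _) (fun k => hn2 _) (fun k => hn3 _) fun k => ?_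
  rw [Nat.sub_sub]
  exact hn4 _

lemma le_dimH_of_lt_partitionSum {ℓ m : ℕ} {B s f : ℝ} {𝒩 : Set ℕ} {β : ℕ → ℝ} (hB : 1 < B)
    (hs : 0 < s) (hs1 : s ≤ 1) (hf0 : 0 ≤ f) (h𝒩 : 𝒩.Infinite) (hβ : ∀ i, 0 < β i)
    (hsum : ∑ i ∈ Finset.range ℓ, β i = 1)
    (hf : ∀ i < ℓ, (2 * s - 1) * ∑ j ∈ Finset.range i, β j + s * β i ≤ f) (hm : 0 < m)
    (h : ENNReal.ofReal (16 * B ^ (m * f)) < partitionSum m s) :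
    ENNReal.ofReal s ≤ dimH (EprimeℓN ℓ B 𝒩) := by
  classical
  have hB0 : 0 < B := by linarith
  rw [partitionSum, ENNReal.tsum_eq_iSup_sum, lt_iSup_iff] at h
  obtain ⟨U, hU⟩ := h
  rw [← ENNReal.ofReal_sum_of_nonneg (fun u _ => by positivity)] at hU
  set Z := ∑ u ∈ U, (den (wd u) 0 ^ 2) ^ (-s) with hZ
  have hZU : 16 * B ^ (m * f) < Z := (ENNReal.ofReal_lt_ofReal_iff_of_nonneg (by positivity)).1 hU
  have hZ0 : 0 < Z := lt_trans (by positivity) hZU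
  have hinj : Function.Injective fun (u : Fin m → ℕ) i => u i + 1 := fun u v huv =>
    funext fun i => Nat.succ_injective (congrFun huv i)
  have hW : ∑ v ∈ U.image fun u i => u i + 1, (den (List.ofFn v) 0 ^ 2) ^ (-s) = Z :=
    Finset.sum_image fun u _ v _ huv => hinj huv
  have hγm : ((4 / Z) ^ (1 / m : ℝ)) ^ m = 4 / Z := by
    rw [one_div]
    exact Real.rpow_inv_natCast_pow (by positivity) hm.ne'
  have hγ : 0 < (4 / Z) ^ (1 / m : ℝ) := by positivity
  refine le_dimH_of_words (M := U.sup (fun u => Finset.univ.sup u) + 2) (γ := (4 / Z) ^ (1 / m : ℝ))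
    (W := U.image fun u i => u i + 1) hB hs hs1 hf0 h𝒩 hβ hsum hf hm (by omega) hγ ?_ ?_ ?_
  · refine lt_of_pow_lt_pow_left₀ m zero_le_one ?_
    rw [mul_pow, hγm, one_pow, div_mul_eq_mul_div, div_lt_one hZ0, ← Real.rpow_natCast,
      ← Real.rpow_mul hB0.le, mul_comm f]
    have : 0 < B ^ (m * f) := by positivity
    linarith
  · intro v hv t
    obtain ⟨u, hu, rfl⟩ := Finset.mem_image.1 hv
    have h1 : u t ≤ Finset.univ.sup u := Finset.le_sup (Finset.mem_univ t)
    have h2 : Finset.univ.sup u ≤ U.sup fun u => Finset.univ.sup u :=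
      Finset.le_sup (f := fun u : Fin m → ℕ => Finset.univ.sup u) hu
    simp only
    omega
  · rw [hW, hγm, div_mul_cancel₀ _ hZ0.ne']
    exact Real.rpow_le_self_of_one_le (by norm_num) hs1

lemma partitionSum_one_eq_top {s : ℝ} (hs : s ≤ 1 / 2) : partitionSum 1 s = ⊤ := by
  have h : partitionSum 1 s = ∑' n : ℕ, ENNReal.ofReal (((n + 1 : ℕ) : ℝ) ^ (-(2 * s))) := by
    rw [partitionSum, ← (Equiv.funUnique (Fin 1) ℕ).symm.tsum_eq]
    refine tsum_congr fun n => ?_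
    have e : den (wd ((Equiv.funUnique (Fin 1) ℕ).symm n)) 0 = ((n + 1 : ℕ) : ℝ) := by
      simp [wd, den, mob]
    rw [e, ← Real.rpow_natCast, ← Real.rpow_mul (Nat.cast_nonneg _)]
    congr 2
    push_cast
    ring
  rw [h]
  by_contra hne
  have h1 := ENNReal.summable_toReal hne
  have h2 : Summable fun n : ℕ => ((n + 1 : ℕ) : ℝ) ^ (-(2 * s)) :=
    h1.congr fun n => ENNReal.toReal_ofReal (by positivity)
  rw [summable_nat_add_iff (f := fun n : ℕ => (n : ℝ) ^ (-(2 * s))) 1, Real.summable_nat_rpow] at h2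
  linarith

lemma le_dimH_of_lt_half {ℓ : ℕ} {B s : ℝ} {𝒩 : Set ℕ} (hℓ : 1 ≤ ℓ) (hB : 1 < B) (h𝒩 : 𝒩.Infinite)
    (hs : 0 < s) (hs' : s ≤ 1 / 2) : ENNReal.ofReal s ≤ dimH (EprimeℓN ℓ B 𝒩) := by
  obtain ⟨β, f, hβ, hsum, hf0, hf⟩ := exists_exponents (s := 1 / 2) le_rfl (by norm_num) hℓ
  refine le_dimH_of_lt_partitionSum (m := 1) hB hs (by linarith) hf0.le h𝒩 hβ hsum (fun i _ => ?_)
    one_pos ?_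
  · have h1 : 0 ≤ ∑ j ∈ Finset.range i, β j := Finset.sum_nonneg fun j _ => (hβ j).le
    rw [← hf i]
    have := hβ i
    gcongr
  · rw [partitionSum_one_eq_top hs']
    exact ENNReal.ofReal_lt_top

lemma dimH_le_or_le_dimH {ℓ : ℕ} {B s s' : ℝ} {𝒩 : Set ℕ} (hℓ : 1 ≤ ℓ) (hB : 1 < B)
    (h𝒩 : 𝒩.Infinite) (hs' : 0 < s') (hss : s' < s) (hs : 1 / 2 ≤ s) (hs1 : s < 1) :
    dimH (EprimeℓN ℓ B univ) ≤ ENNReal.ofReal s ∨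
      ENNReal.ofReal s' ≤ dimH (EprimeℓN ℓ B 𝒩) := by
  obtain ⟨β, f, hβ, hsum, hf0, hf⟩ := exists_exponents hs hs1 hℓ
  by_cases hp : ∀ p : ℕ, partitionSum p s' ≤ ENNReal.ofReal (16 * B ^ (p * f))
  · exact Or.inl (dimH_le_of_partitionSum hℓ hB (by linarith) hss hs1.le (fun i => (hβ i).le) hsum
      (fun i _ => hf i) (by norm_num) hp)
  push Not at hp
  obtain ⟨m, hm⟩ := hp
  refine Or.inr (le_dimH_of_lt_partitionSum hB hs' (by linarith) hf0.le h𝒩 hβ hsum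
    (fun i _ => ?_) (Nat.pos_of_ne_zero ?_) hm)
  · have h1 : 0 ≤ ∑ j ∈ Finset.range i, β j := Finset.sum_nonneg fun j _ => (hβ j).le
    rw [← hf i]
    have := hβ i
    gcongr
  · rintro rfl
    refine hm.not_ge ?_
    have e : partitionSum 0 s' = 1 := by
      rw [partitionSum, tsum_fintype]
      simp [wd, den]
    rw [e, Nat.cast_zero, zero_mul, Real.rpow_zero, mul_one]
    norm_num

end CFrac

/-- **Lemma.** For `ℓ ≥ 1`, a real `1 < B < ∞` and an infinite set `𝒩 ⊆ ℕ`, the Hausdorff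
dimension of `E′_ℓ(φ_B; 𝒩)` equals that of `E′_ℓ(φ_B) = E′_ℓ(φ_B; ℕ)`, where `φ_B(n) = B^n`. -/
theorem dimH_EprimeℓN_eq (ℓ : ℕ) (hℓ : 1 ≤ ℓ) (B : ℝ) (hB : 1 < B)
    (𝒩 : Set ℕ) (h𝒩 : 𝒩.Infinite) :
    dimH (EprimeℓN ℓ B 𝒩) = dimH (EprimeℓN ℓ B Set.univ) := by
  refine le_antisymm (dimH_mono fun x hx => ⟨hx.1, hx.2.1, hx.2.2.mono fun n hn =>
    ⟨mem_univ n, hn.2⟩⟩) ?_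
  by_contra! hlt
  have htop : dimH (EprimeℓN ℓ B univ) ≤ 1 :=
    (dimH_mono (subset_univ _)).trans Real.dimH_univ.le
  obtain ⟨t, ht1, ht2⟩ := ENNReal.lt_iff_exists_nnreal_btwn.1 hlt
  obtain ⟨t', ht1', ht2'⟩ := ENNReal.lt_iff_exists_nnreal_btwn.1 ht1
  have ht'0 : (0 : ℝ) < t' := by
    exact_mod_cast zero_le.trans_lt ht1'
  have htt' : (t' : ℝ) < t := by exact_mod_cast ht2'
  have ht_lt : (t : ℝ) < 1 := by exact_mod_cast ht2.trans_le htop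
  rw [← ENNReal.ofReal_coe_nnreal] at ht1 ht2 ht1'
  rcases le_total (t : ℝ) (1 / 2) with h | h
  · exact ht1.not_ge (CFrac.le_dimH_of_lt_half hℓ hB h𝒩 (by linarith) h)
  · rcases CFrac.dimH_le_or_le_dimH hℓ hB h𝒩 ht'0 htt' h ht_lt with h | h
    · exact ht2.not_ge h
    · exact ht1'.not_ge h
end

section
/- Let n be a positive integer and 𝐚 = (a_1, …, a_n) ∈ ℕ^{n} a tuple of positive integers. For every k ∈ {1, …, n}, writing 𝐚̂ = (a_1, …, a_{k−1}, a_{k+1}, …, a_n) for the tuple with the k-th entry deleted, one has (a_k + 1)/2 ≤ q_n(𝐚)/q_{n−1}(𝐚̂) ≤ a_k + 1. -/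
/-- The continuant: `contK [a_1, ..., a_n]` is the denominator `q_n(a_1, ..., a_n)` of the
continued fraction `[a_1, ..., a_n]`; it satisfies `q_{-1} = 0`, `q_0 = 1` and
`q_m = a_m q_{m-1} + q_{m-2}`. -/
def contK : List ℕ → ℕ
  | [] => 1
  | [a] => a
  | a :: b :: l => a * contK (b :: l) + contK l

theorem contK_pos : ∀ l : List ℕ, (∀ x ∈ l, 0 < x) → 0 < contK l
  | [], _ => by simp [contK]
  | [a], h => by simpa [contK] using h
  | a :: b :: l, h => by
    rw [contK]
    exact Nat.add_pos_right _ (contK_pos l fun x hx => h x (by simp [hx]))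

theorem contK_le_contK_cons {a : ℕ} (ha : 0 < a) : ∀ l : List ℕ, contK l ≤ contK (a :: l)
  | [] => by simpa [contK] using Nat.succ_le_of_lt ha
  | b :: l => by
    rw [contK]
    nlinarith

/-- Inserting the entry `a` into a tuple of positive integers multiplies the continuant by a factor
between `(a + 1) / 2` and `a + 1`. -/
theorem contK_append_cons_bounds {a : ℕ} (ha : 0 < a) (s : List ℕ) (hs : ∀ x ∈ s, 0 < x) :
    ∀ p : List ℕ, (∀ x ∈ p, 0 < x) →
      (a + 1) * contK (p ++ s) ≤ 2 * contK (p ++ a :: s) ∧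
        contK (p ++ a :: s) ≤ (a + 1) * contK (p ++ s)
  | [], _ => by
    cases s with
    | nil => simp only [List.nil_append, contK]; omega
    | cons c m =>
      have h := contK_le_contK_cons (hs c (by simp)) m
      simp only [List.nil_append, contK]
      constructor <;> nlinarith
  | [b], hp => by
    have hb : 0 < b := hp b (by simp)
    cases s with
    | nil =>
      simp only [List.cons_append, List.nil_append, contK]
      constructor <;> nlinarith
    | cons c m =>
      have h := contK_le_contK_cons (hs c (by simp)) m
      simp only [List.cons_append, List.nil_append, contK]
      generalize contK (c :: m) = u at *
      generalize contK m = v at *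
      obtain ⟨a, rfl⟩ := Nat.exists_eq_add_of_lt ha
      obtain ⟨b, rfl⟩ := Nat.exists_eq_add_of_lt hb
      obtain ⟨d, rfl⟩ := Nat.exists_eq_add_of_le h
      constructor <;> ring_nf <;> nlinarith [Nat.zero_le (a * b * v), Nat.zero_le (a * b * d),
        Nat.zero_le (a * v), Nat.zero_le (a * d), Nat.zero_le (b * v), Nat.zero_le (b * d)]
  | x :: y :: p, hp => by
    have h₁ := contK_append_cons_bounds ha s hs (y :: p) fun z hz => hp z (by simp_all)
    have h₂ := contK_append_cons_bounds ha s hs p fun z hz => hp z (by simp_all)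
    simp only [List.cons_append, contK] at h₁ ⊢
    have l := Nat.mul_le_mul_left x h₁.1
    have u := Nat.mul_le_mul_left x h₁.2
    constructor <;> linarith [h₂.1, h₂.2]

/-- **Proposition.** For `n ≥ 1`, a tuple `𝐚 = (a_1, …, a_n)` of positive integers and
`k ∈ {1, …, n}`, writing `𝐚̂` for the tuple with the `k`-th entry deleted,
`(a_k + 1)/2 ≤ q_n(𝐚)/q_{n-1}(𝐚̂) ≤ a_k + 1`. -/
theorem continuant_delete_entry_est (n : ℕ) (hn : 1 ≤ n) (a : Fin n → ℕ)
    (ha : ∀ i, 0 < a i) (k : Fin n) :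
    ((a k : ℝ) + 1) / 2 ≤
        (contK (List.ofFn a) : ℝ) / (contK ((List.ofFn a).eraseIdx (k : ℕ)) : ℝ) ∧
      (contK (List.ofFn a) : ℝ) / (contK ((List.ofFn a).eraseIdx (k : ℕ)) : ℝ) ≤
        (a k : ℝ) + 1 := by
  have hk : (k : ℕ) < (List.ofFn a).length := by simp
  have hpos : ∀ x ∈ List.ofFn a, 0 < x := by simpa [List.mem_ofFn] using ha
  have hsplit : List.ofFn a =
      (List.ofFn a).take k ++ a k :: (List.ofFn a).drop (k + 1) := by
    conv_lhs => rw [← List.take_append_drop k (List.ofFn a), List.drop_eq_getElem_cons hk]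
    simp
  have herase := List.eraseIdx_eq_take_drop_succ (List.ofFn a) k
  have hbounds := contK_append_cons_bounds (ha k) ((List.ofFn a).drop (k + 1))
    (fun x hx => hpos x (List.mem_of_mem_drop hx)) ((List.ofFn a).take k)
    (fun x hx => hpos x (List.mem_of_mem_take hx))
  rw [← hsplit, ← herase] at hbounds
  have hq : (0 : ℝ) < contK ((List.ofFn a).eraseIdx k) := by
    exact_mod_cast contK_pos _ fun x hx => hpos x (List.mem_of_mem_eraseIdx hx)
  have hlower : ((a k : ℝ) + 1) * contK ((List.ofFn a).eraseIdx k) ≤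
      2 * contK (List.ofFn a) := by exact_mod_cast hbounds.1
  have hupper : (contK (List.ofFn a) : ℝ) ≤
      ((a k : ℝ) + 1) * contK ((List.ofFn a).eraseIdx k) := by exact_mod_cast hbounds.2
  rw [le_div_iff₀ hq, div_le_iff₀ hq]
  exact ⟨by linarith, hupper⟩
end

section
/- Let ℓ ≥ 2 be an integer, B > 1 a real number, and 1/2 < s < 1. Define α_j := B^{ s^{ℓ−1−j}(2s−1)(1−s)^{j} / (s^{ℓ} − (1−s)^{ℓ}) } for 0 ≤ j ≤ ℓ−2. Then: (i) for every j ∈ {0, 1, …, ℓ−3}, 1/(α_0 ⋯ α_j) = ( 1/(α_0 · (α_1 ⋯ α_j)^{2} · α_{j+1}) )^{s}; (ii) 1/(α_0 ⋯ α_{ℓ−2}) = ( 1/(B · α_1 ⋯ α_{ℓ−2}) )^{s}; and (iii) B · α_0^{s} ≥ B^{2s}. -/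
/-- The product `α_1 ⋯ α_j` telescopes to a single power of `B`. -/
theorem prod_Icc_rpow_eq (ℓ : ℕ) (B s D : ℝ) (hB : 0 < B) (α : ℕ → ℝ)
    (hα : ∀ j, j + 2 ≤ ℓ →
      α j = B ^ (s ^ (ℓ - 1 - j) * (2 * s - 1) * (1 - s) ^ j / D)) (j : ℕ) (hj : j + 2 ≤ ℓ) :
    ∏ i ∈ Finset.Icc 1 j, α i =
      B ^ ((s ^ (ℓ - 1) * (1 - s) - s ^ (ℓ - 1 - j) * (1 - s) ^ (j + 1)) / D) := by
  induction j with
  | zero => simp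
  | succ j ih =>
    rw [Finset.prod_Icc_succ_top (by omega), ih (by omega), hα _ hj, ← Real.rpow_add hB]
    congr 1
    obtain ⟨k, rfl⟩ := Nat.exists_eq_add_of_le hj
    have h1 : j + 1 + 2 + k - 1 - j = k + 2 := by omega
    have h2 : j + 1 + 2 + k - 1 - (j + 1) = k + 1 := by omega
    rw [h1, h2]
    ring

/-- **Lemma.** Let `ℓ ≥ 2`, `B > 1` and `1/2 < s < 1`, and set
`α_j = B^{s^{ℓ-1-j}(2s-1)(1-s)^j / (s^ℓ - (1-s)^ℓ)}` for `0 ≤ j ≤ ℓ-2`. Then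
(i) for `0 ≤ j ≤ ℓ-3`, `1/(α_0 ⋯ α_j) = (1/(α_0 (α_1 ⋯ α_j)^2 α_{j+1}))^s`;
(ii) `1/(α_0 ⋯ α_{ℓ-2}) = (1/(B α_1 ⋯ α_{ℓ-2}))^s`; and
(iii) `B α_0^s ≥ B^{2s}`. -/
theorem alpha_identities (ℓ : ℕ) (hℓ : 2 ≤ ℓ) (B s : ℝ) (hB : 1 < B)
    (hs1 : 1 / 2 < s) (hs2 : s < 1) (α : ℕ → ℝ)
    (hα : ∀ j, j ≤ ℓ - 2 →
      α j = B ^ (s ^ (ℓ - 1 - j) * (2 * s - 1) * (1 - s) ^ j / (s ^ ℓ - (1 - s) ^ ℓ))) :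
    (∀ j, j + 3 ≤ ℓ →
      1 / ∏ i ∈ Finset.range (j + 1), α i =
        (1 / (α 0 * (∏ i ∈ Finset.Icc 1 j, α i) ^ 2 * α (j + 1))) ^ s) ∧
    (1 / ∏ i ∈ Finset.range (ℓ - 1), α i =
        (1 / (B * ∏ i ∈ Finset.Icc 1 (ℓ - 2), α i)) ^ s) ∧
    B ^ (2 * s) ≤ B * α 0 ^ s := by
  have hB0 : 0 < B := by linarith
  have hα' : ∀ j, j + 2 ≤ ℓ →
      α j = B ^ (s ^ (ℓ - 1 - j) * (2 * s - 1) * (1 - s) ^ j / (s ^ ℓ - (1 - s) ^ ℓ)) :=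
    fun j hj => hα j (by omega)
  have hD : 0 < s ^ ℓ - (1 - s) ^ ℓ :=
    sub_pos.2 (pow_lt_pow_left₀ (by linarith) (by linarith) (by omega))
  have hr : 0 ≤ (1 - s) ^ ℓ := pow_nonneg (by linarith) _
  have hIcc := prod_Icc_rpow_eq ℓ B s _ hB0 α hα'
  have hrange : ∀ j, ∏ i ∈ Finset.range (j + 1), α i = α 0 * ∏ i ∈ Finset.Icc 1 j, α i := by
    intro j
    rw [Finset.range_eq_Ico, Finset.prod_eq_prod_Ico_succ_bot (by omega)]
    rfl
  have h0 := hα' 0 hℓ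
  refine ⟨fun j hj => ?_, ?_, ?_⟩
  · have hsq : ∀ x : ℝ, (B ^ x) ^ 2 = B ^ (x + x) := fun x => by
      rw [sq, Real.rpow_add hB0]
    rw [hrange, hIcc j (by omega), h0, hα' (j + 1) (by omega), hsq,
      ← Real.rpow_add hB0, ← Real.rpow_add hB0, ← Real.rpow_add hB0,
      one_div, one_div, ← Real.rpow_neg hB0.le, ← Real.rpow_neg hB0.le, ← Real.rpow_mul hB0.le]
    congr 1
    obtain ⟨k, rfl⟩ := Nat.exists_eq_add_of_le hj
    have h1 : j + 3 + k - 1 - j = k + 2 := by omega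
    have h2 : j + 3 + k - 1 - (j + 1) = k + 1 := by omega
    have h3 : j + 3 + k - 1 = j + k + 2 := by omega
    rw [h1, h2, Nat.sub_zero, h3]
    ring
  · obtain ⟨k, rfl⟩ := Nat.exists_eq_add_of_le' hℓ
    have h1 : k + 2 - 1 = k + 1 := by omega
    have h2 : k + 2 - 2 = k := by omega
    have h3 : k + 1 - k = 1 := by omega
    have hBm : ∀ x : ℝ, B * B ^ x = B ^ (1 + x) := fun x => by
      rw [Real.rpow_add hB0, Real.rpow_one]
    rw [h1, h2, hrange, hIcc k le_rfl, h0, hBm, ← Real.rpow_add hB0,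
      one_div, one_div, ← Real.rpow_neg hB0.le, ← Real.rpow_neg hB0.le, ← Real.rpow_mul hB0.le]
    congr 1
    rw [h1, Nat.sub_zero, h3]
    field_simp
    ring
  · rw [h0, ← Real.rpow_mul hB0.le]
    nth_rewrite 2 [← Real.rpow_one B]
    rw [← Real.rpow_add hB0]
    apply Real.rpow_le_rpow_of_exponent_le hB.le
    have hs : s ^ (ℓ - 1) * s = s ^ ℓ := by rw [← pow_succ, Nat.sub_add_cancel (by omega)]
    have key : 2 * s - 1 ≤ s ^ ℓ * (2 * s - 1) / (s ^ ℓ - (1 - s) ^ ℓ) := by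
      rw [le_div_iff₀ hD]
      nlinarith
    calc 2 * s ≤ 1 + s ^ ℓ * (2 * s - 1) / (s ^ ℓ - (1 - s) ^ ℓ) := by linarith
      _ = _ := by
        rw [← hs, Nat.sub_zero]
        ring
end

section
/- Let r be a positive integer and (B_n)_{n≥1} a sequence of subsets of [0,1), each of which is a countable union of fundamental intervals of level r. Let A := { x ∈ [0,1) : T^{n}(x) ∈ B_n for infinitely many n ∈ ℕ }, where T is the Gauss map. If Σ_{n≥1} leb(B_n) < ∞ then leb(A) = 0, and if Σ_{n≥1} leb(B_n) = ∞ then leb(A) = 1. -/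
open MeasureTheory Filter Set

/-- The fundamental interval `I_r(a) = {x ∈ [0,1) : a_1(x) = a 0, …, a_r(x) = a (r-1)}`. -/
noncomputable def fundInterval (r : ℕ) (a : Fin r → ℕ) : Set ℝ :=
  {x | x ∈ Set.Ico (0 : ℝ) 1 ∧ ∀ i : Fin r, cfA x ((i : ℕ) + 1) = a i}

/-- The measure `ν` has a density `f` on `(0,1)` such that `f` is antitone and
`x ↦ (1 + x)² f x` is monotone. This class is stable under countable sums and under pushing
forward along a single branch of the Gauss map, and such densities have bounded distortion. -/
structure HasRegularDensity (ν : Measure ℝ) (f : ℝ → ENNReal) : Prop where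
  measurable : Measurable f
  eq_withDensity : ν = (volume.restrict (Ioo (0 : ℝ) 1)).withDensity f
  anti : ∀ ⦃x y⦄, 0 < x → x ≤ y → y < 1 → f y ≤ f x
  mono : ∀ ⦃x y⦄, 0 < x → x ≤ y → y < 1 →
    f x * ENNReal.ofReal ((1 + x) ^ 2) ≤ f y * ENNReal.ofReal ((1 + y) ^ 2)

/-- The measure `ν` has some regular density on `(0,1)`, see `HasRegularDensity`. -/
def IsRegularMeasure (ν : Measure ℝ) : Prop := ∃ f, HasRegularDensity ν f

lemma measurable_gaussMap : Measurable gaussMap :=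
  Measurable.ite (measurableSet_singleton 0) measurable_const
    (measurable_fract.comp measurable_inv)

lemma gaussMap_mem_Ico (x : ℝ) : gaussMap x ∈ Ico (0 : ℝ) 1 := by
  unfold gaussMap
  split_ifs
  · simp
  · exact ⟨Int.fract_nonneg _, Int.fract_lt_one _⟩

lemma measurable_cfA (n : ℕ) : Measurable fun x => cfA x n :=
  Nat.measurable_floor.comp (measurable_gaussMap.iterate (n - 1)).inv

lemma measurableSet_fundInterval (r : ℕ) (a : Fin r → ℕ) :
    MeasurableSet (fundInterval r a) := by
  unfold fundInterval
  simp only [ofPred_and, ofPred_forall]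
  exact measurableSet_Ico.inter <| .iInter fun i => measurable_cfA _ (measurableSet_singleton (a i))

lemma mem_fundInterval_succ {r : ℕ} {a : Fin (r + 1) → ℕ} {x : ℝ} :
    x ∈ fundInterval (r + 1) a ↔
      (x ∈ Ico (0 : ℝ) 1 ∧ ⌊x⁻¹⌋₊ = a 0) ∧ gaussMap x ∈ fundInterval r (Fin.tail a) := by
  have h : ∀ i, cfA x (i + 1 + 1) = cfA (gaussMap x) (i + 1) := fun i => by
    simp [cfA]
  simp only [fundInterval, Set.mem_ofPred_eq, Fin.forall_fin_succ, gaussMap_mem_Ico, true_and,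
    Fin.val_succ, h, Fin.tail, and_assoc]
  simp [cfA]

lemma pairwise_disjoint_fundInterval (r : ℕ) :
    Pairwise (Function.onFun Disjoint (fundInterval r)) := by
  intro a b hab
  refine Set.disjoint_left.2 fun x hx hy => hab (funext fun i => ?_)
  rw [← hx.2 i, hy.2 i]

lemma Irrational.gaussMap {x : ℝ} (hx : Irrational x) : Irrational (gaussMap x) := by
  unfold _root_.gaussMap
  rw [if_neg hx.ne_zero, ← Int.self_sub_floor]
  exact hx.inv.sub_intCast _

lemma Irrational.cfA_pos {x : ℝ} (hx : Irrational x) (hx' : x ∈ Ico (0 : ℝ) 1) (n : ℕ) :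
    0 < cfA x n := by
  have h : ∀ n, Irrational (_root_.gaussMap^[n] x) ∧ _root_.gaussMap^[n] x ∈ Ico (0 : ℝ) 1 := by
    intro n
    induction n with
    | zero => exact ⟨hx, hx'⟩
    | succ n ih =>
      rw [Function.iterate_succ_apply']
      exact ⟨ih.1.gaussMap, gaussMap_mem_Ico _⟩
  obtain ⟨h1, h2⟩ := h (n - 1)
  refine Nat.floor_pos.2 ((one_le_inv₀ ?_).2 h2.2.le)
  exact lt_of_le_of_ne h2.1 h1.ne_zero.symm

lemma ae_irrational : ∀ᵐ x : ℝ, Irrational x :=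
  (Set.countable_range ((↑) : ℚ → ℝ)).ae_notMem _

namespace HasRegularDensity

variable {ν : Measure ℝ} {f : ℝ → ENNReal}

lemma le_four_mul (h : HasRegularDensity ν f) {x y : ℝ} (hx : x ∈ Ioo (0 : ℝ) 1)
    (hy : y ∈ Ioo (0 : ℝ) 1) : f x ≤ 4 * f y := by
  rcases le_total y x with hxy | hxy
  · refine (h.anti hy.1 hxy hx.2).trans ?_
    exact le_mul_of_one_le_left (zero_le) (by norm_num)
  · calc f x = f x * ENNReal.ofReal 1 := by simp
      _ ≤ f x * ENNReal.ofReal ((1 + x) ^ 2) := by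
        gcongr; nlinarith [hx.1]
      _ ≤ f y * ENNReal.ofReal ((1 + y) ^ 2) := h.mono hx.1 hxy hy.2
      _ ≤ f y * ENNReal.ofReal 4 := by
        gcongr; nlinarith [hy.1, hy.2]
      _ = 4 * f y := by rw [mul_comm]; norm_num

lemma apply (h : HasRegularDensity ν f) {E : Set ℝ} (hE : MeasurableSet E) :
    ν E = ∫⁻ x in E ∩ Ioo 0 1, f x := by
  rw [h.eq_withDensity, withDensity_apply _ hE, Measure.restrict_restrict hE]

lemma univ_mul_volume_le (h : HasRegularDensity ν f) {B : Set ℝ} (hB : MeasurableSet B)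
    (hB1 : B ⊆ Ico 0 1) : ν univ * volume B ≤ 4 * ν B := by
  have hvol : volume B = volume (B ∩ Ioo 0 1) := by
    rw [← measure_congr ((ae_eq_refl B).inter Ioo_ae_eq_Ico.symm), inter_eq_left.2 hB1]
  rw [h.apply hB, hvol, ← setLIntegral_const, ← lintegral_const_mul _ h.measurable]
  refine setLIntegral_mono' (hB.inter measurableSet_Ioo) fun y hy => ?_
  rw [h.apply MeasurableSet.univ, univ_inter]
  calc ∫⁻ x in Ioo (0 : ℝ) 1, f x ≤ ∫⁻ x in Ioo (0 : ℝ) 1, 4 * f y :=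
        setLIntegral_mono' measurableSet_Ioo fun x hx => h.le_four_mul hx hy.2
    _ = 4 * f y := by simp

lemma le_mul_volume (h : HasRegularDensity ν f) {B : Set ℝ} (hB : MeasurableSet B) :
    ν B ≤ 4 * ν univ * volume B := by
  calc ν B = ∫⁻ x in B ∩ Ioo 0 1, f x := h.apply hB
    _ ≤ ∫⁻ _ in B ∩ Ioo 0 1, 4 * ν univ := by
        refine setLIntegral_mono' (hB.inter measurableSet_Ioo) fun y hy => ?_
        rw [h.apply MeasurableSet.univ, univ_inter, ← lintegral_const_mul _ h.measurable]
        calc f y = ∫⁻ x in Ioo (0 : ℝ) 1, f y := by simp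
          _ ≤ _ := setLIntegral_mono' measurableSet_Ioo fun x hx => h.le_four_mul hy.2 hx
    _ = 4 * ν univ * volume (B ∩ Ioo 0 1) := setLIntegral_const _ _
    _ ≤ _ := by gcongr; exact inter_subset_left

lemma sum {ι : Type*} [Countable ι] {μ : ι → Measure ℝ} {g : ι → ℝ → ENNReal}
    (h : ∀ i, HasRegularDensity (μ i) (g i)) :
    HasRegularDensity (Measure.sum μ) (∑' i, g i) where
  measurable := by
    have : (∑' i, g i) = fun x => ∑' i, g i x := by
      ext x; exact tsum_apply (Pi.summable.2 fun _ => ENNReal.summable)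
    rw [this]
    exact Measurable.tsum fun i => (h i).measurable
  eq_withDensity := by
    rw [withDensity_tsum fun i => (h i).measurable]
    congr 1; ext1 i; exact (h i).eq_withDensity
  anti x y hx hxy hy := by
    rw [tsum_apply (Pi.summable.2 fun _ => ENNReal.summable),
      tsum_apply (Pi.summable.2 fun _ => ENNReal.summable)]
    exact ENNReal.tsum_le_tsum fun i => (h i).anti hx hxy hy
  mono x y hx hxy hy := by
    rw [tsum_apply (Pi.summable.2 fun _ => ENNReal.summable),
      tsum_apply (Pi.summable.2 fun _ => ENNReal.summable), ← ENNReal.tsum_mul_right,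
      ← ENNReal.tsum_mul_right]
    exact ENNReal.tsum_le_tsum fun i => (h i).mono hx hxy hy

end HasRegularDensity

lemma image_inv_add_inter_Ioo {k : ℕ} (hk : 0 < k) (E : Set ℝ) :
    (fun y : ℝ => ((k : ℝ) + y)⁻¹) '' (E ∩ Ioo 0 1) =
      ((gaussMap ⁻¹' E ∩ {x | x ∈ Ico (0 : ℝ) 1 ∧ ⌊x⁻¹⌋₊ = k}) ∩ Ioo 0 1) \ {(k : ℝ)⁻¹} := by
  have hk1 : (1 : ℝ) ≤ k := by exact_mod_cast hk
  ext x
  constructor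
  · rintro ⟨y, ⟨hyE, hy0, hy1⟩, rfl⟩
    have hpos : (0 : ℝ) < k + y := by linarith
    have hlt : ((k : ℝ) + y)⁻¹ < 1 := inv_lt_one_of_one_lt₀ (by linarith)
    have hg : gaussMap ((k : ℝ) + y)⁻¹ = y := by
      rw [gaussMap, if_neg (inv_pos.2 hpos).ne', inv_inv, Int.fract_natCast_add,
        Int.fract_eq_self.2 ⟨hy0.le, hy1⟩]
    refine ⟨⟨⟨?_, ⟨(inv_pos.2 hpos).le, hlt⟩, ?_⟩, inv_pos.2 hpos, hlt⟩, ?_⟩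
    · simpa [hg] using hyE
    · rw [inv_inv, Nat.floor_eq_iff hpos.le]
      constructor <;> linarith
    · simp [hy0.ne']
  · rintro ⟨⟨⟨hE, -, hf⟩, hx0, hx1⟩, hne⟩
    have hg : gaussMap x = x⁻¹ - k := by
      rw [gaussMap, if_neg hx0.ne', ← hf, ← Int.self_sub_floor,
        natCast_floor_eq_intCast_floor (inv_pos.2 hx0).le]
    rw [Nat.floor_eq_iff (inv_pos.2 hx0).le] at hf
    have hne' : x⁻¹ ≠ k := fun h => hne (by simp [← h])
    refine ⟨x⁻¹ - k, ⟨hg ▸ hE, ?_, by linarith⟩, by simp⟩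
    exact sub_pos.2 (lt_of_le_of_ne hf.1 hne'.symm)

lemma HasRegularDensity.map_gaussMap_restrict {ν : Measure ℝ} {f : ℝ → ENNReal}
    (h : HasRegularDensity ν f) {k : ℕ} (hk : 0 < k) :
    HasRegularDensity ((ν.restrict {x | x ∈ Ico (0 : ℝ) 1 ∧ ⌊x⁻¹⌋₊ = k}).map gaussMap)
      (fun y => ENNReal.ofReal (((k : ℝ) + y)⁻¹ ^ 2) * f ((k : ℝ) + y)⁻¹) where
  measurable := by
    have := h.measurable
    fun_prop
  eq_withDensity := by
    ext E hE
    have hD : MeasurableSet {x : ℝ | x ∈ Ico (0 : ℝ) 1 ∧ ⌊x⁻¹⌋₊ = k} :=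
      measurableSet_Ico.inter
        ((Nat.measurable_floor.comp measurable_inv) (measurableSet_singleton k))
    have hTE := measurable_gaussMap hE
    rw [Measure.map_apply measurable_gaussMap hE, Measure.restrict_apply hTE,
      h.apply (hTE.inter hD), withDensity_apply _ hE, Measure.restrict_restrict hE]
    rw [← setLIntegral_congr (sdiff_null_ae_eq_self (measure_singleton (k : ℝ)⁻¹)),
      ← image_inv_add_inter_Ioo hk,
      lintegral_image_eq_lintegral_abs_deriv_mul (hE.inter measurableSet_Ioo)
        (f' := fun y => -(((k : ℝ) + y)⁻¹ ^ 2))]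
    · simp
    · intro y hy
      have hpos : (0 : ℝ) < k + y := add_pos_of_nonneg_of_pos k.cast_nonneg hy.2.1
      have := ((hasDerivAt_id y).const_add (k : ℝ)).inv hpos.ne'
      refine (this.congr_deriv ?_).hasDerivWithinAt
      simp [neg_div]
    · intro y _ z _ hyz
      simpa using hyz
  anti y z hy hyz hz := by
    have hk1 : (1 : ℝ) ≤ k := by exact_mod_cast hk
    have hw0 : 0 < ((k : ℝ) + z)⁻¹ := inv_pos.2 (by linarith)
    have hwx : ((k : ℝ) + z)⁻¹ ≤ ((k : ℝ) + y)⁻¹ := inv_anti₀ (by linarith) (by linarith)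
    have hx1 : ((k : ℝ) + y)⁻¹ < 1 := inv_lt_one_of_one_lt₀ (by linarith)
    have key := h.mono hw0 hwx hx1
    set w := ((k : ℝ) + z)⁻¹
    set x := ((k : ℝ) + y)⁻¹
    calc ENNReal.ofReal (w ^ 2) * f w
        = ENNReal.ofReal ((w / (1 + w)) ^ 2) * (f w * ENNReal.ofReal ((1 + w) ^ 2)) := by
          rw [mul_left_comm, ← ENNReal.ofReal_mul (by positivity), mul_comm]
          congr 2
          field_simp
      _ ≤ ENNReal.ofReal ((w / (1 + w)) ^ 2) * (f x * ENNReal.ofReal ((1 + x) ^ 2)) := by gcongr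
      _ = ENNReal.ofReal ((w / (1 + w)) ^ 2 * (1 + x) ^ 2) * f x := by
          rw [mul_left_comm, ← ENNReal.ofReal_mul (by positivity), mul_comm]
      _ ≤ _ := by
          gcongr
          rw [← mul_pow]
          have : 0 < x := hw0.trans_le hwx
          gcongr
          rw [div_mul_eq_mul_div, div_le_iff₀ (by positivity)]
          nlinarith
  mono y z hy hyz hz := by
    have hk1 : (1 : ℝ) ≤ k := by exact_mod_cast hk
    have hw0 : 0 < ((k : ℝ) + z)⁻¹ := inv_pos.2 (by linarith)
    have hwx : ((k : ℝ) + z)⁻¹ ≤ ((k : ℝ) + y)⁻¹ := inv_anti₀ (by linarith) (by linarith)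
    have hx1 : ((k : ℝ) + y)⁻¹ < 1 := inv_lt_one_of_one_lt₀ (by linarith)
    have key := h.anti hw0 hwx hx1
    rw [mul_right_comm, mul_right_comm _ (f ((k : ℝ) + z)⁻¹),
      ← ENNReal.ofReal_mul (by positivity), ← ENNReal.ofReal_mul (by positivity),
      ← mul_pow, ← mul_pow]
    have h1 : 0 < (k : ℝ) + y := by linarith
    have h2 : 0 < (k : ℝ) + z := by linarith
    gcongr ENNReal.ofReal (?_ ^ 2) * ?_
    rw [inv_mul_eq_div, inv_mul_eq_div, div_le_div_iff₀ h1 h2]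
    nlinarith

namespace IsRegularMeasure

variable {ν : Measure ℝ}

lemma ae_mem_Ico_and_cfA_pos (h : IsRegularMeasure ν) :
    ∀ᵐ x ∂ν, x ∈ Ico (0 : ℝ) 1 ∧ ∀ n, 0 < cfA x n := by
  obtain ⟨f, hf⟩ := h
  rw [hf.eq_withDensity]
  refine (withDensity_absolutelyContinuous _ _).ae_le ?_
  filter_upwards [ae_restrict_mem measurableSet_Ioo, ae_restrict_of_ae ae_irrational] with x hx hi
  exact ⟨Ioo_subset_Ico_self hx, hi.cfA_pos (Ioo_subset_Ico_self hx)⟩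

lemma sum {ι : Type*} [Countable ι] {μ : ι → Measure ℝ} (h : ∀ i, IsRegularMeasure (μ i)) :
    IsRegularMeasure (Measure.sum μ) := by
  choose g hg using h
  exact ⟨_, HasRegularDensity.sum hg⟩

lemma map_iterate_restrict_fundInterval {r : ℕ} : ∀ {ν : Measure ℝ} (_ : IsRegularMeasure ν)
    {a : Fin r → ℕ} (_ : ∀ i, 0 < a i),
    IsRegularMeasure ((ν.restrict (fundInterval r a)).map gaussMap^[r]) := by
  induction r with
  | zero =>
    intro ν h a _
    have : ν.restrict (fundInterval 0 a) = ν := by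
      refine Measure.restrict_eq_self_of_ae_mem ?_
      filter_upwards [h.ae_mem_Ico_and_cfA_pos] with x hx
      exact ⟨hx.1, fun i => i.elim0⟩
    simpa [this] using h
  | succ r ih =>
    intro ν h a ha
    obtain ⟨f, hf⟩ := h
    have key := ih ⟨_, hf.map_gaussMap_restrict (ha 0)⟩ (a := Fin.tail a) fun i => ha i.succ
    rw [Measure.restrict_map measurable_gaussMap (measurableSet_fundInterval _ _),
      Measure.restrict_restrict (measurable_gaussMap (measurableSet_fundInterval _ _)),
      Measure.map_map (measurable_gaussMap.iterate r) measurable_gaussMap,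
      ← Function.iterate_succ] at key
    convert key using 3
    ext x
    rw [mem_fundInterval_succ, and_comm]
    rfl

lemma map_iterate_restrict (h : IsRegularMeasure ν) {r : ℕ} {M : Set ℝ} {S : Set (Fin r → ℕ)}
    (hS : ∀ a ∈ S, ∀ i, 0 < a i) (hM : M =ᵐ[ν] ⋃ a ∈ S, fundInterval r a) :
    IsRegularMeasure ((ν.restrict M).map gaussMap^[r]) := by
  rw [Measure.restrict_congr_set hM, biUnion_eq_iUnion, Measure.restrict_iUnion
    ((pairwise_disjoint_fundInterval r).comp_of_injective Subtype.val_injective)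
    fun a => measurableSet_fundInterval r a,
    Measure.map_sum (measurable_gaussMap.iterate r).aemeasurable]
  exact sum fun a => h.map_iterate_restrict_fundInterval (hS a a.2)

lemma map_iterate (h : IsRegularMeasure ν) (n : ℕ) : IsRegularMeasure (ν.map gaussMap^[n]) := by
  have := h.map_iterate_restrict (r := n) (M := univ) (S := {a | ∀ i, 0 < a i}) (fun a ha => ha) ?_
  · rwa [Measure.restrict_univ] at this
  · refine (eventuallyEq_univ.2 ?_).symm
    filter_upwards [h.ae_mem_Ico_and_cfA_pos] with x hx
    exact mem_biUnion (x := fun i : Fin n => cfA x (i + 1)) (fun i => hx.2 _) ⟨hx.1, fun _ => rfl⟩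

lemma map_iterate_restrict_compl (h : IsRegularMeasure ν) {r : ℕ} (S : Set (Fin r → ℕ)) :
    IsRegularMeasure ((ν.restrict (⋃ a ∈ S, fundInterval r a)ᶜ).map gaussMap^[r]) := by
  refine h.map_iterate_restrict (S := {a | a ∉ S ∧ ∀ i, 0 < a i}) (fun a ha => ha.2) ?_
  filter_upwards [h.ae_mem_Ico_and_cfA_pos] with x hx
  have hmem : ∀ a, x ∈ fundInterval r a ↔ a = fun i : Fin r => cfA x (i + 1) := fun a =>
    ⟨fun h => funext fun i => (h.2 i).symm, by rintro rfl; exact ⟨hx.1, fun _ => rfl⟩⟩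
  refine propext ?_
  change x ∈ (⋃ a ∈ S, fundInterval r a)ᶜ ↔ x ∈ ⋃ a ∈ {a | a ∉ S ∧ ∀ i, 0 < a i}, fundInterval r a
  simp only [mem_compl_iff, mem_iUnion, hmem, exists_prop, exists_eq_right, Set.mem_ofPred_eq, hx.2,
    implies_true, and_true]

end IsRegularMeasure

lemma measurableSet_biUnion_fundInterval {r : ℕ} (S : Set (Fin r → ℕ)) :
    MeasurableSet (⋃ a ∈ S, fundInterval r a) :=
  .biUnion S.to_countable fun a _ => measurableSet_fundInterval r a

lemma biUnion_fundInterval_subset_Ico {r : ℕ} (S : Set (Fin r → ℕ)) :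
    ⋃ a ∈ S, fundInterval r a ⊆ Ico 0 1 :=
  iUnion₂_subset fun _ _ _ hx => hx.1

lemma isRegularMeasure_volume_restrict_Ico :
    IsRegularMeasure (volume.restrict (Ico (0 : ℝ) 1)) := by
  refine ⟨1, measurable_one, ?_, fun x y _ _ _ => le_rfl, fun x y hx hxy _ => ?_⟩
  · rw [withDensity_one, Measure.restrict_congr_set Ioo_ae_eq_Ico]
  · simp only [Pi.one_apply, one_mul]
    gcongr

namespace IsRegularMeasure

/-- Bounded distortion gives a lower bound on the mass of `B`, hence an upper bound on that of
`Bᶜ`. -/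
lemma measure_compl_le {ν : Measure ℝ} [IsFiniteMeasure ν] (h : IsRegularMeasure ν) {B : Set ℝ}
    (hB : MeasurableSet B) (hB1 : B ⊆ Ico 0 1) :
    ν Bᶜ ≤ ENNReal.ofReal (Real.exp (-(volume.real B / 4))) * ν univ := by
  obtain ⟨f, hf⟩ := h
  have key := hf.univ_mul_volume_le hB hB1
  have hfin : volume B ≠ ⊤ := ((measure_mono hB1).trans_lt (by simp)).ne
  have key' : ν.real univ * volume.real B ≤ 4 * ν.real B := by
    have := ENNReal.toReal_mono (by finiteness) key
    simpa [Measure.real] using this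
  rw [← ofReal_measureReal (μ := ν) (s := Bᶜ), ← ofReal_measureReal (μ := ν) (s := univ),
    ← ENNReal.ofReal_mul (by positivity), measureReal_compl hB]
  gcongr
  have := Real.add_one_le_exp (-(volume.real B / 4))
  nlinarith [measureReal_nonneg (μ := ν) (s := univ)]

lemma measure_forall_lt_notMem_le {r : ℕ} (m : ℕ) : ∀ {ν : Measure ℝ} [IsFiniteMeasure ν]
    (_ : IsRegularMeasure ν) (S : ℕ → Set (Fin r → ℕ)),
    ν {x | ∀ k < m, gaussMap^[r * k] x ∉ ⋃ a ∈ S k, fundInterval r a} ≤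
      ENNReal.ofReal (Real.exp (-((∑ k ∈ Finset.range m,
        volume.real (⋃ a ∈ S k, fundInterval r a)) / 4))) * ν univ := by
  induction m with
  | zero => intro ν _ h S; simp
  | succ m ih =>
    intro ν _ h S
    set U := fun k => ⋃ a ∈ S k, fundInterval r a with hU
    have hUm : ∀ k, MeasurableSet (U k) := fun k => measurableSet_biUnion_fundInterval _
    have hTm := measurable_gaussMap.iterate r
    have key := ih (h.map_iterate_restrict_compl (S 0)) fun k => S (k + 1)
    have hset : MeasurableSet {x | ∀ k < m, gaussMap^[r * k] x ∉ U (k + 1)} := by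
      simp only [ofPred_forall]
      exact .iInter fun k => .iInter fun _ => (measurable_gaussMap.iterate _ (hUm _)).compl
    rw [Measure.map_apply hTm hset, Measure.restrict_apply (hTm hset),
      Measure.map_apply hTm .univ, preimage_univ, Measure.restrict_apply_univ] at key
    calc _ ≤ _ := measure_mono ?_
      _ ≤ _ := key
      _ ≤ _ := mul_le_mul_right (h.measure_compl_le (hUm 0)
        (biUnion_fundInterval_subset_Ico _)) _
      _ = _ := ?_
    · intro x hx
      refine ⟨fun k hk => ?_, by simpa using hx 0 m.succ_pos⟩
      rw [← Function.iterate_add_apply, ← Nat.mul_succ]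
      exact hx (k + 1) (by omega)
    · rw [← mul_assoc, ← ENNReal.ofReal_mul (Real.exp_nonneg _), ← Real.exp_add,
        Finset.sum_range_succ']
      congr 3
      ring

lemma measure_forall_notMem_eq_zero {ν : Measure ℝ} [IsFiniteMeasure ν] (h : IsRegularMeasure ν)
    {r : ℕ} (S : ℕ → Set (Fin r → ℕ)) (hS : ∑' k, volume (⋃ a ∈ S k, fundInterval r a) = ⊤) :
    ν {x | ∀ k, gaussMap^[r * k] x ∉ ⋃ a ∈ S k, fundInterval r a} = 0 := by
  have hfin : ∀ k, volume (⋃ a ∈ S k, fundInterval r a) ≠ ⊤ := fun k =>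
    ((measure_mono (biUnion_fundInterval_subset_Ico _)).trans_lt (by simp)).ne
  have hns : ¬ Summable fun k => volume.real (⋃ a ∈ S k, fundInterval r a) := fun hs => by
    refine hs.tsum_ofReal_ne_top ?_
    simpa [ofReal_measureReal, hfin] using hS
  rw [not_summable_iff_tendsto_nat_atTop_of_nonneg fun _ => measureReal_nonneg] at hns
  have hlim := (ENNReal.tendsto_ofReal (Real.tendsto_exp_neg_atTop_nhds_zero.comp
    (hns.atTop_div_const (by norm_num : (0 : ℝ) < 4))))
  have hlim' := ENNReal.Tendsto.mul_const (b := ν univ) hlim (Or.inr (measure_ne_top _ _))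
  rw [ENNReal.ofReal_zero, zero_mul] at hlim'
  refine le_antisymm (ge_of_tendsto' hlim' fun m => ?_) zero_le
  exact (measure_mono (ofPred_subset_ofPred.2 fun x hx k _ => hx k)).trans
    (h.measure_forall_lt_notMem_le m S)

end IsRegularMeasure

lemma exists_residue_tsum_eq_top {u : ℕ → ENNReal} (hu : ∑' n, u n = ⊤) {r : ℕ} (hr : 1 ≤ r) :
    ∃ j, ∑' k, u (r * k + j) = ⊤ := by
  have : NeZero r := ⟨by omega⟩
  rw [← (Nat.divModEquiv r).symm.tsum_eq, ENNReal.tsum_prod', ENNReal.tsum_comm,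
    tsum_fintype, ENNReal.sum_eq_top] at hu
  obtain ⟨j, -, hj⟩ := hu
  refine ⟨j, ?_⟩
  simpa [Nat.divModEquiv, mul_comm] using hj

lemma tsum_add_eq_top {u : ℕ → ENNReal} (hu : ∑' n, u n = ⊤) (hfin : ∀ n, u n ≠ ⊤) (N : ℕ) :
    ∑' n, u (n + N) = ⊤ := by
  rw [← ENNReal.summable.sum_add_tsum_nat_add' (k := N), ENNReal.add_eq_top] at hu
  exact hu.resolve_left (ENNReal.sum_ne_top.2 fun n _ => hfin n)

/-- **Lemma (Kleinbock–Wadleigh).** Let `r ≥ 1` and let each `B_n ⊆ [0,1)` be a countable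
union of fundamental intervals of level `r`. Set
`A = {x ∈ [0,1) : T^n(x) ∈ B_n for infinitely many n}`. If `∑_n leb(B_n) < ∞` then
`leb(A) = 0`, and if `∑_n leb(B_n) = ∞` then `leb(A) = 1`. -/
theorem gauss_dynamical_borel_cantelli (r : ℕ) (hr : 1 ≤ r) (B : ℕ → Set ℝ)
    (hB : ∀ n, ∃ S : Set (Fin r → ℕ), (∀ a ∈ S, ∀ i, 0 < a i) ∧
      B n = ⋃ a ∈ S, fundInterval r a) :
    ((∑' n : ℕ, volume (B n)) ≠ ⊤ →
      volume {x | x ∈ Set.Ico (0 : ℝ) 1 ∧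
        {n : ℕ | gaussMap^[n] x ∈ B n}.Infinite} = 0) ∧
    ((∑' n : ℕ, volume (B n)) = ⊤ →
      volume {x | x ∈ Set.Ico (0 : ℝ) 1 ∧
        {n : ℕ | gaussMap^[n] x ∈ B n}.Infinite} = 1) := by
  choose S hS hBS using hB
  obtain rfl : B = fun n => ⋃ a ∈ S n, fundInterval r a := funext hBS
  set U := fun n => ⋃ a ∈ S n, fundInterval r a with hU
  have hUm : ∀ n, MeasurableSet (U n) := fun n => measurableSet_biUnion_fundInterval _
  have hfin : ∀ n, volume (U n) ≠ ⊤ := fun n =>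
    ((measure_mono (biUnion_fundInterval_subset_Ico _)).trans_lt (by simp)).ne
  set μ : Measure ℝ := volume.restrict (Ico (0 : ℝ) 1) with hμ
  have hreg : IsRegularMeasure μ := isRegularMeasure_volume_restrict_Ico
  have hmap : ∀ n {s : Set ℝ}, MeasurableSet s → μ.map gaussMap^[n] s = μ (gaussMap^[n] ⁻¹' s) :=
    fun n s hs => Measure.map_apply (measurable_gaussMap.iterate n) hs
  have hset : volume {x | x ∈ Ico (0 : ℝ) 1 ∧ {n : ℕ | gaussMap^[n] x ∈ U n}.Infinite} =
      μ {x | ∃ᶠ n in atTop, gaussMap^[n] x ∈ U n} := by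
    rw [hμ, Measure.restrict_apply' measurableSet_Ico]
    congr 1
    ext x
    simp [Nat.frequently_atTop_iff_infinite, and_comm]
  rw [hset]
  constructor
  · intro hsum
    refine measure_setOfPred_frequently_eq_zero (ne_top_of_le_ne_top
      (b := ∑' n, 4 * volume (U n)) ?_ (ENNReal.tsum_le_tsum fun n => ?_))
    · rw [ENNReal.tsum_mul_left]
      exact ENNReal.mul_ne_top (by simp) hsum
    · obtain ⟨f, hf⟩ := hreg.map_iterate n
      have := hf.le_mul_volume (hUm n)
      rw [hmap n (hUm n), hmap n .univ] at this
      change μ (gaussMap^[n] ⁻¹' U n) ≤ _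
      simpa [hμ] using this
  · intro hsum
    obtain ⟨j, hj⟩ := exists_residue_tsum_eq_top hsum hr
    have hnull : ∀ N, ∀ᵐ x ∂μ, ∃ k, gaussMap^[r * (k + N) + j] x ∈ U (r * (k + N) + j) := by
      intro N
      have h0 := (hreg.map_iterate (r * N + j)).measure_forall_notMem_eq_zero
        (fun k => S (r * (k + N) + j)) (tsum_add_eq_top hj (fun _ => hfin _) N)
      have h1 := ae_of_ae_map (measurable_gaussMap.iterate _).aemeasurable
        (measure_eq_zero_iff_ae_notMem.1 h0)
      filter_upwards [h1] with x hx
      simp only [not_forall, not_not] at hx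
      obtain ⟨k, hk⟩ := hx
      refine ⟨k, ?_⟩
      rwa [← Function.iterate_add_apply, ← add_assoc, ← mul_add] at hk
    have hall : ∀ᵐ x ∂μ, ∃ᶠ n in atTop, gaussMap^[n] x ∈ U n := by
      filter_upwards [ae_all_iff.2 hnull] with x hx
      refine frequently_atTop.2 fun N => ?_
      obtain ⟨k, hk⟩ := hx N
      exact ⟨_, by nlinarith, hk⟩
    rw [measure_congr (eventuallyEq_univ.2 hall)]
    simp [hμ]
end

section
/- Let φ : ℕ → [1, ∞) be any function. If the series Σ_{n≥1} 1/φ(n) converges, then the Lebesgue measure of E_1(φ) is 0; if this series diverges, then the Lebesgue measure of E_1(φ) is 1. -/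
open MeasureTheory Filter Set

/-- `E₁ φ` is the set of irrational `x ∈ [0,1)` such that `a_n(x) ≥ φ(n)` for infinitely
many `n ∈ ℕ`. -/
noncomputable def E₁ (φ : ℕ → ℝ) : Set ℝ :=
  {x | x ∈ Set.Ico (0 : ℝ) 1 ∧ Irrational x ∧
    {n : ℕ | 1 ≤ n ∧ φ n ≤ (cfA x n : ℝ)}.Infinite}

/-- The irrational numbers of the open unit interval. -/
def unitIrrationals : Set ℝ := {x | x ∈ Ioo (0 : ℝ) 1 ∧ Irrational x}

/-- The inverse branch of the Gauss map with first partial quotient `j + 1`. -/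
noncomputable def gaussBranch (j : ℕ) (y : ℝ) : ℝ := 1 / (j + 1 + y)

/-- The Möbius density `(1 + s) / (1 + s x)²`; for `s ≥ 0` it is a probability density on the
unit interval. -/
noncomputable def mobiusDensity (s x : ℝ) : ℝ := (1 + s) / (1 + s * x) ^ 2

/-- The mass which the density `mobiusDensity s` gives to the points with first partial
quotient `j + 1`. -/
noncomputable def branchWeight (s : ℝ) (j : ℕ) : ℝ := (1 + s) / ((j + 1 + s) * (j + 2 + s))

/-- The mass of `A` with respect to `mobiusDensity s` on the irrationals of the unit interval. -/
noncomputable def mobiusMass (s : ℝ) (A : Set ℝ) : ENNReal :=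
  ∫⁻ x in unitIrrationals, ENNReal.ofReal (mobiusDensity s x) * A.indicator 1 x

lemma measurableSet_irrational : MeasurableSet {x : ℝ | Irrational x} :=
  (countable_range ((↑) : ℚ → ℝ)).measurableSet.compl

lemma measurableSet_unitIrrationals : MeasurableSet unitIrrationals :=
  measurableSet_Ioo.inter measurableSet_irrational

lemma volume_unitIrrationals : volume unitIrrationals = 1 := by
  have h : volume (Ioo (0 : ℝ) 1 \ range ((↑) : ℚ → ℝ)) = volume (Ioo (0 : ℝ) 1) :=
    measure_sdiff_null ((countable_range _).measure_zero _)
  have h' : unitIrrationals = Ioo (0 : ℝ) 1 \ range ((↑) : ℚ → ℝ) := rfl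
  rw [h', h]
  simp

lemma gaussMap_of_ne_zero {x : ℝ} (hx : x ≠ 0) : gaussMap x = Int.fract x⁻¹ := if_neg hx

lemma measurableSet_le_cfA (b : ℝ) (n : ℕ) : MeasurableSet {x | b ≤ cfA x n} :=
  measurableSet_le measurable_const (measurable_from_nat.comp (measurable_cfA n))

lemma cfA_iterate (x : ℝ) (N n : ℕ) : cfA (gaussMap^[N] x) (n + 1) = cfA x (n + N + 1) := by
  simp [cfA, Function.iterate_add_apply]

lemma gaussMap_gaussBranch (j : ℕ) {y : ℝ} (hy : y ∈ unitIrrationals) :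
    gaussMap (gaussBranch j y) = y := by
  obtain ⟨⟨h0, h1⟩, -⟩ := hy
  have hpos : (0 : ℝ) < j + 1 + y := by positivity
  have hne : gaussBranch j y ≠ 0 := by unfold gaussBranch; positivity
  rw [gaussMap_of_ne_zero hne, gaussBranch, one_div, inv_inv, Int.fract_eq_iff]
  exact ⟨h0.le, h1, j + 1, by push_cast; ring⟩

lemma cfA_gaussBranch_one (j : ℕ) {y : ℝ} (hy : y ∈ unitIrrationals) :
    cfA (gaussBranch j y) 1 = j + 1 := by
  obtain ⟨⟨h0, h1⟩, -⟩ := hy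
  simp only [cfA, Nat.sub_self, Function.iterate_zero, id, gaussBranch, one_div, inv_inv]
  rw [Nat.floor_eq_iff (by positivity)]
  push_cast
  constructor <;> linarith

lemma gaussBranch_mem (j : ℕ) {y : ℝ} (hy : y ∈ unitIrrationals) :
    gaussBranch j y ∈ unitIrrationals := by
  obtain ⟨⟨h0, h1⟩, hirr⟩ := hy
  have hpos : (0 : ℝ) < j + 1 + y := by positivity
  refine ⟨⟨by unfold gaussBranch; positivity, ?_⟩, ?_⟩
  · rw [gaussBranch, div_lt_one hpos]
    have : (0 : ℝ) ≤ j := by positivity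
    linarith
  · rw [gaussBranch, one_div, irrational_inv_iff]
    have := hirr.natCast_add (j + 1)
    push_cast at this
    exact this

lemma iUnion_image_gaussBranch : ⋃ j, gaussBranch j '' unitIrrationals = unitIrrationals := by
  refine subset_antisymm (iUnion_subset fun j => ?_) fun x hx => ?_
  · rintro _ ⟨y, hy, rfl⟩
    exact gaussBranch_mem j hy
  · obtain ⟨⟨h0, h1⟩, hirr⟩ := hx
    have hinv : 1 < x⁻¹ := (one_lt_inv₀ h0).2 h1
    have hfl : 1 ≤ ⌊x⁻¹⌋₊ := Nat.one_le_floor_iff _ |>.2 hinv.le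
    obtain ⟨j, hj⟩ := Nat.exists_eq_add_of_le' hfl
    have hirr' : Irrational (x⁻¹ - (⌊x⁻¹⌋₊ : ℕ)) := (irrational_inv_iff.2 hirr).sub_natCast _
    refine mem_iUnion.2 ⟨j, x⁻¹ - (⌊x⁻¹⌋₊ : ℕ), ⟨⟨?_, ?_⟩, hirr'⟩, ?_⟩
    · have := Nat.floor_le (inv_nonneg.2 h0.le)
      exact lt_of_le_of_ne (by linarith) hirr'.ne_zero.symm
    · have := Nat.lt_floor_add_one x⁻¹
      linarith
    · rw [gaussBranch, hj]
      push_cast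
      rw [add_sub_cancel, one_div, inv_inv]

lemma injOn_gaussBranch (j : ℕ) : InjOn (gaussBranch j) unitIrrationals := fun x hx y hy h => by
  rw [← gaussMap_gaussBranch j hx, h, gaussMap_gaussBranch j hy]

lemma hasDerivAt_gaussBranch (j : ℕ) {y : ℝ} (hy : 0 < y) :
    HasDerivAt (gaussBranch j) (-1 / (j + 1 + y) ^ 2) y := by
  have hpos : (j + 1 + y : ℝ) ≠ 0 := by positivity
  have h := ((hasDerivAt_id y).const_add (j + 1 : ℝ)).inv hpos
  refine h.congr_of_eventuallyEq (.of_forall fun z => ?_)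
  simp [gaussBranch]

lemma measurableSet_image_gaussBranch (j : ℕ) :
    MeasurableSet (gaussBranch j '' unitIrrationals) :=
  measurableSet_unitIrrationals.image_of_continuousOn_injOn
    (fun _ hy => (hasDerivAt_gaussBranch j hy.1.1).continuousAt.continuousWithinAt)
    (injOn_gaussBranch j)

lemma pairwise_disjoint_image_gaussBranch :
    Pairwise (Function.onFun Disjoint fun j => gaussBranch j '' unitIrrationals) := by
  intro i j hij
  refine disjoint_left.2 ?_
  rintro _ ⟨y, hy, rfl⟩ ⟨z, hz, h⟩
  have := congrArg (fun x => cfA x 1) h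
  simp only [cfA_gaussBranch_one _ hy, cfA_gaussBranch_one _ hz] at this
  omega

lemma deriv_mul_mobiusDensity_gaussBranch {s : ℝ} (hs : 0 ≤ s) (j : ℕ) {y : ℝ} (hy : 0 < y) :
    |-1 / (j + 1 + y) ^ 2| * mobiusDensity s (gaussBranch j y) =
      branchWeight s j * mobiusDensity (1 / (j + 1 + s)) y := by
  have h1 : (0 : ℝ) < j + 1 + y := by positivity
  have h2 : (0 : ℝ) < j + 1 + s := by positivity
  have h3 : (0 : ℝ) < j + 2 + s := by positivity
  have h4 : (0 : ℝ) < j + 1 + y + s := by positivity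
  have e1 : 1 + s * (1 / (j + 1 + y)) = (j + 1 + y + s) / (j + 1 + y) := by field_simp
  have e2 : 1 + 1 / (j + 1 + s) * y = (j + 1 + y + s) / (j + 1 + s) := by field_simp; ring
  have e3 : 1 + 1 / (j + 1 + s) = (j + 2 + s) / (j + 1 + s) := by field_simp; ring
  rw [neg_div, abs_neg, abs_of_pos (by positivity)]
  simp only [mobiusDensity, gaussBranch, branchWeight, e1, e2, e3]
  field_simp

/-- The transfer operator of the Gauss map permutes the Möbius densities up to weights. -/
lemma mobiusMass_eq_tsum {s : ℝ} (hs : 0 ≤ s) (A : Set ℝ) :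
    mobiusMass s A = ∑' j : ℕ, ENNReal.ofReal (branchWeight s j) *
      mobiusMass (1 / (j + 1 + s)) (gaussBranch j ⁻¹' A) := by
  have hw (j : ℕ) : 0 ≤ branchWeight s j := by unfold branchWeight; positivity
  rw [mobiusMass]
  conv_lhs => rw [← iUnion_image_gaussBranch]
  rw [lintegral_iUnion measurableSet_image_gaussBranch pairwise_disjoint_image_gaussBranch]
  refine tsum_congr fun j => ?_
  rw [lintegral_image_eq_lintegral_abs_deriv_mul measurableSet_unitIrrationals
    (fun y hy => (hasDerivAt_gaussBranch j hy.1.1).hasDerivWithinAt) (injOn_gaussBranch j),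
    mobiusMass, ← lintegral_const_mul' _ _ ENNReal.ofReal_ne_top]
  refine setLIntegral_congr_fun measurableSet_unitIrrationals fun y hy => ?_
  rw [← mul_assoc, ← mul_assoc, ← ENNReal.ofReal_mul (abs_nonneg _), ← ENNReal.ofReal_mul (hw j),
    deriv_mul_mobiusDensity_gaussBranch hs j hy.1.1]
  rfl

lemma one_div_add_mem_Icc {s : ℝ} (hs : s ∈ Icc (0 : ℝ) 1) (j : ℕ) :
    1 / (j + 1 + s) ∈ Icc (0 : ℝ) 1 := by
  have h0 := hs.1
  have hj : (0 : ℝ) ≤ j := by positivity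
  refine ⟨by positivity, ?_⟩
  rw [div_le_one (by positivity)]
  linarith

lemma sum_branchWeight {s : ℝ} (hs : 0 ≤ s) (n : ℕ) :
    ∑ j ∈ Finset.range n, branchWeight s j = n / (n + 1 + s) := by
  induction n with
  | zero => simp
  | succ n ih =>
    rw [Finset.sum_range_succ, ih, branchWeight]
    push_cast
    have h1 : (0 : ℝ) < n + 1 + s := by positivity
    have h2 : (0 : ℝ) < n + 2 + s := by positivity
    have h3 : (n + 1 + 1 + s : ℝ) = n + 2 + s := by ring
    rw [h3]
    field_simp
    ring

lemma sum_ofReal_branchWeight {s : ℝ} (hs : 0 ≤ s) (n : ℕ) :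
    ∑ j ∈ Finset.range n, ENNReal.ofReal (branchWeight s j) = ENNReal.ofReal (n / (n + 1 + s)) := by
  rw [← sum_branchWeight hs, ENNReal.ofReal_sum_of_nonneg]
  intro j _
  unfold branchWeight
  positivity

lemma tsum_ofReal_branchWeight_le {s : ℝ} (hs : 0 ≤ s) :
    ∑' j : ℕ, ENNReal.ofReal (branchWeight s j) ≤ 1 := by
  refine ENNReal.tsum_le_of_sum_range_le fun n => ?_
  rw [sum_ofReal_branchWeight hs, ENNReal.ofReal_le_one, div_le_one (by positivity)]
  linarith

lemma mobiusMass_mono (s : ℝ) {A B : Set ℝ} (h : A ∩ unitIrrationals ⊆ B) :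
    mobiusMass s A ≤ mobiusMass s B := by
  refine setLIntegral_mono' measurableSet_unitIrrationals fun x hx => ?_
  refine mul_le_mul_right ?_ _
  by_cases hA : x ∈ A
  · rw [indicator_of_mem hA, indicator_of_mem (h ⟨hA, hx⟩)]
  · rw [indicator_of_notMem hA]
    exact zero_le

lemma mobiusMass_zero {A : Set ℝ} (hA : MeasurableSet A) :
    mobiusMass 0 A = volume (A ∩ unitIrrationals) := by
  simp [mobiusMass, mobiusDensity, lintegral_indicator_one hA, Measure.restrict_apply hA]

lemma mobiusMass_le {s : ℝ} (hs : s ∈ Icc (0 : ℝ) 1) {A : Set ℝ} (hA : MeasurableSet A) :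
    mobiusMass s A ≤ 2 * volume (A ∩ unitIrrationals) := by
  rw [← mobiusMass_zero hA, mobiusMass, mobiusMass,
    ← lintegral_const_mul' _ _ (by simp)]
  refine setLIntegral_mono' measurableSet_unitIrrationals fun x hx => ?_
  rw [← mul_assoc]
  gcongr
  have h0 := hs.1
  have h1 := hs.2
  have hx0 := hx.1.1
  have h : mobiusDensity s x ≤ 2 := by
    have : 0 ≤ s * x := by positivity
    rw [mobiusDensity, div_le_iff₀ (by positivity)]
    nlinarith
  simpa [mobiusDensity] using ENNReal.ofReal_le_ofReal h

/-- A bound which is uniform over the Möbius densities passes to preimages under the Gauss map. -/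
lemma mobiusMass_preimage_iterate_le {A : Set ℝ} {C : ENNReal}
    (h : ∀ s ∈ Icc (0 : ℝ) 1, mobiusMass s A ≤ C) (N : ℕ) :
    ∀ s ∈ Icc (0 : ℝ) 1, mobiusMass s (gaussMap^[N] ⁻¹' A) ≤ C := by
  induction N with
  | zero => simpa using h
  | succ N ih =>
    intro s hs
    rw [mobiusMass_eq_tsum hs.1]
    calc _ ≤ ∑' j : ℕ, ENNReal.ofReal (branchWeight s j) * C := by
          gcongr with j
          refine (mobiusMass_mono _ ?_).trans (ih _ (one_div_add_mem_Icc hs j))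
          rintro y ⟨hy, hyS⟩
          simpa [gaussMap_gaussBranch j hyS] using hy
      _ ≤ 1 * C := by
          rw [ENNReal.tsum_mul_right]
          gcongr
          exact tsum_ofReal_branchWeight_le hs.1
      _ = C := one_mul C

lemma mobiusMass_le_cfA_one {s : ℝ} (hs : s ∈ Icc (0 : ℝ) 1) {b : ℝ} (hb : 1 ≤ b) :
    mobiusMass s {x | b ≤ cfA x 1} ≤ ENNReal.ofReal (2 * (1 / b)) := by
  have hb0 : 0 < b := by linarith
  refine (mobiusMass_le hs (measurableSet_le_cfA b 1)).trans ?_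
  rw [ENNReal.ofReal_mul (by norm_num), ENNReal.ofReal_ofNat]
  gcongr
  calc _ ≤ volume (Icc 0 (1 / b)) := measure_mono ?_
    _ = ENNReal.ofReal (1 / b) := by simp
  rintro x ⟨hx, ⟨h0, -⟩, -⟩
  have h : b ≤ x⁻¹ := le_trans hx (Nat.floor_le (inv_nonneg.2 h0.le))
  exact ⟨h0.le, by rw [one_div]; exact (le_inv_comm₀ hb0 h0).1 h⟩

lemma weight_le_exp {s b : ℝ} (hs : 0 ≤ s) (hb : 1 ≤ b) {n : ℕ} (hn : n + 1 = ⌈b⌉₊) :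
    (n / (n + 1 + s) : ℝ) ≤ Real.exp (-(1 / (2 * b))) := by
  have hb' : (n + 1 : ℝ) ≤ 2 * b := by
    have := Nat.ceil_lt_add_one (by linarith : 0 ≤ b)
    rw [← hn] at this
    push_cast at this
    linarith
  have h1 : (n / (n + 1 + s) : ℝ) ≤ n / (n + 1) := by
    exact div_le_div_of_nonneg_left (by positivity) (by positivity) (by linarith)
  have h2 : (n / (n + 1) : ℝ) = -(1 / (n + 1)) + 1 := by field_simp; ring
  have h3 : 1 / (2 * b) ≤ 1 / (n + 1 : ℝ) := one_div_le_one_div_of_le (by positivity) hb'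
  have := Real.add_one_le_exp (-(1 / (2 * b)))
  linarith

lemma mobiusMass_cfA_lt_le (m : ℕ) : ∀ b : ℕ → ℝ, (∀ i, 1 ≤ b i) → ∀ s ∈ Icc (0 : ℝ) 1,
    mobiusMass s {x | ∀ i < m, (cfA x (i + 1) : ℝ) < b i} ≤
      2 * ENNReal.ofReal (Real.exp (-∑ i ∈ Finset.range m, 1 / (2 * b i))) := by
  induction m with
  | zero =>
    intro b hb s hs
    simpa [volume_unitIrrationals] using mobiusMass_le hs MeasurableSet.univ
  | succ m ih =>
    intro b hb s hs
    obtain ⟨n, hn⟩ : ∃ n, ⌈b 0⌉₊ = n + 1 :=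
      Nat.exists_eq_add_of_le' (Nat.one_le_ceil_iff.2 (by linarith [hb 0]))
    have hlt (j : ℕ) : ((j + 1 : ℕ) : ℝ) < b 0 ↔ j < n := by
      rw [← Nat.lt_ceil, hn, Nat.succ_lt_succ_iff]
    set C := 2 * ENNReal.ofReal (Real.exp (-∑ i ∈ Finset.range m, 1 / (2 * b (i + 1)))) with hC
    have hpre (j : ℕ) (y : ℝ) (hy : y ∈ unitIrrationals)
        (h : ∀ i < m + 1, (cfA (gaussBranch j y) (i + 1) : ℝ) < b i) :
        j < n ∧ ∀ i < m, (cfA y (i + 1) : ℝ) < b (i + 1) := by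
      constructor
      · have := h 0 (by omega)
        rwa [zero_add, cfA_gaussBranch_one j hy, hlt] at this
      · intro i hi
        have := h (i + 1) (by omega)
        have hc := cfA_iterate (gaussBranch j y) 1 i
        rw [Function.iterate_one, gaussMap_gaussBranch j hy] at hc
        rwa [hc]
    rw [mobiusMass_eq_tsum hs.1, tsum_eq_sum (s := Finset.range n)]
    · calc _ ≤ ∑ j ∈ Finset.range n, ENNReal.ofReal (branchWeight s j) * C := by
            gcongr with j
            refine (mobiusMass_mono _ ?_).trans
              (ih (fun i => b (i + 1)) (fun i => hb _) _ (one_div_add_mem_Icc hs j))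
            rintro y ⟨hy, hyS⟩
            exact (hpre j y hyS hy).2
        _ = ENNReal.ofReal (n / (n + 1 + s)) * C := by
            rw [← Finset.sum_mul, sum_ofReal_branchWeight hs.1]
        _ ≤ ENNReal.ofReal (Real.exp (-(1 / (2 * b 0)))) * C := by
            gcongr
            exact weight_le_exp hs.1 (hb 0) hn.symm
        _ = _ := by
            rw [hC, mul_left_comm, ← ENNReal.ofReal_mul (Real.exp_nonneg _), ← Real.exp_add,
              Finset.sum_range_succ', neg_add, add_comm]
    · intro j hj
      have h0 : mobiusMass (1 / (j + 1 + s)) ∅ = 0 := by simp [mobiusMass]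
      rw [← nonpos_iff_eq_zero, ← mul_zero (ENNReal.ofReal (branchWeight s j)), ← h0]
      gcongr
      refine mobiusMass_mono _ ?_
      rintro y ⟨hy, hyS⟩
      exact hj (Finset.mem_range.2 (hpre j y hyS hy).1)

lemma volume_le_cfA_le {b : ℝ} (hb : 1 ≤ b) (n : ℕ) :
    volume ({x | b ≤ cfA x (n + 1)} ∩ unitIrrationals) ≤ ENNReal.ofReal (2 * (1 / b)) := by
  rw [← mobiusMass_zero (measurableSet_le_cfA b (n + 1))]
  have h := mobiusMass_preimage_iterate_le (fun s hs => mobiusMass_le_cfA_one hs hb) n 0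
    ⟨le_rfl, zero_le_one⟩
  have he : gaussMap^[n] ⁻¹' {x | b ≤ cfA x 1} = {x | b ≤ cfA x (n + 1)} := by
    ext x
    have := cfA_iterate x n 0
    simp only [zero_add] at this
    simp [this]
  rwa [he] at h

lemma volume_forall_cfA_lt_eq_zero {φ : ℕ → ℝ} (hφ : ∀ n, 1 ≤ φ n)
    (hsum : ¬ Summable fun n => 1 / φ n) (N : ℕ) :
    volume ({x | ∀ n, N ≤ n → (cfA x (n + 1) : ℝ) < φ (n + 1)} ∩ unitIrrationals) = 0 := by
  let b : ℕ → ℝ := fun i => φ (i + N + 1)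
  have hb (i : ℕ) : 1 ≤ b i := hφ _
  have hbsum : ¬ Summable fun i => 1 / (2 * b i) := by
    intro h
    refine hsum ((summable_nat_add_iff (N + 1)).1 ((h.mul_left 2).congr fun i => ?_))
    have : 0 < b i := by linarith [hb i]
    simp only [← add_assoc]
    change 2 * (1 / (2 * b i)) = 1 / b i
    field_simp
  have hdiv := (not_summable_iff_tendsto_nat_atTop_of_nonneg
    (fun i => by have := hb i; positivity)).1 hbsum
  have hlim : Tendsto
      (fun m => 2 * ENNReal.ofReal (Real.exp (-∑ i ∈ Finset.range m, 1 / (2 * b i))))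
      atTop (nhds 0) := by
    simpa using ENNReal.Tendsto.const_mul (a := 2)
      (ENNReal.tendsto_ofReal (Real.tendsto_exp_neg_atTop_nhds_zero.comp hdiv)) (by simp)
  refine le_antisymm (ge_of_tendsto' hlim fun m => ?_) zero_le
  have h := mobiusMass_preimage_iterate_le (mobiusMass_cfA_lt_le m b hb) N 0 ⟨le_rfl, zero_le_one⟩
  have hm : MeasurableSet (gaussMap^[N] ⁻¹' {x | ∀ i < m, (cfA x (i + 1) : ℝ) < b i}) := by
    refine measurable_gaussMap.iterate N ?_
    have : {x | ∀ i < m, (cfA x (i + 1) : ℝ) < b i} = ⋂ i < m, {x | b i ≤ cfA x (i + 1)}ᶜ := by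
      ext x
      simp
    rw [this]
    exact .iInter fun i => .iInter fun _ => (measurableSet_le_cfA _ _).compl
  rw [mobiusMass_zero hm] at h
  refine (measure_mono (inter_subset_inter_left _ fun x hx i hi => ?_)).trans h
  rw [cfA_iterate]
  exact hx (i + N) (by omega)

lemma E₁_subset_unitIrrationals (φ : ℕ → ℝ) : E₁ φ ⊆ unitIrrationals := fun _ ⟨hx, hirr, _⟩ =>
  ⟨⟨lt_of_le_of_ne hx.1 hirr.ne_zero.symm, hx.2⟩, hirr⟩

/-- **Theorem (Borel–Bernstein).** Let `φ : ℕ → [1, ∞)`. If `∑_n 1/φ(n)` converges then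
`leb(E₁(φ)) = 0`, and if it diverges then `leb(E₁(φ)) = 1`. -/
theorem borel_bernstein (φ : ℕ → ℝ) (hφ : ∀ n, 1 ≤ φ n) :
    (Summable (fun n : ℕ => 1 / φ n) → volume (E₁ φ) = 0) ∧
    (¬ Summable (fun n : ℕ => 1 / φ n) → volume (E₁ φ) = 1) := by
  constructor
  · intro hsum
    have hfin : ∑' n, volume ({x | φ (n + 1) ≤ cfA x (n + 1)} ∩ unitIrrationals) ≠ ⊤ := by
      refine ne_top_of_le_ne_top ?_ (ENNReal.tsum_le_tsum fun n => volume_le_cfA_le (hφ (n + 1)) n)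
      exact (((summable_nat_add_iff 1).2 hsum).mul_left 2).tsum_ofReal_ne_top
    refine measure_mono_null ?_ (measure_setOfPred_frequently_eq_zero hfin)
    intro x hx
    have hS := E₁_subset_unitIrrationals φ hx
    refine Nat.frequently_atTop_iff_infinite.2 fun hf => hx.2.2 ?_
    refine (hf.image (· + 1)).subset ?_
    rintro n ⟨hn, hle⟩
    obtain ⟨k, rfl⟩ := Nat.exists_eq_add_of_le' hn
    exact ⟨k, ⟨hle, hS⟩, rfl⟩
  · intro hsum
    rw [← volume_unitIrrationals]
    refine le_antisymm (measure_mono (E₁_subset_unitIrrationals φ)) ?_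
    have hnull : volume (⋃ N, {x | ∀ n, N ≤ n → (cfA x (n + 1) : ℝ) < φ (n + 1)} ∩
        unitIrrationals) = 0 :=
      measure_iUnion_null (volume_forall_cfA_lt_eq_zero hφ hsum)
    refine (measure_mono fun x hx => ?_).trans
      ((measure_union_le (E₁ φ) _).trans_eq (by rw [hnull, add_zero]))
    by_cases hE : x ∈ E₁ φ
    · exact Or.inl hE
    · refine Or.inr ?_
      have hf : {n : ℕ | 1 ≤ n ∧ φ n ≤ (cfA x n : ℝ)}.Finite := by
        by_contra hinf
        exact hE ⟨⟨hx.1.1.le, hx.1.2⟩, hx.2, hinf⟩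
      obtain ⟨N, hN⟩ := hf.bddAbove
      refine mem_iUnion.2 ⟨N, fun n hn => ?_, hx⟩
      by_contra! hle
      have := hN ⟨Nat.le_add_left 1 n, hle⟩
      omega
end
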